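/- Let n ≥ 1 and let u : ℝ^{2n} → ℝ be a smooth non-constant function. Then there exists a constant C > 0 (depending only on u) such that for every smooth compactly supported f : ℝ^{2n} → ℝ with ∫ f dvol = 0 and ‖f‖_∞ + ‖f‖_{L¹} ≤ 1, there exist a natural number ℓ, real numbers c_1, …, c_ℓ with ∑_{i=1}^ℓ |c_i| ≤ C, and compactly supported volume-preserving diffeomorphisms Φ_{1,+}, Φ_{1,-}, …, Φ_{ℓ,+}, Φ_{ℓ,-} of ℝ^{2n} such that f = ∑_{i=1}^ℓ c_i · (u ∘ Φ_{i,+} − u ∘ Φ_{i,-}). -/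

import Mathlib

open MeasureTheory

/-- A compactly supported volume-preserving diffeomorphism of `ℝ^d`: a smooth
diffeomorphism that preserves Lebesgue measure and equals the identity outside
some compact set. -/
def IsCompSuppVolDiffeo (d : ℕ)
    (Φ : EuclideanSpace ℝ (Fin d) → EuclideanSpace ℝ (Fin d)) : Prop :=
  ContDiff ℝ (⊤ : ℕ∞) Φ ∧
  (∃ Ψ : EuclideanSpace ℝ (Fin d) → EuclideanSpace ℝ (Fin d),
    ContDiff ℝ (⊤ : ℕ∞) Ψ ∧ Function.LeftInverse Ψ Φ ∧ Function.RightInverse Ψ Φ) ∧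
  MeasurePreserving Φ volume volume ∧
  (∃ K : Set (EuclideanSpace ℝ (Fin d)), IsCompact K ∧ ∀ x ∉ K, Φ x = x)

namespace Flexibility

open Set

/-- Euclidean space of dimension `d`. -/
abbrev V (d : ℕ) := EuclideanSpace ℝ (Fin d)

variable {d : ℕ}

theorem diffeo_id : IsCompSuppVolDiffeo d id :=
  ⟨contDiff_id, ⟨id, contDiff_id, fun _ => rfl, fun _ => rfl⟩, MeasurePreserving.id _,
    ∅, isCompact_empty, fun _ _ => rfl⟩

theorem diffeo_comp {Φ Ψ : V d → V d} (hΦ : IsCompSuppVolDiffeo d Φ)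
    (hΨ : IsCompSuppVolDiffeo d Ψ) : IsCompSuppVolDiffeo d (Φ ∘ Ψ) := by
  obtain ⟨h1, ⟨Φ', h2, h3, h4⟩, h5, K, hK, h6⟩ := hΦ
  obtain ⟨g1, ⟨Ψ', g2, g3, g4⟩, g5, L, hL, g6⟩ := hΨ
  refine ⟨h1.comp g1, ⟨Ψ' ∘ Φ', g2.comp h2, h3.comp g3, h4.comp g4⟩, h5.comp g5, K ∪ L,
    hK.union hL, fun x hx => ?_⟩
  simp only [mem_union, not_or] at hx
  simp [g6 x hx.2, h6 x hx.1]

theorem diffeo_inv {Φ : V d → V d} (hΦ : IsCompSuppVolDiffeo d Φ) :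
    ∃ Ψ, IsCompSuppVolDiffeo d Ψ ∧ Function.LeftInverse Ψ Φ ∧ Function.RightInverse Ψ Φ := by
  obtain ⟨h1, ⟨Φ', h2, h3, h4⟩, h5, K, hK, h6⟩ := hΦ
  refine ⟨Φ', ⟨h2, ⟨Φ, h1, h4, h3⟩, ⟨h2.continuous.measurable, ?_⟩, K, hK, fun x hx => ?_⟩, h3, h4⟩
  · conv_lhs => rw [← h5.map_eq]
    rw [Measure.map_map h2.continuous.measurable h1.continuous.measurable, h3.comp_eq_id,
      Measure.map_id]
  · conv_lhs => rw [← h6 x hx]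
    exact h3 x

/-- `Φ` conjugated by the affine map `x ↦ p + L x`. -/
def conj (p : V d) (L : V d ≃L[ℝ] V d) (Φ : V d → V d) (x : V d) : V d :=
  L.symm (Φ (p + L x) - p)

theorem diffeo_conj {Φ : V d → V d} (hΦ : IsCompSuppVolDiffeo d Φ) (p : V d)
    (L : V d ≃L[ℝ] V d) : IsCompSuppVolDiffeo d (conj p L Φ) := by
  obtain ⟨h1, ⟨Φ', h2, h3, h4⟩, h5, K, hK, h6⟩ := hΦ
  have hT : ContDiff ℝ (⊤ : ℕ∞) (fun x => p + L x) := contDiff_const.add L.contDiff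
  have hS : ContDiff ℝ (⊤ : ℕ∞) (fun x => L.symm (x - p)) :=
    L.symm.contDiff.comp (contDiff_id.sub contDiff_const)
  refine ⟨hS.comp (h1.comp hT), ⟨conj p L Φ', hS.comp (h2.comp hT), ?_, ?_⟩, ?_, 
    (fun x => L.symm (x - p)) '' K, hK.image hS.continuous, fun x hx => ?_⟩
  · intro x; simp [conj, h3 _]
  · intro x; simp [conj, h4 _]
  · have e1 : Measure.map (fun x => L x) (volume : Measure (V d)) =
        ENNReal.ofReal |(LinearMap.det (L : V d →ₗ[ℝ] V d))⁻¹| • volume :=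
      Measure.map_linearMap_addHaar_eq_smul_addHaar volume
        (LinearEquiv.isUnit_det' L.toLinearEquiv).ne_zero
    set c := ENNReal.ofReal |(LinearMap.det (L : V d →ₗ[ℝ] V d))⁻¹| with hc
    have hmL : Measurable (fun x => L x) := L.continuous.measurable
    have hmS : Measurable (fun x => L.symm x) := L.symm.continuous.measurable
    have hmΦ : Measurable Φ := h5.measurable
    have hmp : Measurable (fun x : V d => p + x) := by fun_prop
    have hmq : Measurable (fun x : V d => x - p) := by fun_prop
    have e2 : Measure.map (fun x : V d => p + x) volume = volume := map_add_left_eq_self _ p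
    have e3 : Measure.map (fun x : V d => x - p) volume = volume := by
      simpa [sub_eq_add_neg] using map_add_right_eq_self (volume : Measure (V d)) (-p)
    refine ⟨(hS.comp (h1.comp hT)).continuous.measurable, ?_⟩
    have : conj p L Φ = (fun x => L.symm x) ∘ (fun x => x - p) ∘ Φ ∘ (fun x => p + x) ∘
      (fun x => L x) := by ext x; simp [conj]
    rw [this, ← Measure.map_map hmS (by fun_prop), ← Measure.map_map hmq (by fun_prop),
      ← Measure.map_map h5.measurable (by fun_prop), ← Measure.map_map hmp hmL, e1,
      Measure.map_smul, e2, Measure.map_smul, h5.map_eq, Measure.map_smul, e3,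
      ← e1, Measure.map_map hmS hmL]
    simp [Function.comp_def]
  · have : p + L x ∉ K := fun h => hx ⟨_, h, by simp⟩
    simp [conj, h6 _ this]

/-- `f` is a combination of differences of pull-backs of `u`, with coefficient sum at most `C`. -/
def Rep (u : V d → ℝ) (C : ℝ) (f : V d → ℝ) : Prop :=
  ∃ (ι : Type) (_ : Fintype ι) (c : ι → ℝ) (P M : ι → V d → V d), ∑ i, |c i| ≤ C ∧
    (∀ i, IsCompSuppVolDiffeo d (P i)) ∧ (∀ i, IsCompSuppVolDiffeo d (M i)) ∧
    ∀ x, f x = ∑ i, c i * (u (P i x) - u (M i x))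

namespace Rep

variable {u f g : V d → ℝ} {C C' : ℝ}

theorem mono (h : Rep u C f) (hC : C ≤ C') : Rep u C' f := by
  obtain ⟨ι, i1, c, P, M, h1, h2⟩ := h
  exact ⟨ι, i1, c, P, M, h1.trans hC, h2⟩

theorem congr (h : Rep u C f) (hfg : ∀ x, g x = f x) : Rep u C g := by
  rwa [show g = f from funext hfg]

theorem zero (u : V d → ℝ) : Rep u 0 (fun _ => 0) :=
  ⟨Empty, inferInstance, fun _ => 0, fun _ => id, fun _ => id, by simp, by simp, by simp, by simp⟩

theorem single {P M : V d → V d} (hP : IsCompSuppVolDiffeo d P) (hM : IsCompSuppVolDiffeo d M) :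
    Rep u 1 (fun x => u (P x) - u (M x)) :=
  ⟨Unit, inferInstance, fun _ => 1, fun _ => P, fun _ => M, by simp, by simp [hP], by simp [hM],
    by simp⟩

theorem add (hf : Rep u C f) (hg : Rep u C' g) : Rep u (C + C') (fun x => f x + g x) := by
  obtain ⟨ι, i1, c, P, M, h1, h2, h3, h4⟩ := hf
  obtain ⟨ι', i1', c', P', M', h1', h2', h3', h4'⟩ := hg
  refine ⟨ι ⊕ ι', inferInstance, Sum.elim c c', Sum.elim P P', Sum.elim M M', ?_, ?_, ?_, ?_⟩
  · simp only [Fintype.sum_sum_type, Sum.elim_inl, Sum.elim_inr]; gcongr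
  · rintro (i | i) <;> simp [h2, h2']
  · rintro (i | i) <;> simp [h3, h3']
  · intro x; simp [h4, h4']

theorem smul (hf : Rep u C f) (a : ℝ) : Rep u (|a| * C) (fun x => a * f x) := by
  obtain ⟨ι, i1, c, P, M, h1, h2, h3, h4⟩ := hf
  refine ⟨ι, i1, fun i => a * c i, P, M, ?_, h2, h3, fun x => ?_⟩
  · simp only [abs_mul, ← Finset.mul_sum]; gcongr
  · simp [h4, Finset.mul_sum, mul_assoc]

theorem neg (hf : Rep u C f) : Rep u C (fun x => - f x) := by
  simpa using hf.smul (-1)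

theorem sub (hf : Rep u C f) (hg : Rep u C' g) : Rep u (C + C') (fun x => f x - g x) := by
  simpa [sub_eq_add_neg] using hf.add hg.neg

theorem sum {κ : Type*} (s : Finset κ) {F : κ → V d → ℝ} {c : κ → ℝ}
    (h : ∀ k ∈ s, Rep u (c k) (F k)) : Rep u (∑ k ∈ s, c k) (fun x => ∑ k ∈ s, F k x) := by
  classical
  induction s using Finset.induction_on with
  | empty => simpa using zero u
  | insert k s hk ih =>
    simp only [Finset.sum_insert hk]
    exact (h k (by simp)).add (ih fun k' hk' => h k' (by simp [hk']))

theorem comp (hf : Rep u C f) {T : V d → V d} (hT : IsCompSuppVolDiffeo d T) :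
    Rep u C (fun x => f (T x)) := by
  obtain ⟨ι, i1, c, P, M, h1, h2, h3, h4⟩ := hf
  exact ⟨ι, i1, c, fun i => P i ∘ T, fun i => M i ∘ T, h1, fun i => diffeo_comp (h2 i) hT,
    fun i => diffeo_comp (h3 i) hT, fun x => h4 _⟩

theorem of_comp {Φ : V d → V d} (hΦ : IsCompSuppVolDiffeo d Φ)
    (hf : Rep (fun x => u (Φ x)) C f) : Rep u C f := by
  obtain ⟨ι, i1, c, P, M, h1, h2, h3, h4⟩ := hf
  exact ⟨ι, i1, c, fun i => Φ ∘ P i, fun i => Φ ∘ M i, h1, fun i => diffeo_comp hΦ (h2 i),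
    fun i => diffeo_comp hΦ (h3 i), fun x => h4 _⟩

theorem affine {a b : ℝ} (hf : Rep (fun x => a * u x + b) C f) : Rep u (|a| * C) f := by
  obtain ⟨ι, i1, c, P, M, h1, h2, h3, h4⟩ := hf
  refine ⟨ι, i1, fun i => a * c i, P, M, ?_, h2, h3, fun x => ?_⟩
  · simp only [abs_mul, ← Finset.mul_sum]; gcongr
  · rw [h4]; refine Finset.sum_congr rfl fun i _ => by ring

theorem of_conj {p : V d} {L : V d ≃L[ℝ] V d}
    (hf : Rep (fun x => u (p + L x)) C (fun x => f (p + L x))) : Rep u C f := by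
  obtain ⟨ι, i1, c, P, M, h1, h2, h3, h4⟩ := hf
  refine ⟨ι, i1, c, fun i => conj (-(L.symm p)) L.symm (P i),
    fun i => conj (-(L.symm p)) L.symm (M i), h1, fun i => diffeo_conj (h2 i) _ _,
    fun i => diffeo_conj (h3 i) _ _, fun x => ?_⟩
  have := h4 (L.symm (x - p))
  simp only [ContinuousLinearEquiv.apply_symm_apply, add_sub_cancel] at this
  rw [this]
  have e : ∀ y, p + L y = L (y + L.symm p) := fun y => by simp [add_comm]
  have e' : L.symm (x - p) = -L.symm p + L.symm x := by simp [sub_eq_add_neg, add_comm]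
  simp [conj, e, e']
  
end Rep

/-- Every zero-mean test function is represented with cost controlled by its sup and `L¹` norms. -/
def Flex (u : V d → ℝ) : Prop :=
  ∃ C : ℝ, 0 < C ∧ ∀ f : V d → ℝ, ContDiff ℝ (⊤ : ℕ∞) f → HasCompactSupport f →
    (∫ x, f x) = 0 → ∀ A : ℝ, (∀ x, |f x| ≤ A) → Rep u (C * (A + ∫ x, |f x|)) f

theorem Flex.of_comp {u : V d → ℝ} {Φ : V d → V d} (hΦ : IsCompSuppVolDiffeo d Φ)
    (h : Flex (fun x => u (Φ x))) : Flex u := by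
  obtain ⟨C, hC, h⟩ := h
  exact ⟨C, hC, fun f h1 h2 h3 A hA => (h f h1 h2 h3 A hA).of_comp hΦ⟩

theorem Flex.affine {u : V d → ℝ} {a b : ℝ} (ha : a ≠ 0) (h : Flex (fun x => a * u x + b)) :
    Flex u := by
  obtain ⟨C, hC, h⟩ := h
  refine ⟨|a| * C, by positivity, fun f h1 h2 h3 A hA => ?_⟩
  simpa [mul_assoc] using (h f h1 h2 h3 A hA).affine

theorem Flex.of_conj {u : V d → ℝ} {p : V d} {L : V d ≃L[ℝ] V d}
    (h : Flex (fun x => u (p + L x))) : Flex u := by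
  obtain ⟨C, hC, h⟩ := h
  set c := |(LinearMap.det (L : V d →ₗ[ℝ] V d))⁻¹| with hc
  have hint : ∀ g : V d → ℝ, ∫ x, g (p + L x) = c * ∫ x, g x := by
    intro g
    rw [← integral_add_left_eq_self g p]
    have e1 : Measure.map (fun x => L x) (volume : Measure (V d)) =
        ENNReal.ofReal c • volume :=
      Measure.map_linearMap_addHaar_eq_smul_addHaar volume
        (LinearEquiv.isUnit_det' L.toLinearEquiv).ne_zero
    have := (L.toHomeomorph.measurableEmbedding).integral_map (μ := volume) (fun y => g (p + y))
    have e2 : ∫ y, g (p + y) ∂(Measure.map (fun x => L x) (volume : Measure (V d))) =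
      ∫ x, g (p + L x) := this
    rw [← e2, e1, integral_smul_measure, ENNReal.toReal_ofReal (abs_nonneg _), smul_eq_mul]
  refine ⟨C * (1 + c), by positivity, fun f h1 h2 h3 A hA => ?_⟩
  have hT : ContDiff ℝ (⊤ : ℕ∞) (fun x => p + L x) := contDiff_const.add L.contDiff
  have hA0 : 0 ≤ A := (abs_nonneg _).trans (hA 0)
  refine Rep.of_conj ((h (fun x => f (p + L x)) (h1.comp hT) ?_ ?_ A fun x => hA _).mono ?_)
  · exact h2.comp_homeomorph (L.toHomeomorph.trans (Homeomorph.addLeft p))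
  · rw [hint f, h3, mul_zero]
  · rw [hint (fun x => |f x|), mul_assoc]
    have : 0 ≤ ∫ x, |f x| := integral_nonneg fun x => abs_nonneg _
    have hc0 : 0 ≤ c := abs_nonneg _
    gcongr
    nlinarith [mul_nonneg hc0 hA0]

/-- The `i`-th standard basis vector. -/
noncomputable def ev (i : Fin d) : V d := EuclideanSpace.single i (1 : ℝ)

theorem ev_apply (i k : Fin d) : ev i k = if k = i then 1 else 0 := by
  simp [ev]

@[simp] theorem ev_same (i : Fin d) : ev i i = 1 := by simp [ev_apply]

theorem ev_ne {i k : Fin d} (h : k ≠ i) : ev i k = 0 := by simp [ev_apply, h]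

@[simp] theorem norm_ev (i : Fin d) : ‖(ev i : V d)‖ = 1 := by simp [ev]

/-- The `i`-th partial derivative. -/
noncomputable def pd (i : Fin d) (f : V d → ℝ) (x : V d) : ℝ := fderiv ℝ f x (ev i)

theorem contDiff_coord (i : Fin d) : ContDiff ℝ (⊤ : ℕ∞) (fun x : V d => x i) :=
  (EuclideanSpace.proj i : V d →L[ℝ] ℝ).contDiff

theorem diff_of_smooth {E F : Type*} [NormedAddCommGroup E] [NormedSpace ℝ E]
    [NormedAddCommGroup F] [NormedSpace ℝ F] {f : E → F} (hf : ContDiff ℝ (⊤ : ℕ∞) f) :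
    Differentiable ℝ f := hf.differentiable (by simp)

theorem contDiff_pd {f : V d → ℝ} (hf : ContDiff ℝ (⊤ : ℕ∞) f) (i : Fin d) :
    ContDiff ℝ (⊤ : ℕ∞) (pd i f) :=
  (hf.fderiv_right (m := (⊤ : ℕ∞)) (by simp)).clm_apply contDiff_const

theorem hasDerivAt_line {f : V d → ℝ} (hf : Differentiable ℝ f) (i : Fin d) (x : V d) (t : ℝ) :
    HasDerivAt (fun t : ℝ => f (x + t • ev i)) (pd i f (x + t • ev i)) t := by
  have h1 : HasDerivAt (fun t : ℝ => x + t • ev i) (ev i) t := by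
    simpa using ((hasDerivAt_id t).smul_const (ev i)).const_add x
  exact (hf (x + t • ev i)).hasFDerivAt.comp_hasDerivAt t h1

theorem pd_eq {f : V d → ℝ} (hf : Differentiable ℝ f) {i : Fin d} {x : V d} {a : ℝ}
    (h : HasDerivAt (fun t : ℝ => f (x + t • ev i)) a 0) : pd i f x = a := by
  have := hasDerivAt_line hf i x 0
  simp only [zero_smul, add_zero] at this
  exact this.unique h

theorem pd_add {f g : V d → ℝ} (hf : Differentiable ℝ f) (hg : Differentiable ℝ g) (i : Fin d)
    (x : V d) : pd i (fun x => f x + g x) x = pd i f x + pd i g x := by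
  simp [pd, fderiv_fun_add (hf x) (hg x)]

theorem pd_sub {f g : V d → ℝ} (hf : Differentiable ℝ f) (hg : Differentiable ℝ g) (i : Fin d)
    (x : V d) : pd i (fun x => f x - g x) x = pd i f x - pd i g x := by
  simp [pd, fderiv_fun_sub (hf x) (hg x)]

theorem pd_mul {f g : V d → ℝ} (hf : Differentiable ℝ f) (hg : Differentiable ℝ g) (i : Fin d)
    (x : V d) : pd i (fun x => f x * g x) x = f x * pd i g x + g x * pd i f x := by
  simp [pd, fderiv_fun_mul (hf x) (hg x)]

theorem pd_const_mul {f : V d → ℝ} (hf : Differentiable ℝ f) (i : Fin d) (a : ℝ)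
    (x : V d) : pd i (fun x => a * f x) x = a * pd i f x := by
  simp [pd, fderiv_const_mul (hf x)]

theorem pd_neg (f : V d → ℝ) (i : Fin d)
    (x : V d) : pd i (fun x => - f x) x = - pd i f x := by
  simp [pd]

theorem pd_coord_same {φ : ℝ → ℝ} (hφ : Differentiable ℝ φ) (i : Fin d) (x : V d) :
    pd i (fun x => φ (x i)) x = deriv φ (x i) := by
  have hc := diff_of_smooth (contDiff_coord i)
  refine pd_eq (hφ.comp hc) ?_
  have h := (hφ (x i)).hasDerivAt
  have h1 : HasDerivAt (fun t : ℝ => x i + t) 1 0 := by simpa using (hasDerivAt_id (0:ℝ)).const_add (x i)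
  have h2 : HasDerivAt φ (deriv φ (x i)) (x i + 0) := by simpa using h
  simpa [Function.comp_def] using h2.comp 0 h1

theorem pd_coord_ne {φ : ℝ → ℝ} (hφ : Differentiable ℝ φ) {i k : Fin d} (hik : k ≠ i) (x : V d) :
    pd i (fun x => φ (x k)) x = 0 := by
  have hc := diff_of_smooth (contDiff_coord k)
  refine pd_eq (hφ.comp hc) ?_
  simpa [ev_ne hik] using hasDerivAt_const (0 : ℝ) (φ (x k))

theorem pd_comm {f : V d → ℝ} (hf : ContDiff ℝ (⊤ : ℕ∞) f) (i j : Fin d) (x : V d) :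
    pd i (pd j f) x = pd j (pd i f) x := by
  have hs : IsSymmSndFDerivAt ℝ f x := hf.contDiffAt.isSymmSndFDerivAt (by
    rw [minSmoothness_of_isRCLikeNormedField]; exact WithTop.coe_le_coe.2 (le_top (a := (2 : ℕ∞))))
  have hd : DifferentiableAt ℝ (fderiv ℝ f) x :=
    diff_of_smooth (hf.fderiv_right (m := (⊤ : ℕ∞)) (by simp)) x
  have key : ∀ k l : Fin d, pd k (pd l f) x = fderiv ℝ (fderiv ℝ f) x (ev k) (ev l) := by
    intro k l
    change fderiv ℝ (fun y => fderiv ℝ f y (ev l)) x (ev k) = _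
    rw [fderiv_clm_apply hd (by fun_prop)]
    simp
  rw [key, key, hs]

theorem abs_sub_le_of_pd {f : V d → ℝ} (hf : Differentiable ℝ f) {i : Fin d} {c : ℝ}
    (h : ∀ x, |pd i f x| ≤ c) (x : V d) (t : ℝ) : |f (x + t • ev i) - f x| ≤ c * |t| := by
  have := Convex.norm_image_sub_le_of_norm_hasDerivWithin_le (f := fun t : ℝ => f (x + t • ev i))
    (s := univ) (x := 0) (y := t) (C := c)
    (fun s _ => (hasDerivAt_line hf i x s).hasDerivWithinAt) (fun s _ => h _) convex_univ
    (mem_univ _) (mem_univ _)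
  simpa using this

theorem hasCompactSupport_pd {f : V d → ℝ} (hf : HasCompactSupport f) (i : Fin d) :
    HasCompactSupport (pd i f) := by
  refine (hf.fderiv (𝕜 := ℝ)).comp_left (g := fun L => L (ev i)) (by simp)

theorem pd_eq_zero {f : V d → ℝ} {i : Fin d} {x : V d} (hx : x ∉ tsupport f) : pd i f x = 0 := by
  have := fderiv_of_notMem_tsupport (𝕜 := ℝ) hx
  simp [pd, this]

/-- A bijective smooth map with invertible derivative has a smooth inverse. -/
theorem exists_smooth_inverse {P : V d → V d} (hP : ContDiff ℝ (⊤ : ℕ∞) P)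
    (hb : Function.Bijective P) (hdet : ∀ x, (fderiv ℝ P x).det ≠ 0) :
    ∃ Q : V d → V d, ContDiff ℝ (⊤ : ℕ∞) Q ∧ Function.LeftInverse Q P ∧
      Function.RightInverse Q P := by
  let f' : V d → V d ≃L[ℝ] V d := fun x =>
    (fderiv ℝ P x).toContinuousLinearEquivOfDetNeZero (hdet x)
  have hs : ∀ x, HasStrictFDerivAt P (f' x : V d →L[ℝ] V d) x := fun x => by
    simpa [f'] using hP.contDiffAt.hasStrictFDerivAt (by simp)
  have ho := isOpenMap_of_hasStrictFDerivAt_equiv hs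
  let H : V d ≃ₜ V d := (Equiv.ofBijective P hb).toHomeomorphOfContinuousOpen hP.continuous ho
  exact ⟨H.symm, H.contDiff_symm (fun a => (hs a).hasFDerivAt) hP, H.symm_apply_apply,
    H.apply_symm_apply⟩

/-- Two diffeomorphisms with the same Jacobian determinant differ by a volume-preserving one. -/
theorem exists_diffeo_of_pair {P Q : V d → V d} (hP : ContDiff ℝ (⊤ : ℕ∞) P)
    (hQ : ContDiff ℝ (⊤ : ℕ∞) Q) (hPb : Function.Bijective P) (hQb : Function.Bijective Q)
    (hdet : ∀ x, (fderiv ℝ P x).det ≠ 0) (heq : ∀ x, (fderiv ℝ Q x).det = (fderiv ℝ P x).det)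
    {K : Set (V d)} (hK : IsCompact K) (hfix : ∀ x ∉ K, P x = x ∧ Q x = x) :
    ∃ Φ, IsCompSuppVolDiffeo d Φ ∧ ∀ y, Φ (P y) = Q y := by
  obtain ⟨P', hP', hl, hr⟩ := exists_smooth_inverse hP hPb hdet
  obtain ⟨Q', hQ', hl', hr'⟩ := exists_smooth_inverse hQ hQb (fun x => by rw [heq]; exact hdet x)
  refine ⟨Q ∘ P', ⟨hQ.comp hP', ⟨P ∘ Q', hP.comp hQ', ?_, ?_⟩, ?_, K, hK, ?_⟩, ?_⟩
  · intro x; simp [hl' _, hr _]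
  · intro x; simp [hr' _, hl _]
  · refine ⟨(hQ.comp hP').continuous.measurable, Measure.ext fun s hs => ?_⟩
    rw [Measure.map_apply (hQ.comp hP').continuous.measurable hs]
    have hA : MeasurableSet (Q ⁻¹' s) := hQ.continuous.measurable hs
    have e1 : (Q ∘ P') ⁻¹' s = P '' (Q ⁻¹' s) := by
      rw [preimage_comp, image_eq_preimage_of_inverse hl hr]
    have e2 : s = Q '' (Q ⁻¹' s) := (image_preimage_eq s hQb.surjective).symm
    conv_rhs => rw [e2]
    rw [e1, ← lintegral_abs_det_fderiv_eq_addHaar_image volume hA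
      (fun x _ => (diff_of_smooth hP x).hasFDerivAt.hasFDerivWithinAt) hPb.injective.injOn,
      ← lintegral_abs_det_fderiv_eq_addHaar_image volume hA
      (fun x _ => (diff_of_smooth hQ x).hasFDerivAt.hasFDerivWithinAt) hQb.injective.injOn]
    simp [heq]
  · intro x hx
    have : P' x = x := by conv_lhs => rw [← (hfix x hx).1]; 
                          exact hl x
    simp [this, (hfix x hx).2]
  · intro y; simp [hl y]

/-- The shear `x ↦ x + h(x) e_j`. -/
noncomputable def shear (j : Fin d) (h : V d → ℝ) (x : V d) : V d := x + h x • ev j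

theorem shear_smooth {h : V d → ℝ} (hs : ContDiff ℝ (⊤ : ℕ∞) h) (j : Fin d) :
    ContDiff ℝ (⊤ : ℕ∞) (shear j h) :=
  contDiff_id.add (hs.smul contDiff_const)

theorem shear_det {h : V d → ℝ} (hs : Differentiable ℝ h) (j : Fin d) (x : V d) :
    (fderiv ℝ (shear j h) x).det = 1 + pd j h x := by
  have : HasFDerivAt (shear j h)
      (ContinuousLinearMap.id ℝ (V d) + (fderiv ℝ h x).smulRight (ev j)) x :=
    (hasFDerivAt_id x).add ((hs x).hasFDerivAt.smul_const (ev j))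
  rw [this.fderiv]
  have := LinearMap.transvection.det (fderiv ℝ h x : V d →ₗ[ℝ] ℝ) (ev j)
  rw [pd, ← ContinuousLinearMap.coe_coe, ← this, ContinuousLinearMap.det]
  congr 1

theorem shear_same (j : Fin d) (h : V d → ℝ) (x : V d) : shear j h x j = x j + h x := by
  simp [shear]

theorem shear_ne {j k : Fin d} (hk : k ≠ j) (h : V d → ℝ) (x : V d) : shear j h x k = x k := by
  simp [shear, ev_ne hk]

theorem shear_of_zero {j : Fin d} {h : V d → ℝ} {x : V d} (hx : h x = 0) : shear j h x = x := by
  simp [shear, hx]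

theorem shear_injective {h : V d → ℝ} (hs : Differentiable ℝ h) {j : Fin d}
    (hj : ∀ x, |pd j h x| ≤ 1 / 2) : Function.Injective (shear j h) := by
  intro x y hxy
  have h1 : x + h x • ev j = y + h y • ev j := hxy
  have h2 : y = x + (h x - h y) • ev j := by
    rw [sub_smul, ← add_sub_assoc, h1, add_sub_cancel_right]
  have h3 := abs_sub_le_of_pd hs hj x (h x - h y)
  rw [← h2, abs_sub_comm] at h3
  have h4 : |h x - h y| = 0 := by linarith [abs_nonneg (h x - h y)]
  rw [abs_eq_zero] at h4
  rw [h2, h4]; simp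

theorem shear_surjective {h : V d → ℝ} (hs : Differentiable ℝ h) {j : Fin d}
    (hj : ∀ x, |pd j h x| ≤ 1 / 2) : Function.Surjective (shear j h) := by
  intro y
  let g : ℝ → ℝ := fun t => t + h (y + t • ev j)
  have hg : Continuous g := by
    have := hs.continuous
    fun_prop
  have hb := abs_sub_le_of_pd hs hj y
  set T := 2 * |h y| with hT
  have h0 : (0 : ℝ) ∈ Icc (g (-T)) (g T) := by
    have h1 := abs_le.1 (hb T)
    have h2 := abs_le.1 (hb (-T))
    have hT0 : 0 ≤ T := by positivity
    rw [abs_neg, abs_of_nonneg hT0] at h2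
    rw [abs_of_nonneg hT0] at h1
    have := abs_le.1 (le_refl |h y|)
    constructor <;> simp only [g] <;> linarith
  obtain ⟨t, -, ht⟩ := intermediate_value_Icc (by
    have : 0 ≤ T := by positivity
    linarith) hg.continuousOn h0
  refine ⟨y + t • ev j, ?_⟩
  simp only [g] at ht
  rw [shear, add_assoc, ← add_smul, ht]; simp

theorem shear_bijective {h : V d → ℝ} (hs : Differentiable ℝ h) {j : Fin d}
    (hj : ∀ x, |pd j h x| ≤ 1 / 2) : Function.Bijective (shear j h) :=
  ⟨shear_injective hs hj, shear_surjective hs hj⟩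

theorem one_add_pd_pos {h : V d → ℝ} {j : Fin d} {x : V d} (hj : |pd j h x| ≤ 1 / 2) :
    1 / 2 ≤ 1 + pd j h x := by
  linarith [(abs_le.1 hj).1]

/-- The inverse of the shear by `h` is the shear by some `κ`. -/
theorem exists_shear_inverse {h : V d → ℝ} (hs : ContDiff ℝ (⊤ : ℕ∞) h) {j : Fin d}
    (hj : ∀ x, |pd j h x| ≤ 1 / 2) :
    ∃ κ : V d → ℝ, ContDiff ℝ (⊤ : ℕ∞) κ ∧ (∀ x, κ (shear j h x) = - h x) ∧
      (∀ x, shear j κ (shear j h x) = x) ∧ (∀ x, shear j h (shear j κ x) = x) ∧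
      (∀ x, h (shear j κ x) = - κ x) := by
  have hd := diff_of_smooth hs
  obtain ⟨Q, hQ, hl, hr⟩ := exists_smooth_inverse (shear_smooth hs j) (shear_bijective hd hj)
    (fun x => by rw [shear_det hd]; linarith [one_add_pd_pos (hj x)])
  have e1 : ∀ x, shear j (fun y => - h (Q y)) x = Q x := by
    intro x
    have : Q x + h (Q x) • ev j = x := hr x
    rw [shear]; nth_rw 1 [← this]; simp
  refine ⟨fun y => - h (Q y), (hs.comp hQ).neg, fun x => by simp only [hl x], fun x => by rw [e1, hl],
    fun x => by rw [e1, hr], fun x => by rw [e1]; simp⟩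

/-- A function `K` generates a volume-preserving diffeomorphism
`y + ∂ᵢK e_j ↦ y + ∂_jK e_i`. -/
theorem exists_diffeo_of_generating {K : V d → ℝ} (hK : ContDiff ℝ (⊤ : ℕ∞) K)
    (hc : HasCompactSupport K) {i j : Fin d} (hb : ∀ x, |pd j (pd i K) x| ≤ 1 / 2) :
    ∃ Φ, IsCompSuppVolDiffeo d Φ ∧ ∀ y, Φ (shear j (pd i K) y) = shear i (pd j K) y := by
  have hi := contDiff_pd hK i
  have hj := contDiff_pd hK j
  have hb' : ∀ x, |pd i (pd j K) x| ≤ 1 / 2 := fun x => by rw [pd_comm hK]; exact hb x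
  refine exists_diffeo_of_pair (shear_smooth hi j) (shear_smooth hj i)
    (shear_bijective (diff_of_smooth hi) hb) (shear_bijective (diff_of_smooth hj) hb')
    (fun x => ?_) (fun x => ?_) hc (fun x hx => ⟨?_, ?_⟩)
  · rw [shear_det (diff_of_smooth hi)]; linarith [one_add_pd_pos (hb x)]
  · rw [shear_det (diff_of_smooth hi), shear_det (diff_of_smooth hj), pd_comm hK]
  · exact shear_of_zero (pd_eq_zero hx)
  · exact shear_of_zero (pd_eq_zero hx)

theorem hasFDerivAt_param {E G : Type} [NormedAddCommGroup E] [NormedSpace ℝ E] [ProperSpace E]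
    [NormedAddCommGroup G] [NormedSpace ℝ G] {F : E × ℝ → G}
    (hF : ContDiff ℝ (⊤ : ℕ∞) F) (a b : ℝ) (x₀ : E) :
    HasFDerivAt (fun x => ∫ t in a..b, F (x, t))
      (∫ t in a..b, (fderiv ℝ F (x₀, t)).comp (ContinuousLinearMap.inl ℝ E ℝ)) x₀ := by
  have hc : Continuous (fderiv ℝ F) := hF.continuous_fderiv (by simp)
  have hc2 : Continuous (fun p : E × ℝ => (fderiv ℝ F p).comp (ContinuousLinearMap.inl ℝ E ℝ)) := by
    fun_prop
  obtain ⟨B, hB⟩ := ((isCompact_closedBall x₀ 1).prod (isCompact_uIcc (a := a) (b := b))).exists_bound_of_continuousOn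
    hc2.continuousOn
  have hFc := hF.continuous
  refine intervalIntegral.hasFDerivAt_integral_of_dominated_of_fderiv_le (F := fun x t => F (x, t))
    (F' := fun x t => (fderiv ℝ F (x, t)).comp (ContinuousLinearMap.inl ℝ E ℝ)) (bound := fun _ => B)
    (s := Metric.ball x₀ 1) (Metric.ball_mem_nhds x₀ one_pos) ?_ ?_ ?_ ?_ ?_ ?_
  · refine Filter.Eventually.of_forall fun x => ?_
    exact (hFc.comp (by fun_prop : Continuous fun t : ℝ => (x, t))).aestronglyMeasurable
  · exact (hFc.comp (by fun_prop : Continuous fun t : ℝ => (x₀, t))).intervalIntegrable _ _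
  · exact (hc2.comp (by fun_prop : Continuous fun t : ℝ => (x₀, t))).aestronglyMeasurable
  · refine Filter.Eventually.of_forall fun t ht x hx => hB (x, t) ⟨?_, uIoc_subset_uIcc ht⟩
    exact Metric.ball_subset_closedBall hx
  · exact intervalIntegrable_const
  · refine Filter.Eventually.of_forall fun t ht x hx => ?_
    have h1 : HasFDerivAt (fun x : E => (x, t)) (ContinuousLinearMap.inl ℝ E ℝ) x := 
      hasFDerivAt_prodMk_left x t
    exact (diff_of_smooth hF (x, t)).hasFDerivAt.comp x h1

theorem contDiff_param {E : Type} [NormedAddCommGroup E] [NormedSpace ℝ E] [ProperSpace E]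
    (n : ℕ) : ∀ {G : Type} [NormedAddCommGroup G] [NormedSpace ℝ G] {F : E × ℝ → G}
    (_ : ContDiff ℝ (⊤ : ℕ∞) F) (a b : ℝ), ContDiff ℝ n (fun x => ∫ t in a..b, F (x, t)) := by
  induction n with
  | zero =>
    intro G _ _ F hF a b
    refine contDiff_zero.2 (Differentiable.continuous (𝕜 := ℝ) fun x => ?_)
    exact (hasFDerivAt_param hF a b x).differentiableAt
  | succ n ih =>
    intro G _ _ F hF a b
    have h := fun x => hasFDerivAt_param hF a b x
    refine (contDiff_succ_iff_fderiv (n := n)).2 ⟨fun x => (h x).differentiableAt, by simp, ?_⟩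
    rw [show fderiv ℝ (fun x => ∫ t in a..b, F (x, t)) = _ from funext fun x => (h x).fderiv]
    exact ih (F := fun p => (fderiv ℝ F p).comp (ContinuousLinearMap.inl ℝ E ℝ))
      ((hF.fderiv_right (m := (⊤ : ℕ∞)) (by simp)).clm_comp contDiff_const) a b

theorem smooth_param {E G : Type} [NormedAddCommGroup E] [NormedSpace ℝ E] [ProperSpace E]
    [NormedAddCommGroup G] [NormedSpace ℝ G] {F : E × ℝ → G}
    (hF : ContDiff ℝ (⊤ : ℕ∞) F) (a b : ℝ) :
    ContDiff ℝ (⊤ : ℕ∞) (fun x => ∫ t in a..b, F (x, t)) :=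
  contDiff_infty.2 fun n => contDiff_param n hF a b

/-- The primitive of `f` in the `i`-th direction, starting at `x i = a`. -/
noncomputable def prim (i : Fin d) (a : ℝ) (f : V d → ℝ) (y : V d) : ℝ :=
  ∫ t in a..(y i), f (y + (t - y i) • ev i)

/-- The integral of `f` over a segment in the `i`-th direction. -/
noncomputable def lineInt (i : Fin d) (a b : ℝ) (f : V d → ℝ) (y : V d) : ℝ :=
  ∫ t in a..b, f (y + (t - y i) • ev i)

theorem lineInt_eq_prim (i : Fin d) (a b : ℝ) (f : V d → ℝ) (y : V d) :
    lineInt i a b f y = prim i a f (y + (b - y i) • ev i) := by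
  simp only [lineInt, prim, PiLp.add_apply, PiLp.smul_apply, ev_same, smul_eq_mul, mul_one,
    add_sub_cancel, add_assoc, ← add_smul]
  congr 1; ext t; ring_nf

theorem prim_smooth {f : V d → ℝ} (hf : ContDiff ℝ (⊤ : ℕ∞) f) (i : Fin d) (a : ℝ) :
    ContDiff ℝ (⊤ : ℕ∞) (prim i a f) := by
  have h1 : prim i a f = fun y =>
      ∫ s in (0 : ℝ)..1, (y i - a) * f (y + ((1 - s) * (a - y i)) • ev i) := by
    ext y
    have := intervalIntegral.mul_integral_comp_mul_add (a := 0) (b := 1) (c := y i - a) (d := a)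
      (f := fun t => f (y + (t - y i) • ev i))
    rw [prim, intervalIntegral.integral_const_mul]
    simp only [mul_zero, zero_add, mul_one, sub_add_cancel] at this
    rw [← this]
    congr 2; ext s; ring_nf
  rw [h1]
  refine smooth_param (F := fun p : V d × ℝ =>
    (p.1 i - a) * f (p.1 + ((1 - p.2) * (a - p.1 i)) • ev i)) ?_ 0 1
  have hc : ContDiff ℝ (⊤ : ℕ∞) (fun p : V d × ℝ => p.1 i) := (contDiff_coord i).comp contDiff_fst
  refine (hc.sub contDiff_const).mul (hf.comp (contDiff_fst.add ?_))
  exact ((contDiff_const.sub contDiff_snd).mul (contDiff_const.sub hc)).smul contDiff_const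

theorem lineInt_smooth {f : V d → ℝ} (hf : ContDiff ℝ (⊤ : ℕ∞) f) (i : Fin d) (a b : ℝ) :
    ContDiff ℝ (⊤ : ℕ∞) (lineInt i a b f) := by
  rw [show lineInt i a b f = _ from funext (lineInt_eq_prim i a b f)]
  refine (prim_smooth hf i a).comp (contDiff_id.add ?_)
  exact (contDiff_const.sub (contDiff_coord i)).smul contDiff_const

theorem pd_prim_same {f : V d → ℝ} (hf : ContDiff ℝ (⊤ : ℕ∞) f) (i : Fin d) (a : ℝ) (y : V d) :
    pd i (prim i a f) y = f y := by
  refine pd_eq (diff_of_smooth (prim_smooth hf i a)) ?_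
  have h1 : (fun t : ℝ => prim i a f (y + t • ev i)) =
      fun t => ∫ s in a..(y i + t), f (y + (s - y i) • ev i) := by
    ext t
    simp only [prim, PiLp.add_apply, PiLp.smul_apply, ev_same, smul_eq_mul, mul_one,
      add_assoc, ← add_smul]
    congr 1; ext s; ring_nf
  rw [h1]
  have hc : Continuous fun s : ℝ => f (y + (s - y i) • ev i) := by
    have := hf.continuous
    fun_prop
  have h2 := (hc.integral_hasStrictDerivAt a (y i + 0)).hasDerivAt
  have h3 : HasDerivAt (fun t : ℝ => y i + t) 1 0 := by simpa using (hasDerivAt_id (0:ℝ)).const_add (y i)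
  simpa [Function.comp_def] using h2.comp 0 h3

theorem pd_prim_ne {f : V d → ℝ} (hf : ContDiff ℝ (⊤ : ℕ∞) f) {i j : Fin d} (hij : i ≠ j) (a : ℝ)
    (y : V d) : pd j (prim i a f) y = prim i a (pd j f) y := by
  refine pd_eq (diff_of_smooth (prim_smooth hf i a)) ?_
  have h1 : (fun t : ℝ => prim i a f (y + t • ev j)) =
      fun t => ∫ s in a..(y i), f (y + (s - y i) • ev i + t • ev j) := by
    ext t
    simp only [prim, PiLp.add_apply, PiLp.smul_apply, ev_ne hij, smul_eq_mul, mul_zero, add_zero]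
    congr 1; ext s; rw [add_right_comm]
  rw [h1]
  let F : ℝ × ℝ → ℝ := fun p => f (y + (p.2 - y i) • ev i + p.1 • ev j)
  have hF : ContDiff ℝ (⊤ : ℕ∞) F := by
    refine hf.comp ((contDiff_const.add ?_).add ?_)
    · exact (contDiff_snd.sub contDiff_const).smul contDiff_const
    · exact contDiff_fst.smul contDiff_const
  have h2 := (hasFDerivAt_param hF a (y i) 0).hasDerivAt
  refine h2.congr_deriv ?_
  rw [ContinuousLinearMap.intervalIntegral_apply]
  · refine intervalIntegral.integral_congr fun s _ => ?_
    have h3 := hasDerivAt_line (diff_of_smooth hf) j (y + (s - y i) • ev i) 0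
    have h4 : HasFDerivAt (fun x : ℝ => (x, s)) (ContinuousLinearMap.inl ℝ ℝ ℝ) 0 := 
      hasFDerivAt_prodMk_left 0 s
    have h5 := ((diff_of_smooth hF (0, s)).hasFDerivAt.comp 0 h4).hasDerivAt
    simpa using (h3.unique h5).symm
  · have hc : Continuous (fderiv ℝ F) := hF.continuous_fderiv (by simp)
    exact Continuous.intervalIntegrable (by fun_prop) _ _

theorem lineInt_add_same (i : Fin d) (a b : ℝ) (f : V d → ℝ) (y : V d) (t : ℝ) :
    lineInt i a b f (y + t • ev i) = lineInt i a b f y := by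
  simp only [lineInt, PiLp.add_apply, PiLp.smul_apply, ev_same, smul_eq_mul, mul_one,
    add_assoc, ← add_smul]
  congr 1; ext s; ring_nf

theorem pd_lineInt_same {f : V d → ℝ} (hf : ContDiff ℝ (⊤ : ℕ∞) f) (i : Fin d) (a b : ℝ)
    (y : V d) : pd i (lineInt i a b f) y = 0 := by
  refine pd_eq (diff_of_smooth (lineInt_smooth hf i a b)) ?_
  simpa only [lineInt_add_same] using hasDerivAt_const (0 : ℝ) (lineInt i a b f y)

theorem pd_lineInt_ne {f : V d → ℝ} (hf : ContDiff ℝ (⊤ : ℕ∞) f) {i j : Fin d} (hij : i ≠ j)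
    (a b : ℝ) (y : V d) : pd j (lineInt i a b f) y = lineInt i a b (pd j f) y := by
  rw [lineInt_eq_prim, ← pd_prim_ne hf hij]
  refine pd_eq (diff_of_smooth (lineInt_smooth hf i a b)) ?_
  have := hasDerivAt_line (diff_of_smooth (prim_smooth hf i a)) j (y + (b - y i) • ev i) 0
  simp only [zero_smul, add_zero] at this
  convert this using 2 with t
  rw [lineInt_eq_prim]
  simp only [PiLp.add_apply, PiLp.smul_apply, ev_ne hij, smul_eq_mul, mul_zero, add_zero]
  rw [add_right_comm]

theorem abs_lineInt_le {f : V d → ℝ} {c : ℝ} (hc : ∀ x, |f x| ≤ c) (i : Fin d) {a b : ℝ}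
    (hab : a ≤ b) (y : V d) : |lineInt i a b f y| ≤ c * (b - a) := by
  have := intervalIntegral.norm_integral_le_of_norm_le_const (a := a) (b := b)
    (f := fun t => f (y + (t - y i) • ev i)) (C := c) (fun t _ => hc _)
  rwa [abs_of_nonneg (sub_nonneg.2 hab)] at this

theorem lineInt_eq_zero {f : V d → ℝ} {i : Fin d} {a b : ℝ} {y : V d}
    (h : ∀ t : ℝ, f (y + t • ev i) = 0) : lineInt i a b f y = 0 := by
  simp [lineInt, h]

theorem prim_eq_zero {f : V d → ℝ} {i : Fin d} {a : ℝ} {y : V d}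
    (h : ∀ t : ℝ, f (y + t • ev i) = 0) : prim i a f y = 0 := by
  simp [prim, h]

theorem prim_of_le {f : V d → ℝ} {i : Fin d} {R : ℝ} (hR : ∀ x, f x ≠ 0 → |x i| ≤ R) {y : V d}
    (h : y i ≤ -R) : prim i (-R) f y = 0 := by
  rw [prim, intervalIntegral.integral_symm, neg_eq_zero]
  refine intervalIntegral.integral_zero_ae ?_
  have h0 : ∀ᵐ t : ℝ, t ≠ -R := by simp [ae_iff]
  filter_upwards [h0] with t ht0 ht
  rw [uIoc_of_le h] at ht
  by_contra h1
  have := (abs_le.1 (hR _ h1)).1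
  simp at this
  exact ht0 (le_antisymm ht.2 this)

theorem prim_of_ge {f : V d → ℝ} (hf : Continuous f) {i : Fin d} {R : ℝ}
    (hR : ∀ x, f x ≠ 0 → |x i| ≤ R) {y : V d}
    (h : R ≤ y i) : prim i (-R) f y = lineInt i (-R) R f y := by
  have hc : Continuous fun s : ℝ => f (y + (s - y i) • ev i) := by fun_prop
  rw [prim, lineInt, ← intervalIntegral.integral_add_adjacent_intervals
    (hc.intervalIntegrable (-R) R) (hc.intervalIntegrable R (y i)), add_eq_left]
  refine intervalIntegral.integral_zero_ae (Filter.Eventually.of_forall fun t ht => ?_)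
  rw [uIoc_of_le h] at ht
  by_contra h1
  have := (abs_le.1 (hR _ h1)).2
  simp at this
  linarith [ht.1]

theorem const_of_pd_eq_zero {f : V d → ℝ} (hf : Differentiable ℝ f) {i : Fin d}
    (h : ∀ x, pd i f x = 0) (x : V d) (t : ℝ) : f (x + t • ev i) = f x := by
  have := abs_sub_le_of_pd hf (i := i) (c := 0) (fun x => by simp [h]) x t
  simpa [sub_eq_zero] using this

theorem smoothTransition_smooth : ContDiff ℝ (⊤ : ℕ∞) Real.smoothTransition :=
  Real.smoothTransition.contDiff

theorem exists_bound_of_periodic {f : ℝ → ℝ} {c : ℝ} (hp : f.Periodic c) (hc : c ≠ 0)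
    (hf : Continuous f) : ∃ B, ∀ t, |f t| ≤ B := by
  obtain ⟨B, hB⟩ := (hp.isBounded_of_continuous hc hf).exists_norm_le
  exact ⟨B, fun t => hB _ (mem_range_self t)⟩

theorem periodic_deriv {f : ℝ → ℝ} {c : ℝ} (hp : f.Periodic c) : (deriv f).Periodic c := by
  intro t
  rw [← deriv_comp_add_const, show (fun x => f (x + c)) = f from funext hp]

theorem contDiff_deriv {f : ℝ → ℝ} (hf : ContDiff ℝ (⊤ : ℕ∞) f) :
    ContDiff ℝ (⊤ : ℕ∞) (deriv f) :=
  (contDiff_infty_iff_deriv.1 hf).2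

/-- A smooth step from `0` on `t ≤ 2` to `1` on `t ≥ 4`. -/
noncomputable def step (t : ℝ) : ℝ := Real.smoothTransition ((t - 2) / 2)

theorem step_smooth : ContDiff ℝ (⊤ : ℕ∞) step :=
  smoothTransition_smooth.comp ((contDiff_id.sub contDiff_const).div_const 2)

theorem step_of_le {t : ℝ} (ht : t ≤ 2) : step t = 0 :=
  Real.smoothTransition.zero_of_nonpos (by linarith)

theorem step_of_ge {t : ℝ} (ht : 4 ≤ t) : step t = 1 :=
  Real.smoothTransition.one_of_one_le (by linarith)

theorem deriv_zero_of_zero {f : ℝ → ℝ} (hf : ContDiff ℝ (⊤ : ℕ∞) f) {U : Set ℝ} (hU : IsOpen U)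
    {c : ℝ} (h : ∀ t ∈ U, f t = c) {t : ℝ} (ht : t ∈ closure U) : deriv f t = 0 := by
  have hclosed : IsClosed {t | deriv f t = 0} :=
    isClosed_eq (contDiff_deriv hf).continuous continuous_const
  refine closure_minimal (fun s hs => ?_) hclosed ht
  have : f =ᶠ[nhds s] fun _ => c := Filter.eventually_of_mem (hU.mem_nhds hs) h
  simp [this.deriv_eq]

theorem deriv_step_of_le {t : ℝ} (ht : t ≤ 2) : deriv step t = 0 :=
  deriv_zero_of_zero step_smooth isOpen_Iio (fun t ht => step_of_le (le_of_lt ht))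
    (by rwa [closure_Iio, mem_Iic])

theorem deriv_step_of_ge {t : ℝ} (ht : 4 ≤ t) : deriv step t = 0 :=
  deriv_zero_of_zero step_smooth isOpen_Ioi (fun t ht => step_of_ge (le_of_lt ht))
    (by rwa [closure_Ioi, mem_Ici])

theorem deriv2_step_of_le {t : ℝ} (ht : t ≤ 2) : deriv (deriv step) t = 0 :=
  deriv_zero_of_zero (contDiff_deriv step_smooth) isOpen_Iio
    (fun t ht => deriv_step_of_le (le_of_lt ht)) (by rwa [closure_Iio, mem_Iic])

theorem deriv2_step_of_ge {t : ℝ} (ht : 4 ≤ t) : deriv (deriv step) t = 0 :=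
  deriv_zero_of_zero (contDiff_deriv step_smooth) isOpen_Ioi
    (fun t ht => deriv_step_of_ge (le_of_lt ht)) (by rwa [closure_Ioi, mem_Ici])

theorem exists_step_bound : ∃ B : ℝ, 1 ≤ B ∧ (∀ t, |deriv step t| ≤ B) ∧
    ∀ t, |deriv (deriv step) t| ≤ B := by
  have h1 := contDiff_deriv step_smooth
  have h2 := contDiff_deriv h1
  obtain ⟨B, hB⟩ := isCompact_Icc.exists_bound_of_continuousOn (s := Icc (2 : ℝ) 4)
    h1.continuous.continuousOn
  obtain ⟨B', hB'⟩ := isCompact_Icc.exists_bound_of_continuousOn (s := Icc (2 : ℝ) 4)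
    h2.continuous.continuousOn
  refine ⟨max 1 (max B B'), le_max_left _ _, fun t => ?_, fun t => ?_⟩
  · rcases le_total t 2 with h | h
    · simp [deriv_step_of_le h]
    rcases le_total t 4 with h' | h'
    · exact (hB t ⟨h, h'⟩).trans (by simp)
    · simp [deriv_step_of_ge h']
  · rcases le_total t 2 with h | h
    · simp [deriv2_step_of_le h]
    rcases le_total t 4 with h' | h'
    · exact (hB' t ⟨h, h'⟩).trans (by simp)
    · simp [deriv2_step_of_ge h']

/-- A cutoff of the zones where `cos` is positive. -/
noncomputable def cutX (t : ℝ) : ℝ := Real.smoothTransition (10 * Real.cos t - 4)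

theorem cutX_smooth : ContDiff ℝ (⊤ : ℕ∞) cutX :=
  smoothTransition_smooth.comp ((contDiff_const.mul Real.contDiff_cos).sub contDiff_const)

theorem cutX_one {t : ℝ} (h : 0.5 ≤ Real.cos t) : cutX t = 1 :=
  Real.smoothTransition.one_of_one_le (by linarith)

theorem cutX_zero {t : ℝ} (h : Real.cos t ≤ 0.4) : cutX t = 0 :=
  Real.smoothTransition.zero_of_nonpos (by linarith)

theorem abs_cutX_le (t : ℝ) : |cutX t| ≤ 1 := by
  rw [cutX, abs_of_nonneg (Real.smoothTransition.nonneg _)]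
  exact Real.smoothTransition.le_one _

theorem periodic_cutX : cutX.Periodic (2 * Real.pi) := by
  intro t; simp [cutX]

noncomputable def partDenom (t : ℝ) : ℝ :=
  Real.smoothTransition (10 * Real.cos t - 6) + Real.smoothTransition (10 * Real.sin t - 6) +
    Real.smoothTransition (-10 * Real.cos t - 6) + Real.smoothTransition (-10 * Real.sin t - 6)

theorem partDenom_pos (t : ℝ) : 0 < partDenom t := by
  have h := Real.sin_sq_add_cos_sq t
  have n1 := Real.smoothTransition.nonneg (10 * Real.cos t - 6)
  have n2 := Real.smoothTransition.nonneg (10 * Real.sin t - 6)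
  have n3 := Real.smoothTransition.nonneg (-10 * Real.cos t - 6)
  have n4 := Real.smoothTransition.nonneg (-10 * Real.sin t - 6)
  unfold partDenom
  rcases lt_or_ge 0.6 (Real.cos t) with h1 | h1
  · linarith [Real.smoothTransition.pos_of_pos (show 0 < 10 * Real.cos t - 6 by linarith)]
  rcases lt_or_ge 0.6 (Real.sin t) with h2 | h2
  · linarith [Real.smoothTransition.pos_of_pos (show 0 < 10 * Real.sin t - 6 by linarith)]
  rcases lt_or_ge (Real.cos t) (-0.6) with h3 | h3
  · linarith [Real.smoothTransition.pos_of_pos (show 0 < -10 * Real.cos t - 6 by linarith)]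
  rcases lt_or_ge (Real.sin t) (-0.6) with h4 | h4
  · linarith [Real.smoothTransition.pos_of_pos (show 0 < -10 * Real.sin t - 6 by linarith)]
  nlinarith

/-- A piece of a periodic partition of unity. -/
noncomputable def part (t : ℝ) : ℝ := Real.smoothTransition (10 * Real.cos t - 6) / partDenom t

theorem partDenom_smooth : ContDiff ℝ (⊤ : ℕ∞) partDenom := by
  have hc : ContDiff ℝ (⊤ : ℕ∞) Real.cos := Real.contDiff_cos
  have hs : ContDiff ℝ (⊤ : ℕ∞) Real.sin := Real.contDiff_sin
  have hT := smoothTransition_smooth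
  exact (((hT.comp ((contDiff_const.mul hc).sub contDiff_const)).add
    (hT.comp ((contDiff_const.mul hs).sub contDiff_const))).add
    (hT.comp ((contDiff_const.mul hc).sub contDiff_const))).add
    (hT.comp ((contDiff_const.mul hs).sub contDiff_const))

theorem part_smooth : ContDiff ℝ (⊤ : ℕ∞) part :=
  (smoothTransition_smooth.comp ((contDiff_const.mul Real.contDiff_cos).sub contDiff_const)).div
    partDenom_smooth (fun t => (partDenom_pos t).ne')

theorem part_zero {t : ℝ} (h : Real.cos t ≤ 0.6) : part t = 0 := by
  rw [part, Real.smoothTransition.zero_of_nonpos (by linarith), zero_div]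

theorem abs_part_le (t : ℝ) : |part t| ≤ 1 := by
  have n1 := Real.smoothTransition.nonneg (10 * Real.cos t - 6)
  have n2 := Real.smoothTransition.nonneg (10 * Real.sin t - 6)
  have n3 := Real.smoothTransition.nonneg (-10 * Real.cos t - 6)
  have n4 := Real.smoothTransition.nonneg (-10 * Real.sin t - 6)
  rw [part, abs_of_nonneg (div_nonneg n1 (partDenom_pos t).le), div_le_one (partDenom_pos t)]
  unfold partDenom; linarith

theorem periodic_part : part.Periodic (2 * Real.pi) := by
  intro t; simp [part, partDenom]

theorem part_sum (t : ℝ) :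
    part t + part (t - Real.pi / 2) + part (t - Real.pi) + part (t + Real.pi / 2) = 1 := by
  have h := (partDenom_pos t).ne'
  have e1 : partDenom (t - Real.pi / 2) = partDenom t := by
    simp only [partDenom, Real.cos_sub_pi_div_two, Real.sin_sub_pi_div_two]; ring_nf
  have e2 : partDenom (t - Real.pi) = partDenom t := by
    simp only [partDenom, Real.cos_sub_pi, Real.sin_sub_pi]; ring_nf
  have e3 : partDenom (t + Real.pi / 2) = partDenom t := by
    simp only [partDenom, Real.cos_add_pi_div_two, Real.sin_add_pi_div_two]; ring_nf
  simp only [part, e1, e2, e3]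
  rw [← add_div, ← add_div, ← add_div, div_eq_one_iff_eq h]
  simp only [partDenom, Real.cos_sub_pi_div_two, Real.cos_sub_pi, Real.cos_add_pi_div_two]
  ring_nf

theorem exists_cut_bound : ∃ W : ℝ, 1 ≤ W ∧ (∀ t, |deriv cutX t| ≤ W) ∧ ∀ t, |deriv part t| ≤ W := by
  have hpi : 2 * Real.pi ≠ 0 := by positivity
  obtain ⟨B, hB⟩ := exists_bound_of_periodic (periodic_deriv periodic_cutX) hpi
    (contDiff_deriv cutX_smooth).continuous
  obtain ⟨B', hB'⟩ := exists_bound_of_periodic (periodic_deriv periodic_part) hpi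
    (contDiff_deriv part_smooth).continuous
  exact ⟨max 1 (max B B'), le_max_left _ _, fun t => (hB t).trans (by simp),
    fun t => (hB' t).trans (by simp)⟩

/-- A periodic function whose derivative is a zigzag of slope one where `cos` is positive. -/
noncomputable def zig (t : ℝ) : ℝ :=
  1 / 2 * Real.arcsin (Real.sin t) ^ 2 * Real.smoothTransition (10 * Real.cos t - 1)

theorem sin_ne_of_cos {t : ℝ} (h : Real.cos t ≠ 0) : Real.sin t ≠ -1 ∧ Real.sin t ≠ 1 := by
  have := Real.sin_sq_add_cos_sq t
  have h2 := sq_pos_of_ne_zero h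
  constructor <;> intro h' <;> rw [h'] at this <;> linarith

theorem zig_smooth : ContDiff ℝ (⊤ : ℕ∞) zig := by
  rw [contDiff_iff_contDiffAt]
  intro t
  by_cases h : Real.cos t = 0
  · have h1 : ∀ᶠ s in nhds t, Real.cos s < 0.1 :=
      Real.continuous_cos.continuousAt.eventually_lt continuousAt_const (by rw [h]; norm_num)
    have h2 : zig =ᶠ[nhds t] fun _ => 0 := by
      filter_upwards [h1] with s hs
      rw [zig, Real.smoothTransition.zero_of_nonpos (by linarith), mul_zero]
    exact contDiffAt_const.congr_of_eventuallyEq h2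
  · have h1 := sin_ne_of_cos h
    have h2 : ContDiffAt ℝ (⊤ : ℕ∞) (fun t => Real.arcsin (Real.sin t)) t :=
      (Real.contDiffAt_arcsin h1.1 h1.2).comp t Real.contDiff_sin.contDiffAt
    refine (contDiffAt_const.mul (h2.pow 2)).mul (ContDiff.contDiffAt ?_)
    exact smoothTransition_smooth.comp ((contDiff_const.mul Real.contDiff_cos).sub contDiff_const)

theorem periodic_zig : zig.Periodic (2 * Real.pi) := by
  intro t; simp [zig]

theorem deriv_zig {t : ℝ} (h : 0.25 ≤ Real.cos t) : deriv zig t = Real.arcsin (Real.sin t) := by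
  have h1 : ∀ᶠ s in nhds t, 0.2 < Real.cos s :=
    continuousAt_const.eventually_lt Real.continuous_cos.continuousAt (by linarith)
  have h2 : zig =ᶠ[nhds t] fun s => 1 / 2 * Real.arcsin (Real.sin s) ^ 2 := by
    filter_upwards [h1] with s hs
    rw [zig, Real.smoothTransition.one_of_one_le (by linarith), mul_one]
  rw [h2.deriv_eq]
  have h3 := sin_ne_of_cos (show Real.cos t ≠ 0 by linarith)
  have h4 := (Real.hasDerivAt_arcsin h3.1 h3.2).comp t (Real.hasDerivAt_sin t)
  have h5 := (h4.pow 2).const_mul (1 / 2 : ℝ)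
  refine h5.deriv.trans ?_
  have h6 : √(1 - Real.sin t ^ 2) = Real.cos t := by
    rw [← Real.cos_sq', Real.sqrt_sq (by linarith)]
  rw [h6]
  have : Real.cos t ≠ 0 := by linarith
  simp only [Function.comp_apply]
  field_simp
  norm_num

theorem arcsin_sin_sub {s t : ℝ} (hs : 0 < Real.cos s) (ht : 0 < Real.cos t) (h : |s - t| ≤ 2) :
    Real.arcsin (Real.sin s) - Real.arcsin (Real.sin t) = s - t := by
  have key : ∀ r : ℝ, 0 < Real.cos r → ((Real.arcsin (Real.sin r) : ℝ) : Real.Angle) = r := by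
    intro r hr
    refine Real.Angle.cos_sin_inj ?_ ?_
    · rw [Real.cos_arcsin, ← Real.cos_sq', Real.sqrt_sq hr.le]
    · rw [Real.sin_arcsin (Real.neg_one_le_sin _) (Real.sin_le_one _)]
  have h1 : ((Real.arcsin (Real.sin s) - Real.arcsin (Real.sin t) : ℝ) : Real.Angle) =
      ((s - t : ℝ) : Real.Angle) := by
    rw [Real.Angle.coe_sub, Real.Angle.coe_sub, key s hs, key t ht]
  have hpi := Real.pi_gt_three
  have h2 : ((s - t : ℝ) : Real.Angle).toReal = s - t := by
    rw [Real.Angle.toReal_coe_eq_self_iff]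
    have := abs_le.1 h
    constructor <;> linarith
  have bd : ∀ r : ℝ, 0 < Real.cos r → -(Real.pi / 2) < Real.arcsin (Real.sin r) ∧
      Real.arcsin (Real.sin r) < Real.pi / 2 := by
    intro r hr
    have h3 := sin_ne_of_cos hr.ne'
    exact ⟨Real.neg_pi_div_two_lt_arcsin.2 (lt_of_le_of_ne (Real.neg_one_le_sin r) h3.1.symm),
      Real.arcsin_lt_pi_div_two.2 (lt_of_le_of_ne (Real.sin_le_one r) h3.2)⟩
  rw [← h2, ← h1, Real.Angle.toReal_coe_eq_self_iff.2]
  have a := bd s hs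
  have b := bd t ht
  constructor <;> linarith

theorem deriv_zig_sub {s t : ℝ} (hs : 0.25 ≤ Real.cos s) (ht : 0.25 ≤ Real.cos t)
    (h : |s - t| ≤ 2) : deriv zig s - deriv zig t = s - t := by
  rw [deriv_zig hs, deriv_zig ht, arcsin_sin_sub (by linarith) (by linarith) h]

theorem exists_zig_bound : ∃ W : ℝ, 1 ≤ W ∧ (∀ t, |zig t| ≤ W) ∧ ∀ t, |deriv zig t| ≤ W := by
  have hpi : 2 * Real.pi ≠ 0 := by positivity
  obtain ⟨B, hB⟩ := exists_bound_of_periodic periodic_zig hpi zig_smooth.continuous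
  obtain ⟨B', hB'⟩ := exists_bound_of_periodic (periodic_deriv periodic_zig) hpi
    (contDiff_deriv zig_smooth).continuous
  exact ⟨max 1 (max B B'), le_max_left _ _, fun t => (hB t).trans (by simp),
    fun t => (hB' t).trans (by simp)⟩

theorem pd_comp_shear {g h : V d → ℝ} (hg : Differentiable ℝ g) (hh : Differentiable ℝ h)
    (l j : Fin d) (x : V d) : pd l (fun x => g (shear j h x)) x =
      pd l g (shear j h x) + pd l h x * pd j g (shear j h x) := by
  have h1 : HasFDerivAt (shear j h)
      (ContinuousLinearMap.id ℝ (V d) + (fderiv ℝ h x).smulRight (ev j)) x :=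
    (hasFDerivAt_id x).add ((hh x).hasFDerivAt.smul_const (ev j))
  have h2 := ((hg (shear j h x)).hasFDerivAt.comp x h1).fderiv
  rw [pd, show (fun x => g (shear j h x)) = g ∘ shear j h from rfl, h2]
  simp [pd]

/-- Bounds for the inverse `κ` of the shear by `h`. -/
theorem exists_shear_inverse_bound {h : V d → ℝ} (hs : ContDiff ℝ (⊤ : ℕ∞) h) {j : Fin d} {c : ℝ}
    (hc : c ≤ 1 / 2) (hj : ∀ x, |pd j h x| ≤ c) {η : ℝ} (hη : ∀ x, |h x| ≤ η) :
    ∃ κ : V d → ℝ, ContDiff ℝ (⊤ : ℕ∞) κ ∧ (∀ x, h (shear j κ x) = - κ x) ∧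
      (∀ x, shear j κ (shear j h x) = x) ∧ (∀ x, shear j h (shear j κ x) = x) ∧
      (∀ x, h x = 0 → κ x = 0) ∧ (∀ x, |κ x| ≤ η) ∧ (∀ x, |pd j κ x| ≤ 2 * c) ∧
      ∀ x, (1 + pd j h (shear j κ x)) * (1 + pd j κ x) = 1 := by
  have hj' : ∀ x, |pd j h x| ≤ 1 / 2 := fun x => (hj x).trans hc
  obtain ⟨κ, hκ, k1, k2, k3, k4⟩ := exists_shear_inverse hs hj'
  have key : ∀ x, (1 + pd j h (shear j κ x)) * (1 + pd j κ x) = 1 := by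
    intro x
    have h1 := pd_comp_shear (diff_of_smooth hs) (diff_of_smooth hκ) j j x
    rw [show (fun x => h (shear j κ x)) = fun x => - κ x from funext k4, pd_neg] at h1
    linarith
  refine ⟨κ, hκ, k4, k2, k3, fun x hx => ?_, fun x => ?_, fun x => ?_, key⟩
  · have := k1 x
    rwa [shear_of_zero hx, hx, neg_zero] at this
  · rw [← abs_neg, ← k4]; exact hη _
  · have h1 := key x
    have h2 := abs_le.1 (hj (shear j κ x))
    set p := pd j h (shear j κ x)
    have h3 : pd j κ x = - p * (1 + pd j κ x) := by linarith
    have h4 : 0 < 1 + pd j κ x := by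
      by_contra h5
      nlinarith
    have h5 : 1 + pd j κ x ≤ 2 := by nlinarith
    rw [h3, abs_mul, abs_neg, abs_of_pos h4, mul_comm 2]
    have := hj (shear j κ x)
    have h6 := (abs_nonneg _).trans this
    exact mul_le_mul this h5 h4.le h6

/-- If all integrals of `h` in direction `i` vanish, then the line integrals of `κ`
in direction `i` have a well-localized primitive in direction `j`. -/
theorem exists_localized_primitive {i j : Fin d} (hij : i ≠ j) {h κ : V d → ℝ}
    (hs : ContDiff ℝ (⊤ : ℕ∞) h)
    (hκ : ContDiff ℝ (⊤ : ℕ∞) κ) (h1 : ∀ x, h (shear j κ x) = - κ x)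
    (h2 : ∀ x, h x = 0 → κ x = 0)
    (h3 : ∀ x, (1 + pd j h (shear j κ x)) * (1 + pd j κ x) = 1)
    (hint : ∀ x, lineInt i (-1) 1 h x = 0) :
    ∃ L : V d → ℝ, ContDiff ℝ (⊤ : ℕ∞) L ∧ (∀ y, pd i L y = 0) ∧
      (∀ y, pd j L y = lineInt i (-1) 1 κ y) ∧ ∀ y, (∀ t : ℝ, h (y + t • ev i) = 0) → L y = 0 := by
  have hH := prim_smooth hs j (-1)
  set H := prim j (-1) h with hHdef
  let N : V d → ℝ := fun x => H x + 1 / 2 * (h x * h x)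
  have hN : ContDiff ℝ (⊤ : ℕ∞) N := hH.add (contDiff_const.mul (hs.mul hs))
  let M : V d → ℝ := fun x => N (shear j κ x)
  have hM : ContDiff ℝ (⊤ : ℕ∞) M := hN.comp (shear_smooth hκ j)
  have dM : ∀ y, pd j M y = - κ y := by
    intro y
    have e1 : ∀ x, pd j N x = h x * (1 + pd j h x) := by
      intro x
      rw [pd_add (diff_of_smooth hH) (diff_of_smooth (contDiff_const.mul (hs.mul hs))),
        pd_const_mul (diff_of_smooth (hs.mul hs)), pd_mul (diff_of_smooth hs) (diff_of_smooth hs),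
        pd_prim_same hs]
      ring
    rw [pd_comp_shear (diff_of_smooth hN) (diff_of_smooth hκ), e1, h1]
    linear_combination (- κ y) * h3 y
  refine ⟨fun y => - lineInt i (-1) 1 M y, (lineInt_smooth hM i (-1) 1).neg, fun y => ?_,
    fun y => ?_, fun y hy => ?_⟩
  · rw [pd_neg, pd_lineInt_same hM, neg_zero]
  · rw [pd_neg, pd_lineInt_ne hM hij, show pd j M = fun y => - κ y from funext dM]
    simp [lineInt]
  · have e1 : lineInt i (-1) 1 M y = lineInt i (-1) 1 H y := by
      simp only [lineInt]
      refine intervalIntegral.integral_congr fun t _ => ?_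
      simp [M, N, shear_of_zero (h2 _ (hy _)), hy]
    have hZ := lineInt_smooth hH i (-1) 1
    have e2 : ∀ x, pd j (lineInt i (-1) 1 H) x = 0 := by
      intro x
      rw [pd_lineInt_ne hH hij, show pd j H = h from funext (pd_prim_same hs j (-1))]
      exact hint x
    change -lineInt i (-1) 1 M y = 0
    rw [e1, ← const_of_pd_eq_zero (diff_of_smooth hZ) e2 y (-1 - y j), neg_eq_zero]
    simp only [lineInt, hHdef, prim]
    refine intervalIntegral.integral_zero_ae (Filter.Eventually.of_forall fun t _ => ?_)
    simp [ev_ne hij.symm]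

/-- The compactly supported potential used to realise a shear. -/
noncomputable def pot (i : Fin d) (κ : V d → ℝ) (y : V d) : ℝ :=
  prim i (-1) κ y - step (y i) * lineInt i (-1) 1 κ y

theorem pot_smooth {κ : V d → ℝ} (hκ : ContDiff ℝ (⊤ : ℕ∞) κ) (i : Fin d) :
    ContDiff ℝ (⊤ : ℕ∞) (pot i κ) :=
  (prim_smooth hκ i _).sub ((step_smooth.comp (contDiff_coord i)).mul (lineInt_smooth hκ i _ _))

theorem pd_pot_same {κ : V d → ℝ} (hκ : ContDiff ℝ (⊤ : ℕ∞) κ) (i : Fin d) (y : V d) :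
    pd i (pot i κ) y = κ y - deriv step (y i) * lineInt i (-1) 1 κ y := by
  have h1 : ContDiff ℝ (⊤ : ℕ∞) (fun y : V d => step (y i)) := step_smooth.comp (contDiff_coord i)
  have h2 := lineInt_smooth hκ i (-1) 1
  unfold pot
  rw [pd_sub (diff_of_smooth (prim_smooth hκ i _)) (diff_of_smooth (h1.mul h2)),
    pd_mul (diff_of_smooth h1) (diff_of_smooth h2), pd_prim_same hκ, pd_lineInt_same hκ,
    pd_coord_same (diff_of_smooth step_smooth)]
  ring

theorem pot_support {κ : V d → ℝ} (hκ : Continuous κ) {i : Fin d} (hR : ∀ x, κ x ≠ 0 → |x i| ≤ 1)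
    {y : V d} (hy : pot i κ y ≠ 0) : |y i| ≤ 4 ∧ ∃ t : ℝ, κ (y + t • ev i) ≠ 0 := by
  constructor
  · by_contra h
    rw [not_le, lt_abs] at h
    apply hy
    rcases h with h | h
    · rw [pot, prim_of_ge hκ hR (by linarith), step_of_ge h.le]; ring
    · rw [pot, prim_of_le hR (by linarith), step_of_le (by linarith)]; ring
  · by_contra! h
    apply hy
    rw [pot, prim_eq_zero h, lineInt_eq_zero h]; ring

theorem norm_le_of_line {h : V d → ℝ} {i : Fin d} (hR : ∀ x, h x ≠ 0 → ‖x‖ ≤ 1) {y : V d}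
    (hy : |y i| ≤ 4) {t : ℝ} (ht : h (y + t • ev i) ≠ 0) : ‖y‖ ≤ 6 := by
  have h1 := hR _ ht
  have h2 : |y i + t| ≤ 1 := by
    have := (PiLp.norm_apply_le (y + t • ev i) i).trans h1
    simpa using this
  have h3 : |t| ≤ 5 := by
    have : t = (y i + t) - y i := by ring
    rw [this]; exact (abs_sub _ _).trans (by linarith)
  have h4 : y = (y + t • ev i) - t • ev i := by simp
  rw [h4]
  refine (norm_sub_le _ _).trans ?_
  rw [norm_smul, norm_ev, Real.norm_eq_abs]; linarith

theorem abs_coord_le {x : V d} {r : ℝ} (h : ‖x‖ ≤ r) (i : Fin d) : |x i| ≤ r :=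
  (PiLp.norm_apply_le x i).trans h

theorem hasCompactSupport_of_norm {f : V d → ℝ} {R : ℝ} (h : ∀ x, f x ≠ 0 → ‖x‖ ≤ R) :
    HasCompactSupport f :=
  HasCompactSupport.of_support_subset_isCompact (isCompact_closedBall 0 R)
    fun x hx => by simpa using h x hx

/-- The diffeomorphism generated by `K`, with control of where it moves points. -/
theorem exists_generated {K : V d → ℝ} (hK : ContDiff ℝ (⊤ : ℕ∞) K) {i j : Fin d} (hij : i ≠ j)
    {T : Set (V d)} (hT : IsClosed T) (hKT : ∀ y, K y ≠ 0 → y ∈ T) {R : ℝ}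
    (hR : ∀ y ∈ T, ‖y‖ ≤ R) (hb : ∀ x, |pd j (pd i K) x| ≤ 1 / 2) :
    ∃ Φ, IsCompSuppVolDiffeo d Φ ∧ (∀ y, Φ (shear j (pd i K) y) j = y j) ∧
      (∀ y ∈ tsupport K, y ∈ T) ∧
      (∀ y, Φ (shear j (pd i K) y) = shear i (pd j K) y) ∧
      ∀ x, ∃ y, x = shear j (pd i K) y ∧ (Φ x ≠ x → ‖x‖ ≤ R ∧ ‖Φ x‖ ≤ R ∧ y ∈ T) := by
  have hc : HasCompactSupport K := hasCompactSupport_of_norm fun x hx => hR x (hKT x hx)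
  have hts : tsupport K ⊆ T := closure_minimal (fun y hy => hKT y hy) hT
  obtain ⟨Φ, hΦ, h1⟩ := exists_diffeo_of_generating hK hc hb
  have h2 : ∀ y, y ∉ T → shear j (pd i K) y = y ∧ Φ y = y := by
    intro y hy
    have e1 : shear j (pd i K) y = y := shear_of_zero (pd_eq_zero fun h => hy (hts h))
    have e2 : shear i (pd j K) y = y := shear_of_zero (pd_eq_zero fun h => hy (hts h))
    have := h1 y
    rw [e1, e2] at this
    exact ⟨e1, this⟩
  refine ⟨Φ, hΦ, fun y => by rw [h1, shear_ne hij.symm], fun y hy => hts hy, h1, fun x => ?_⟩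
  obtain ⟨y, hy⟩ := shear_surjective (diff_of_smooth (contDiff_pd hK i)) hb x
  refine ⟨y, hy.symm, fun hx => ⟨?_, ?_, ?_⟩⟩
  · by_contra h
    exact hx (h2 x fun hxT => h (hR x hxT)).2
  · by_contra h
    have h3 := (h2 (Φ x) fun hxT => h (hR _ hxT)).2
    obtain ⟨-, ⟨Ψ, -, hl, -⟩, -⟩ := hΦ
    exact hx (hl.injective h3)
  · by_contra h
    have := h2 y h
    rw [← hy, this.1, this.2] at hx
    exact hx rfl

theorem exists_bound {f : V d → ℝ} (hf : Continuous f) (hc : HasCompactSupport f) :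
    ∃ C : ℝ, 1 ≤ C ∧ ∀ x, |f x| ≤ C := by
  obtain ⟨C, hC⟩ := hc.exists_bound_of_continuous hf
  exact ⟨max C 1, le_max_right _ _, fun x => (hC x).trans (le_max_left _ _)⟩

theorem exists_cut_parabola (i j : Fin d) : ∃ Q : V d → ℝ, ContDiff ℝ (⊤ : ℕ∞) Q ∧
    (∀ y, Q y ≠ 0 → ‖y‖ ≤ 20) ∧ (∀ y, ‖y‖ < 10 → pd i Q y = y i - 3) ∧
    ∃ C : ℝ, 1 ≤ C ∧ (∀ y, |pd i Q y| ≤ C) ∧ ∀ y, |pd j (pd i Q) y| ≤ C := by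
  let χ : ContDiffBump (0 : V d) := ⟨10, 20, by norm_num, by norm_num⟩
  have hq : ContDiff ℝ (⊤ : ℕ∞) (fun y : V d => (y i - 3) * (y i - 3) / 2) := by
    have := contDiff_coord i
    fun_prop
  let Q : V d → ℝ := fun y => (y i - 3) * (y i - 3) / 2 * χ y
  have hQ : ContDiff ℝ (⊤ : ℕ∞) Q := hq.mul χ.contDiff
  have hs : ∀ y, Q y ≠ 0 → ‖y‖ ≤ 20 := by
    intro y hy
    by_contra h
    apply hy
    have : χ y = 0 := χ.zero_of_le_dist (by simpa [χ] using (not_le.1 h).le)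
    simp [Q, this]
  have hc := hasCompactSupport_of_norm hs
  obtain ⟨C, hC1, hC⟩ := exists_bound (contDiff_pd hQ i).continuous (hasCompactSupport_pd hc i)
  obtain ⟨C', hC1', hC'⟩ := exists_bound (contDiff_pd (contDiff_pd hQ i) j).continuous
    (hasCompactSupport_pd (hasCompactSupport_pd hc i) j)
  refine ⟨Q, hQ, hs, fun y hy => ?_, max C C', hC1.trans (le_max_left _ _),
    fun y => (hC y).trans (le_max_left _ _), fun y => (hC' y).trans (le_max_right _ _)⟩
  have e : Q =ᶠ[nhds y] fun y => (y i - 3) * (y i - 3) / 2 := by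
    filter_upwards [Metric.isOpen_ball.mem_nhds (show y ∈ Metric.ball (0 : V d) 10 by simpa using hy)]
      with z hz
    have : χ z = 1 := χ.one_of_mem_closedBall (Metric.ball_subset_closedBall hz)
    simp [Q, this]
  rw [pd, e.fderiv_eq, ← pd, pd_coord_same (φ := fun t => (t - 3) * (t - 3) / 2) (by fun_prop)]
  have h1 : HasDerivAt (fun t : ℝ => t - 3) 1 (y i) := (hasDerivAt_id _).sub_const 3
  refine ((h1.mul h1).div_const 2).deriv.trans ?_
  ring

theorem cos_zone {a τ s t r ε : ℝ} (ha : 0 < a) (h : |s - t| ≤ ε * a)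
    (hs : r ≤ Real.cos (s / a - τ)) : r - ε ≤ Real.cos (t / a - τ) := by
  have h1 := Real.abs_cos_sub_cos_le (s / a - τ) (t / a - τ)
  have h2 : |s / a - τ - (t / a - τ)| ≤ ε := by
    rw [show s / a - τ - (t / a - τ) = (s - t) / a by ring, abs_div, abs_of_pos ha,
      div_le_iff₀ ha]
    exact h
  have := (abs_le.1 (h1.trans h2)).2
  linarith

/-- The region on which the function `w` of `ZoneAffine` is controlled. -/
def ZoneAffine (j : Fin d) (a τ : ℝ) (w : V d → ℝ) : Prop :=
  ∀ x y : V d, ‖x‖ ≤ 20 → ‖y‖ ≤ 20 → 0.3 ≤ Real.cos (x j / a - τ) →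
    0.3 ≤ Real.cos (y j / a - τ) → |x j - y j| ≤ a → w x - w y = (x j - y j) / a

/-- A slab in which the generating functions are supported. -/
def slab (j : Fin d) (a τ : ℝ) : Set (V d) := {y | ‖y‖ ≤ 20 ∧ 0.4 ≤ Real.cos (y j / a - τ)}

theorem isClosed_slab (j : Fin d) (a τ : ℝ) : IsClosed (slab j a τ) := by
  have h : Continuous fun y : V d => Real.cos (y j / a - τ) := by fun_prop
  exact (isClosed_le continuous_norm continuous_const).inter (isClosed_le continuous_const h)

theorem exists_slab_diffeo {i j : Fin d} (hij : i ≠ j) {a τ : ℝ} (ha : 0 < a) {K : V d → ℝ}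
    (hK : ContDiff ℝ (⊤ : ℕ∞) K) (hKT : ∀ y, K y ≠ 0 → y ∈ slab j a τ)
    (h1 : ∀ y, |pd i K y| ≤ 0.1 * a) (h2 : ∀ x, |pd j (pd i K) x| ≤ 1 / 2) :
    ∃ Φ, IsCompSuppVolDiffeo d Φ ∧ ∀ w, ZoneAffine j a τ w →
      ∀ y, w (Φ (shear j (pd i K) y)) - w (shear j (pd i K) y) = - pd i K y / a := by
  obtain ⟨Φ, hΦ, e1, -, -, e2⟩ := exists_generated hK hij (isClosed_slab j a τ) hKT
    (fun y hy => hy.1) h2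
  refine ⟨Φ, hΦ, fun w hw y => ?_⟩
  by_cases h : Φ (shear j (pd i K) y) = shear j (pd i K) y
  · have h3 : pd i K y = 0 := by
      have := e1 y
      rw [h, shear_same] at this
      linarith
    rw [h, h3]; simp
  · obtain ⟨z, hz, h3⟩ := e2 (shear j (pd i K) y)
    obtain rfl := shear_injective (diff_of_smooth (contDiff_pd hK i)) h2 hz
    obtain ⟨h4, h5, h6⟩ := h3 h
    have e3 : shear j (pd i K) y j = y j + pd i K y := shear_same _ _ _
    have h7 : |Φ (shear j (pd i K) y) j - shear j (pd i K) y j| ≤ 0.1 * a := by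
      rw [e1, e3, show y j - (y j + pd i K y) = - pd i K y by ring, abs_neg]; exact h1 y
    rw [hw _ _ h5 h4 ?_ ?_ (h7.trans (by linarith)), e1, e3]
    · ring
    · rw [e1]; linarith [h6.2]
    · rw [e1] at h7
      have := cos_zone ha h7 h6.2
      norm_num at this ⊢
      linarith

/-- Pointwise bookkeeping: the displacements of three generated maps add up to `h`. -/
theorem displacement_sum {i j : Fin d} (hij : i ≠ j) {h κ κ₁ κ₂ : V d → ℝ} {μ : ℝ}
    {s : V d → ℝ} (hs : ∀ x, s x = - (μ * (x i - 3)))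
    (h1 : ∀ x, h (shear j κ x) = - κ x) (h2 : ∀ x, h x ≠ 0 → |x i| ≤ 1)
    (h3 : ∀ x, κ x ≠ 0 → |x i| ≤ 1) (h4 : ∀ x, κ₁ x ≠ 0 → 2 < x i)
    (h5 : ∀ z, κ₁ z ≠ 0 → κ₂ (z + (μ * (z i - 3)) • ev j) = - (μ * (z i - 3)) ∧
      κ₂ (shear j κ₁ z + (μ * (z i - 3)) • ev j) = - (μ * (z i - 3)))
    {κ₀ κ₃ : V d → ℝ} (hκ₀ : ∀ x, κ₀ x = κ x + κ₁ x)
    (hκ₃ : ∀ x, κ₃ x = κ₂ x + κ₁ (shear j s x))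
    (i2 : Function.Injective (shear j κ₂)) (i3 : Function.Injective (shear j κ₃))
    {x z y q : V d} (hz : shear j κ₀ z = x) (hy : shear j κ₃ y = x) (hq : shear j κ₂ q = x) :
    h x = - κ₀ z + κ₃ y - κ₂ q := by
  have zi : z i = x i := by rw [← hz, shear_ne hij]
  have qi : q i = x i := by rw [← hq, shear_ne hij]
  by_cases hx : κ₁ z = 0
  · have e1 : κ₀ z = κ z := by rw [hκ₀, hx, add_zero]
    have e2 : h x = - κ₀ z := by
      rw [e1, ← h1, ← hz]; congr 1; simp only [shear, e1]
    have e3 : κ₁ (shear j s q) = 0 := by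
      by_contra hne
      obtain ⟨h6, -⟩ := h5 _ hne
      have e4 : shear j s q + (μ * ((shear j s q) i - 3)) • ev j = q := by
        rw [shear_ne hij]; simp only [shear, hs]; module
      rw [e4, shear_ne hij] at h6
      have e5 : shear j s q = x := by
        rw [← hq]; simp only [shear, hs, h6]
      have h7 := h4 _ hne
      rw [shear_ne hij, qi, ← zi] at h7
      have e6 : κ z = 0 := by
        by_contra h8
        have := (abs_le.1 (h3 z h8)).2
        linarith
      have e7 : z = x := by
        rw [← hz, shear_of_zero]; rw [e1, e6]
      rw [e5, ← e7] at hne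
      exact hne hx
    have e4 : y = q := by
      apply i3
      rw [hy, ← hq]
      simp only [shear, hκ₃]
      rw [show q + s q • ev j = shear j s q from rfl, e3, add_zero]
    rw [e2, e4, hκ₃, e3]; ring
  · have hi : 2 < x i := zi ▸ h4 z hx
    have e1 : κ z = 0 := by
      by_contra h8
      have := (abs_le.1 (h3 z h8)).2
      linarith
    have e2 : h x = 0 := by
      by_contra h8
      have := (abs_le.1 (h2 x h8)).2
      linarith
    obtain ⟨h6, h7⟩ := h5 z hx
    have e3 : κ₀ z = κ₁ z := by rw [hκ₀, e1, zero_add]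
    have e4 : shear j κ₁ z = x := by rw [← hz]; simp only [shear, e3]
    have e5 : q = x + (μ * (z i - 3)) • ev j := by
      apply i2
      rw [e4] at h7
      rw [hq, shear, h7]; module
    have e6 : shear j s (z + (μ * (z i - 3)) • ev j) = z := by
      simp only [shear, hs]
      simp only [PiLp.add_apply, PiLp.smul_apply, ev_ne hij, smul_eq_mul, mul_zero, add_zero]
      module
    have e7 : κ₃ (z + (μ * (z i - 3)) • ev j) = - (μ * (z i - 3)) + κ₁ z := by
      rw [hκ₃, e6, h6]
    have e8 : y = z + (μ * (z i - 3)) • ev j := by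
      apply i3
      rw [hy, ← e4, shear, shear, e7]; module
    rw [e4] at h7
    rw [e8, e7, e5, h7, e3, e2]; ring

/-- Generating data for a function `h` supported near the hyperplanes where the cosine is large. -/
theorem exists_correction {i j : Fin d} (hij : i ≠ j) {h : V d → ℝ}
    (hs : ContDiff ℝ (⊤ : ℕ∞) h) {a τ η c μ B : ℝ} (ha : 0 < a) (hμ : 0 < μ) (hB : 1 ≤ B)
    (hB1 : ∀ t, |deriv step t| ≤ B) (hB2 : ∀ t, |deriv (deriv step) t| ≤ B)
    (hc : c ≤ 1 / 2) (hj : ∀ x, |pd j h x| ≤ c) (hη : ∀ x, |h x| ≤ η)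
    (hh : ∀ x, h x ≠ 0 → ‖x‖ ≤ 1 ∧ 0.6 ≤ Real.cos (x j / a - τ))
    (hint : ∀ x, lineInt i (-1) 1 h x = 0) :
    ∃ κ κ₁ g : V d → ℝ, ContDiff ℝ (⊤ : ℕ∞) κ ∧ ContDiff ℝ (⊤ : ℕ∞) g ∧
      ContDiff ℝ (⊤ : ℕ∞) κ₁ ∧
      (∀ x, h (shear j κ x) = - κ x) ∧ (∀ x, |κ x| ≤ η) ∧ (∀ x, |pd j κ x| ≤ 2 * c) ∧
      (∀ x, κ x ≠ 0 → ‖x‖ ≤ 1 ∧ 0.6 ≤ Real.cos (x j / a - τ)) ∧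
      (∀ x, g x ≠ 0 → (2 ≤ x i ∧ x i ≤ 4) ∧ ‖x‖ ≤ 6 ∧ 0.6 ≤ Real.cos (x j / a - τ)) ∧
      (∀ x, κ₁ x ≠ 0 → (2 < x i ∧ x i ≤ 4) ∧ ‖x‖ ≤ 6 ∧ 0.6 ≤ Real.cos (x j / a - τ)) ∧
      (∀ x, κ₁ x = pd i g x - μ * pd j g x) ∧
      (∀ x, pd i (fun x => pot i κ x + g x) x = κ x + κ₁ x) ∧
      (∀ x, |κ₁ x| ≤ 2 * B * η + 8 * a * η * B / μ) ∧
      (∀ x, |pd j κ₁ x| ≤ 4 * B * c + 2 * η * B / μ) := by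
  obtain ⟨κ, hκ, k1, -, -, k2, k3, k4, k5⟩ := exists_shear_inverse_bound hs hc hj hη
  obtain ⟨L, hL, L1, L2, L3⟩ := exists_localized_primitive hij hs hκ k1 k2 k5 hint
  have hη0 : 0 ≤ η := (abs_nonneg _).trans (hη 0)
  have hc0 : 0 ≤ c := (abs_nonneg _).trans (hj 0)
  set k := lineInt i (-1) 1 κ with hk
  have hks : ContDiff ℝ (⊤ : ℕ∞) k := lineInt_smooth hκ i _ _
  have bk : ∀ x, |k x| ≤ 2 * η := fun x =>
    (abs_lineInt_le k3 i (by norm_num) x).trans (by linarith)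
  have bk' : ∀ x, |pd j k x| ≤ 4 * c := fun x => by
    rw [hk, pd_lineInt_ne hκ hij]
    exact (abs_lineInt_le k4 i (by norm_num) x).trans (by linarith)
  have L4 : ∀ y, L y ≠ 0 → ∃ t : ℝ, h (y + t • ev i) ≠ 0 := fun y hy => by
    by_contra! h'; exact hy (L3 y h')
  have L5 : ∀ y, k y ≠ 0 → ∃ t : ℝ, h (y + t • ev i) ≠ 0 := fun y hy => by
    by_contra! h'; exact hy (lineInt_eq_zero fun t => k2 _ (h' t))
  have coord : ∀ (y : V d) (t : ℝ), (y + t • ev i) j = y j := fun y t => by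
    simp [ev_ne hij.symm]
  have bL : ∀ y, |L y| ≤ 8 * a * η := by
    intro y
    by_cases hy : L y = 0
    · rw [hy, abs_zero]; positivity
    · obtain ⟨t, ht⟩ := L4 y hy
      have c1 := (hh _ ht).2
      rw [coord] at c1
      have e1 : L (y + (Real.pi * a) • ev j) = 0 := by
        by_contra hne
        obtain ⟨t, ht⟩ := L4 _ hne
        have c2 := (hh _ ht).2
        rw [coord] at c2
        have : (y + (Real.pi * a) • ev j) j / a - τ = y j / a - τ + Real.pi := by
          simp only [PiLp.add_apply, PiLp.smul_apply, ev_same, smul_eq_mul, mul_one]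
          field_simp
          ring
        rw [this, Real.cos_add_pi] at c2
        norm_num at c1 c2
        linarith
      have := abs_sub_le_of_pd (diff_of_smooth hL) (i := j) (c := 2 * η)
        (fun x => by rw [L2]; exact bk x) y (Real.pi * a)
      rw [e1, zero_sub, abs_neg, abs_of_pos (mul_pos Real.pi_pos ha)] at this
      refine this.trans ?_
      have h1 := Real.pi_le_four
      have h2 := mul_le_mul_of_nonneg_right h1 (mul_nonneg ha.le hη0)
      linarith
  let b : V d → ℝ := fun x => deriv step (x i)
  let b' : V d → ℝ := fun x => deriv (deriv step) (x i)
  have sb := contDiff_deriv step_smooth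
  have hb : ContDiff ℝ (⊤ : ℕ∞) b := sb.comp (contDiff_coord i)
  have hb' : ContDiff ℝ (⊤ : ℕ∞) b' := (contDiff_deriv sb).comp (contDiff_coord i)
  have hbL : ContDiff ℝ (⊤ : ℕ∞) fun x => b x * L x := hb.mul hL
  have hg : ContDiff ℝ (⊤ : ℕ∞) fun x => μ⁻¹ * (b x * L x) := contDiff_const.mul hbL
  have pig : ∀ x, pd i (fun x => μ⁻¹ * (b x * L x)) x = μ⁻¹ * (b' x * L x) := fun x => by
    rw [pd_const_mul (diff_of_smooth hbL), pd_mul (diff_of_smooth hb) (diff_of_smooth hL), L1,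
      pd_coord_same (diff_of_smooth sb)]
    simp only [b']; ring
  have pjg : ∀ x, pd j (fun x => μ⁻¹ * (b x * L x)) x = μ⁻¹ * (b x * k x) := fun x => by
    rw [pd_const_mul (diff_of_smooth hbL), pd_mul (diff_of_smooth hb) (diff_of_smooth hL), L2,
      pd_coord_ne (diff_of_smooth sb) hij]
    ring
  have s1 : ContDiff ℝ (⊤ : ℕ∞) fun x => μ⁻¹ * (b' x * L x) := contDiff_const.mul (hb'.mul hL)
  have s2 : ContDiff ℝ (⊤ : ℕ∞) fun x => b x * k x := hb.mul hks
  have loc : ∀ y : V d, |y i| ≤ 4 → (∃ t : ℝ, h (y + t • ev i) ≠ 0) →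
      ‖y‖ ≤ 6 ∧ 0.6 ≤ Real.cos (y j / a - τ) := by
    rintro y hy ⟨t, ht⟩
    refine ⟨norm_le_of_line (fun x hx => (hh x hx).1) hy ht, ?_⟩
    have := (hh _ ht).2
    rwa [coord] at this
  have hμ' : 0 < μ⁻¹ := inv_pos.2 hμ
  have bB : ∀ x, |b x| ≤ B := fun x => hB1 _
  have bB' : ∀ x, |b' x| ≤ B := fun x => hB2 _
  have hB0 : 0 ≤ B := by linarith
  refine ⟨κ, fun x => μ⁻¹ * (b' x * L x) - b x * k x, fun x => μ⁻¹ * (b x * L x), hκ, hg,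
    s1.sub s2, k1, k3, k4, fun x hx => hh x fun h0 => hx (k2 x h0), fun x hx => ?_, fun x hx => ?_,
    fun x => ?_, fun x => ?_, fun x => ?_, fun x => ?_⟩
  · have h1 : b x ≠ 0 := fun h => hx (by simp [h])
    have h2 : L x ≠ 0 := fun h => hx (by simp [h])
    have h3 : 2 ≤ x i := by
      by_contra h; exact h1 (deriv_step_of_le (by linarith))
    have h4 : x i ≤ 4 := by
      by_contra h; exact h1 (deriv_step_of_ge (by linarith))
    exact ⟨⟨h3, h4⟩, loc x (abs_le.2 ⟨by linarith, h4⟩) (L4 x h2)⟩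
  · have h3 : 2 < x i := by
      by_contra h
      apply hx
      simp [b, b', deriv_step_of_le (not_lt.1 h), deriv2_step_of_le (not_lt.1 h)]
    have h4 : x i ≤ 4 := by
      by_contra h
      apply hx
      simp [b, b', deriv_step_of_ge (not_le.1 h).le, deriv2_step_of_ge (not_le.1 h).le]
    refine ⟨⟨h3, h4⟩, loc x (abs_le.2 ⟨by linarith, h4⟩) ?_⟩
    by_cases hLx : L x = 0
    · exact L5 x fun h => hx (by simp [h, hLx])
    · exact L4 x hLx
  · rw [pig, pjg, mul_inv_cancel_left₀ hμ.ne']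
  · rw [pd_add (diff_of_smooth (pot_smooth hκ i)) (diff_of_smooth hg), pig, pd_pot_same hκ]
    simp only [b]; ring
  · refine (abs_sub _ _).trans ?_
    rw [abs_mul, abs_mul, abs_mul, abs_of_pos hμ']
    have e1 : |b' x| * |L x| ≤ B * (8 * a * η) :=
      mul_le_mul (bB' x) (bL x) (abs_nonneg _) hB0
    have e2 : |b x| * |k x| ≤ B * (2 * η) := mul_le_mul (bB x) (bk x) (abs_nonneg _) hB0
    have e3 := mul_le_mul_of_nonneg_left e1 hμ'.le
    calc _ ≤ μ⁻¹ * (B * (8 * a * η)) + B * (2 * η) := add_le_add e3 e2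
      _ = _ := by field_simp; ring
  · rw [pd_sub (diff_of_smooth s1) (diff_of_smooth s2), pd_const_mul (diff_of_smooth (hb'.mul hL)),
      pd_mul (diff_of_smooth hb') (diff_of_smooth hL), pd_mul (diff_of_smooth hb)
      (diff_of_smooth hks), L2, pd_coord_ne (diff_of_smooth (contDiff_deriv sb)) hij,
      pd_coord_ne (diff_of_smooth sb) hij, mul_zero, mul_zero, add_zero, add_zero]
    refine (abs_sub _ _).trans ?_
    rw [abs_mul, abs_mul, abs_mul, abs_of_pos hμ']
    have e1 : |b' x| * |k x| ≤ B * (2 * η) :=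
      mul_le_mul (bB' x) (bk x) (abs_nonneg _) hB0
    have e2 : |b x| * |pd j k x| ≤ B * (4 * c) := mul_le_mul (bB x) (bk' x) (abs_nonneg _) hB0
    have e3 := mul_le_mul_of_nonneg_left e1 hμ'.le
    calc _ ≤ μ⁻¹ * (B * (2 * η)) + B * (4 * c) := add_le_add e3 e2
      _ = _ := by field_simp; ring

theorem rep_of_slab_diffeos {j : Fin d} {a : ℝ} {h : V d → ℝ} {w : V d → ℝ}
    {Φ₀ Φ₂ Φ₃ : V d → V d} (h0 : IsCompSuppVolDiffeo d Φ₀)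
    (h2 : IsCompSuppVolDiffeo d Φ₂) (h3 : IsCompSuppVolDiffeo d Φ₃) {κ₀ κ₂ κ₃ : V d → ℝ}
    (s0 : Function.Surjective (shear j κ₀)) (s2 : Function.Surjective (shear j κ₂))
    (s3 : Function.Surjective (shear j κ₃))
    (e0 : ∀ y, w (Φ₀ (shear j κ₀ y)) - w (shear j κ₀ y) = - κ₀ y / a)
    (e2 : ∀ y, w (Φ₂ (shear j κ₂ y)) - w (shear j κ₂ y) = - κ₂ y / a)
    (e3 : ∀ y, w (Φ₃ (shear j κ₃ y)) - w (shear j κ₃ y) = - κ₃ y / a)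
    (hsum : ∀ x z y q, shear j κ₀ z = x → shear j κ₃ y = x → shear j κ₂ q = x →
      h x = - κ₀ z + κ₃ y - κ₂ q) : Rep w 2 (fun x => h x / a) := by
  have := (Rep.single h0 diffeo_id (u := w)).sub (Rep.single h3 h2 (u := w))
  refine (this.mono (by norm_num)).congr fun x => ?_
  obtain ⟨z, hz⟩ := s0 x
  obtain ⟨y, hy⟩ := s3 x
  obtain ⟨q, hq⟩ := s2 x
  have f0 := e0 z
  have f2 := e2 q
  have f3 := e3 y
  rw [hz] at f0
  rw [hq] at f2
  rw [hy] at f3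
  rw [hsum x z y q hz hy hq, id]
  have : (-κ₀ z + κ₃ y - κ₂ q) / a = - κ₀ z / a - (- κ₃ y / a) + - κ₂ q / a := by ring
  rw [this, ← f0, ← f2, ← f3]
  ring

theorem pd_part_mul {φ : ℝ → ℝ} (hφ : ContDiff ℝ (⊤ : ℕ∞) φ) {f : V d → ℝ}
    (hf : ContDiff ℝ (⊤ : ℕ∞) f) (j : Fin d) (a τ : ℝ) (x : V d) :
    pd j (fun x => φ (x j / a - τ) * f x) x =
      φ (x j / a - τ) * pd j f x + deriv φ (x j / a - τ) / a * f x := by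
  have h1 : ContDiff ℝ (⊤ : ℕ∞) fun t : ℝ => φ (t / a - τ) :=
    hφ.comp ((contDiff_id.div_const a).sub contDiff_const)
  have h2 : HasDerivAt (fun t : ℝ => φ (t / a - τ)) (deriv φ (x j / a - τ) * (1 / a)) (x j) :=
    HasDerivAt.comp (x j) (diff_of_smooth hφ _).hasDerivAt
      (((hasDerivAt_id _).div_const a).sub_const τ)
  rw [pd_mul (f := fun x : V d => φ (x j / a - τ)) (diff_of_smooth (h1.comp (contDiff_coord j)))
    (diff_of_smooth hf), pd_coord_same (φ := fun t => φ (t / a - τ)) (diff_of_smooth h1), h2.deriv]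
  ring

theorem pd_part_mul_ne {φ : ℝ → ℝ} (hφ : ContDiff ℝ (⊤ : ℕ∞) φ) {f : V d → ℝ}
    (hf : ContDiff ℝ (⊤ : ℕ∞) f) {i j : Fin d} (hij : i ≠ j) (a τ : ℝ) (x : V d) :
    pd i (fun x => φ (x j / a - τ) * f x) x = φ (x j / a - τ) * pd i f x := by
  have h1 : ContDiff ℝ (⊤ : ℕ∞) fun t : ℝ => φ (t / a - τ) :=
    hφ.comp ((contDiff_id.div_const a).sub contDiff_const)
  rw [pd_mul (f := fun x : V d => φ (x j / a - τ)) (diff_of_smooth (h1.comp (contDiff_coord j)))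
    (diff_of_smooth hf), pd_coord_ne (φ := fun t => φ (t / a - τ)) (diff_of_smooth h1) hij.symm]
  ring

theorem part_mul_smooth {φ : ℝ → ℝ} (hφ : ContDiff ℝ (⊤ : ℕ∞) φ) {f : V d → ℝ}
    (hf : ContDiff ℝ (⊤ : ℕ∞) f) (j : Fin d) (a τ : ℝ) :
    ContDiff ℝ (⊤ : ℕ∞) (fun x : V d => φ (x j / a - τ) * f x) := by
  have h1 : ContDiff ℝ (⊤ : ℕ∞) fun t : ℝ => φ (t / a - τ) :=
    hφ.comp ((contDiff_id.div_const a).sub contDiff_const)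
  exact (h1.comp (contDiff_coord j)).mul hf

/-- A function with vanishing integrals in direction `i`, localized in a slab, is a combination
of two differences. -/
theorem exists_rep_slab {i j : Fin d} (hij : i ≠ j) : ∃ ε : ℝ, 0 < ε ∧ ∀ (τ : ℝ) (f : V d → ℝ),
    ContDiff ℝ (⊤ : ℕ∞) f → (∀ x, f x ≠ 0 → ‖x‖ ≤ 1) → (∀ x, lineInt i (-1) 1 f x = 0) →
    (∀ x, |f x| ≤ ε) → ∃ a₀ : ℝ, 0 < a₀ ∧ ∀ a, 0 < a → a ≤ a₀ → ∀ w, ZoneAffine j a τ w →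
      Rep w 2 (fun x => part (x j / a - τ) * f x) := by
  obtain ⟨B, hB, hB1, hB2⟩ := exists_step_bound
  obtain ⟨W, hW, hW1, hW2⟩ := exists_cut_bound
  obtain ⟨Q, hQ, Q1, Q2, C, hC, hC1, hC2⟩ := exists_cut_parabola i j
  have hB0 : 0 < B := by linarith
  have hW0 : 0 < W := by linarith
  have hC0 : 0 < C := by linarith
  obtain ⟨c, hc⟩ : ∃ c : ℝ, c = 1 / (40 * C * W) := ⟨_, rfl⟩
  have c0 : 0 < c := by rw [hc]; positivity
  have cCW : c * (C * W) = 1 / 40 := by rw [hc]; field_simp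
  have cC : c * C ≤ 1 / 40 := by
    rw [← cCW]; gcongr; nlinarith
  have c1 : c ≤ 1 / 40 := le_trans (by nlinarith) cC
  obtain ⟨ε, hε⟩ : ∃ ε : ℝ, ε = c / (1000 * (B * W)) := ⟨_, rfl⟩
  have ε0 : 0 < ε := by rw [hε]; positivity
  have εBW : ε * (B * W) = c / 1000 := by rw [hε]; field_simp
  have εB : ε * B ≤ c / 1000 := by
    rw [← εBW]; gcongr; nlinarith
  have εW : ε * W ≤ c / 1000 := by
    rw [← εBW]; gcongr; nlinarith
  refine ⟨ε, ε0, fun τ f hf f1 f2 f3 => ?_⟩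
  obtain ⟨D, hD, hD1⟩ := exists_bound (contDiff_pd hf j).continuous
    (hasCompactSupport_pd (hasCompactSupport_of_norm f1) j)
  have hD0 : 0 < D := by linarith
  refine ⟨min 1 (ε / D), by positivity, fun a ha haa w hw => ?_⟩
  have a1 : a ≤ 1 := haa.trans (min_le_left _ _)
  have aD : a * D ≤ ε := (le_div_iff₀ hD0).1 (haa.trans (min_le_right _ _))
  obtain ⟨h, hh⟩ : ∃ h : V d → ℝ, h = fun x => a * (part (x j / a - τ) * f x) := ⟨_, rfl⟩
  have hpf := part_mul_smooth part_smooth hf j a τ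
  have hsm : ContDiff ℝ (⊤ : ℕ∞) h := by rw [hh]; exact contDiff_const.mul hpf
  have h1 : ∀ x, |h x| ≤ a * ε := fun x => by
    rw [hh, abs_mul, abs_mul, abs_of_pos ha]
    have := mul_le_mul (abs_part_le (x j / a - τ)) (f3 x) (abs_nonneg _) zero_le_one
    gcongr
    linarith
  have h2 : ∀ x, |pd j h x| ≤ 2 * W * ε := fun x => by
    rw [hh, pd_const_mul (diff_of_smooth hpf), pd_part_mul part_smooth hf]
    have e1 : a * (part (x j / a - τ) * pd j f x + deriv part (x j / a - τ) / a * f x) =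
        a * (part (x j / a - τ) * pd j f x) + deriv part (x j / a - τ) * f x := by
      field_simp
    rw [e1]
    refine (abs_add_le _ _).trans ?_
    rw [abs_mul, abs_mul, abs_mul, abs_of_pos ha]
    have e2 := mul_le_mul (abs_part_le (x j / a - τ)) (hD1 x) (abs_nonneg _) zero_le_one
    have e3 := mul_le_mul (hW2 (x j / a - τ)) (f3 x) (abs_nonneg _) hW0.le
    have e4 := mul_le_mul_of_nonneg_left e2 ha.le
    nlinarith
  have h3 : ∀ x, h x ≠ 0 → ‖x‖ ≤ 1 ∧ 0.6 ≤ Real.cos (x j / a - τ) := fun x hx => by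
    rw [hh] at hx
    refine ⟨f1 x fun h => hx (by simp [h]), ?_⟩
    by_contra h
    exact hx (by simp [part_zero (not_le.1 h).le])
  have h4 : ∀ x, lineInt i (-1) 1 h x = 0 := fun x => by
    have : lineInt i (-1) 1 h x = a * part (x j / a - τ) * lineInt i (-1) 1 f x := by
      unfold lineInt
      rw [hh, ← intervalIntegral.integral_const_mul]
      refine intervalIntegral.integral_congr fun t _ => ?_
      simp [ev_ne hij.symm, mul_assoc]
    rw [this, f2, mul_zero]
  have hc2 : 2 * W * ε ≤ 1 / 2 := by linarith
  have μ0 : 0 < c * a := by positivity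
  obtain ⟨κ, κ₁, g, hκ, hg, hκ₁, k1, k2, k3, k4, g1, k5, k6, k7, k8, k9⟩ :=
    exists_correction hij hsm ha μ0 hB hB1 hB2 hc2 h2 h1 h3 h4
  have b1 : ∀ x, |κ₁ x| ≤ 0.01 * a := fun x => by
    refine (k8 x).trans ?_
    have e1 : 8 * a * (a * ε) * B / (c * a) = 8 * a * (ε * B / c) := by field_simp
    have e2 : ε * B / c ≤ 1 / 1000 := by
      rw [div_le_iff₀ c0]; linarith
    have e3 : 2 * B * (a * ε) = 2 * a * (ε * B) := by ring
    rw [e1, e3]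
    have e4 : ε * B ≤ 1 / 1000 := by linarith
    have e5 := mul_le_mul_of_nonneg_left e2 ha.le
    have e6 := mul_le_mul_of_nonneg_left e4 ha.le
    linarith
  have b2 : ∀ x, |pd j κ₁ x| ≤ 0.01 := fun x => by
    refine (k9 x).trans ?_
    have e1 : 2 * (a * ε) * B / (c * a) = 2 * (ε * B / c) := by field_simp
    have e2 : ε * B / c ≤ 1 / 1000 := by
      rw [div_le_iff₀ c0]; linarith
    have e3 : 4 * B * (2 * W * ε) = 8 * (ε * (B * W)) := by ring
    rw [e1, e3, εBW]
    linarith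
  obtain ⟨s, hs⟩ : ∃ s : V d → ℝ, s = fun x => - (c * a * (x i - 3)) := ⟨_, rfl⟩
  have ss : ContDiff ℝ (⊤ : ℕ∞) s := by
    have := contDiff_coord i
    rw [hs]; fun_prop
  have sφ : Differentiable ℝ fun t : ℝ => -(c * a * (t - 3)) := by fun_prop
  have ps : ∀ x, pd i s x = - (c * a) := fun x => by
    rw [hs, pd_coord_same sφ]
    have : HasDerivAt (fun t : ℝ => -(c * a * (t - 3))) (-(c * a * 1)) (x i) :=
      (((hasDerivAt_id _).sub_const 3).const_mul (c * a)).neg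
    rw [this.deriv, mul_one]
  have ps' : ∀ x, pd j s x = 0 := fun x => by
    rw [hs, pd_coord_ne sφ hij]
  let K₂ : V d → ℝ := fun y => -(c * a) * (cutX (y j / a - τ) * Q y)
  let K₀ : V d → ℝ := fun x => pot i κ x + g x
  let K₃ : V d → ℝ := fun y => K₂ y + g (shear j s y)
  have hXQ := part_mul_smooth cutX_smooth hQ j a τ
  have hK₂ : ContDiff ℝ (⊤ : ℕ∞) K₂ := contDiff_const.mul hXQ
  have hK₀ : ContDiff ℝ (⊤ : ℕ∞) K₀ := (pot_smooth hκ i).add hg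
  have hgs : ContDiff ℝ (⊤ : ℕ∞) fun y => g (shear j s y) := hg.comp (shear_smooth ss j)
  have hK₃ : ContDiff ℝ (⊤ : ℕ∞) K₃ := hK₂.add hgs
  have p2 : ∀ y, pd i K₂ y = -(c * a) * (cutX (y j / a - τ) * pd i Q y) := fun y => by
    simp only [K₂]
    rw [pd_const_mul (diff_of_smooth hXQ), pd_part_mul_ne cutX_smooth hQ hij]
  have p3 : ∀ y, pd i K₃ y = pd i K₂ y + κ₁ (shear j s y) := fun y => by
    simp only [K₃]
    rw [pd_add (diff_of_smooth hK₂) (diff_of_smooth hgs), pd_comp_shear (diff_of_smooth hg)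
      (diff_of_smooth ss), ps, k6]
    ring
  have q2 : ∀ y, |pd j (pd i K₂) y| ≤ 1 / 20 := fun y => by
    have hXQ' := part_mul_smooth cutX_smooth (contDiff_pd hQ i) j a τ
    rw [show pd i K₂ = _ from funext p2, pd_const_mul (diff_of_smooth hXQ'),
      pd_part_mul cutX_smooth (contDiff_pd hQ i)]
    have e1 : -(c * a) * (cutX (y j / a - τ) * pd j (pd i Q) y +
        deriv cutX (y j / a - τ) / a * pd i Q y) =
        - (c * a * (cutX (y j / a - τ) * pd j (pd i Q) y)) -
          c * (deriv cutX (y j / a - τ) * pd i Q y) := by field_simp; ring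
    rw [e1]
    refine (abs_sub _ _).trans ?_
    rw [abs_neg, abs_mul (c * a), abs_mul (cutX _), abs_mul c (_ * _), abs_mul (deriv cutX _),
      abs_of_pos μ0, abs_of_pos c0]
    have e2 := mul_le_mul (abs_cutX_le (y j / a - τ)) (hC2 y) (abs_nonneg _) zero_le_one
    have e3 := mul_le_mul (hW1 (y j / a - τ)) (hC1 y) (abs_nonneg _) hW0.le
    have e4 := mul_le_mul_of_nonneg_left e2 μ0.le
    have e5 := mul_le_mul_of_nonneg_left e3 c0.le
    have e6 : c * a * (1 * C) ≤ c * C := by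
      have : c * a * (1 * C) = c * C * a := by ring
      rw [this]; exact mul_le_of_le_one_right (by positivity) a1
    nlinarith
  have r2 : ∀ y, |pd i K₂ y| ≤ 0.025 * a := fun y => by
    rw [p2, abs_mul, abs_neg, abs_mul (cutX _), abs_of_pos μ0]
    have e2 := mul_le_mul (abs_cutX_le (y j / a - τ)) (hC1 y) (abs_nonneg _) zero_le_one
    have e4 := mul_le_mul_of_nonneg_left e2 μ0.le
    have e6 : c * a * (1 * C) = c * C * a := by ring
    have e7 := mul_le_mul_of_nonneg_right cC ha.le
    linarith
  have q3 : ∀ y, |pd j (pd i K₃) y| ≤ 1 / 2 := fun y => by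
    have hκs : ContDiff ℝ (⊤ : ℕ∞) fun y => κ₁ (shear j s y) := hκ₁.comp (shear_smooth ss j)
    rw [show pd i K₃ = _ from funext p3, pd_add (diff_of_smooth (contDiff_pd hK₂ i))
      (diff_of_smooth hκs), pd_comp_shear (diff_of_smooth hκ₁) (diff_of_smooth ss), ps', zero_mul,
      add_zero]
    have := abs_add_le (pd j (pd i K₂) y) (pd j κ₁ (shear j s y))
    have := q2 y
    have := b2 (shear j s y)
    linarith
  have r3 : ∀ y, |pd i K₃ y| ≤ 0.1 * a := fun y => by
    rw [p3]
    have := abs_add_le (pd i K₂ y) (κ₁ (shear j s y))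
    have := r2 y
    have := b1 (shear j s y)
    linarith
  have p0 : ∀ y, pd i K₀ y = κ y + κ₁ y := k7
  have q0 : ∀ y, |pd j (pd i K₀) y| ≤ 1 / 2 := fun y => by
    rw [show pd i K₀ = _ from funext p0, pd_add (diff_of_smooth hκ) (diff_of_smooth hκ₁)]
    have := abs_add_le (pd j κ y) (pd j κ₁ y)
    have := k3 y
    have := b2 y
    linarith
  have r0 : ∀ y, |pd i K₀ y| ≤ 0.1 * a := fun y => by
    rw [p0]
    have := abs_add_le (κ y) (κ₁ y)
    have := k2 y
    have := b1 y
    have : a * ε ≤ a * (1 / 100) := by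
      gcongr
      nlinarith
    linarith
  have shift : ∀ (z : V d) (t : ℝ), |t| ≤ 0.1 * a → ‖z‖ ≤ 7 → ∀ r, r ≤ Real.cos (z j / a - τ) →
      ‖z + t • ev j‖ ≤ 8 ∧ r - 0.1 ≤ Real.cos ((z + t • ev j) j / a - τ) := by
    intro z t ht hz r hr
    constructor
    · refine (norm_add_le _ _).trans ?_
      rw [norm_smul, norm_ev, Real.norm_eq_abs]
      linarith
    · refine cos_zone ha ?_ hr
      simp only [PiLp.add_apply, PiLp.smul_apply, ev_same, smul_eq_mul, mul_one]
      rwa [sub_add_cancel_left, abs_neg]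
  have small : ∀ z : V d, (2 ≤ z i ∧ z i ≤ 4) → |c * a * (z i - 3)| ≤ 0.05 * a := fun z hz => by
    rw [abs_mul, abs_of_pos μ0]
    have e1 : |z i - 3| ≤ 1 := abs_le.2 ⟨by linarith, by linarith⟩
    have e2 := mul_le_mul_of_nonneg_left e1 μ0.le
    have e3 := mul_le_mul_of_nonneg_right c1 ha.le
    linarith
  have t0 : ∀ y, K₀ y ≠ 0 → y ∈ slab j a τ := fun y hy => by
    by_cases hgy : g y = 0
    · have hp : pot i κ y ≠ 0 := fun h => hy (by simp [K₀, h, hgy])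
      obtain ⟨e1, t, e2⟩ := pot_support hκ.continuous
        (fun x hx => abs_coord_le (k4 x hx).1 i) hp
      have e3 := norm_le_of_line (fun x hx => (k4 x hx).1) e1 e2
      have e4 := (k4 _ e2).2
      simp only [PiLp.add_apply, PiLp.smul_apply, ev_ne hij.symm, smul_eq_mul, mul_zero,
        add_zero] at e4
      exact ⟨by linarith, by linarith⟩
    · obtain ⟨-, e3, e4⟩ := g1 y hgy
      exact ⟨by linarith, by linarith⟩
  have t2 : ∀ y, K₂ y ≠ 0 → y ∈ slab j a τ := fun y hy => by
    refine ⟨Q1 y fun h => hy (by simp [K₂, h]), ?_⟩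
    by_contra h
    exact hy (by simp [K₂, cutX_zero (not_le.1 h).le])
  have t3 : ∀ y, K₃ y ≠ 0 → y ∈ slab j a τ := fun y hy => by
    by_cases hk : K₂ y = 0
    · have hgy : g (shear j s y) ≠ 0 := fun h => hy (by simp [K₃, h, hk])
      obtain ⟨e1, e2, e3⟩ := g1 _ hgy
      have e4 : y = shear j s y + (c * a * (shear j s y i - 3)) • ev j := by
        rw [shear_ne hij]; simp only [shear, hs]; module
      have e5 := small _ e1
      obtain ⟨e6, e7⟩ := shift _ _ (e5.trans (by linarith)) (by linarith) _ e3
      rw [← e4] at e6 e7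
      exact ⟨by linarith, by linarith⟩
    · exact t2 y hk
  obtain ⟨Φ₀, hΦ₀, w0⟩ := exists_slab_diffeo hij ha hK₀ t0 r0 q0
  obtain ⟨Φ₂, hΦ₂, w2⟩ := exists_slab_diffeo hij ha hK₂ t2
    (fun y => (r2 y).trans (by norm_num; linarith)) (fun y => (q2 y).trans (by norm_num))
  obtain ⟨Φ₃, hΦ₃, w3⟩ := exists_slab_diffeo hij ha hK₃ t3 r3 q3
  have i2 := shear_bijective (diff_of_smooth (contDiff_pd hK₂ i))
    (fun y => (q2 y).trans (by norm_num))
  have i3 := shear_bijective (diff_of_smooth (contDiff_pd hK₃ i)) q3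
  have i0 := shear_bijective (diff_of_smooth (contDiff_pd hK₀ i)) q0
  have val : ∀ y : V d, ‖y‖ < 10 → 0.5 ≤ Real.cos (y j / a - τ) →
      pd i K₂ y = -(c * a * (y i - 3)) := fun y hy hy' => by
    rw [p2, Q2 y hy, cutX_one hy']; ring
  refine (rep_of_slab_diffeos (h := h) hΦ₀ hΦ₂ hΦ₃ i0.2 i2.2 i3.2 (w0 w hw) (w2 w hw) (w3 w hw)
    fun x z y q hz hy hq => ?_).congr fun x => by rw [hh]; field_simp
  refine displacement_sum hij (s := s) (μ := c * a) (κ := κ) (κ₁ := κ₁) (fun x => by rw [hs]) k1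
    (fun x hx => abs_coord_le (h3 x hx).1 i) (fun x hx => abs_coord_le (k4 x hx).1 i)
    (fun x hx => (k5 x hx).1.1) (fun v hv => ?_) p0 p3 i2.1 i3.1 hz hy hq
  obtain ⟨e1, e2, e3⟩ := k5 v hv
  have e5 := small v ⟨e1.1.le, e1.2⟩
  have e6 := b1 v
  obtain ⟨e7, e8⟩ := shift v _ (e5.trans (by linarith)) (by linarith) _ e3
  obtain ⟨e9, e10⟩ := shift v (κ₁ v + c * a * (v i - 3))
    ((abs_add_le _ _).trans (by linarith)) (by linarith) _ e3
  have e11 : shear j κ₁ v + (c * a * (v i - 3)) • ev j =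
    v + (κ₁ v + c * a * (v i - 3)) • ev j := by simp only [shear]; module
  rw [e11, val _ (by linarith) (by linarith),
    val _ (by linarith) (by linarith)]
  simp [ev_ne hij]

/-- Projection to the plane of the coordinates `i` and `j`. -/
noncomputable def planeProj (i j : Fin d) : V d →L[ℝ] V d :=
  (EuclideanSpace.proj i : V d →L[ℝ] ℝ).smulRight (ev i) +
    (EuclideanSpace.proj j : V d →L[ℝ] ℝ).smulRight (ev j)

/-- Quarter turn in the plane of the coordinates `i` and `j`, composed with the projection. -/
noncomputable def planeTurn (i j : Fin d) : V d →L[ℝ] V d :=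
  (EuclideanSpace.proj i : V d →L[ℝ] ℝ).smulRight (ev j) -
    (EuclideanSpace.proj j : V d →L[ℝ] ℝ).smulRight (ev i)

theorem planeProj_apply (i j : Fin d) (x : V d) : planeProj i j x = x i • ev i + x j • ev j := by
  simp [planeProj]

theorem planeTurn_apply (i j : Fin d) (x : V d) : planeTurn i j x = x i • ev j - x j • ev i := by
  simp [planeTurn]

/-- Rotation by the angle `φ` in the plane of the coordinates `i` and `j`. -/
noncomputable def rot (i j : Fin d) (φ : ℝ) : V d →L[ℝ] V d :=
  ContinuousLinearMap.id ℝ (V d) + (Real.cos φ - 1) • planeProj i j + Real.sin φ • planeTurn i j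

theorem rot_apply (i j : Fin d) (φ : ℝ) (x : V d) : rot i j φ x =
    x + (Real.cos φ - 1) • planeProj i j x + Real.sin φ • planeTurn i j x := by
  simp [rot]

theorem rot_fst {i j : Fin d} (hij : i ≠ j) (φ : ℝ) (x : V d) :
    rot i j φ x i = Real.cos φ * x i - Real.sin φ * x j := by
  simp [rot_apply, planeProj_apply, planeTurn_apply, ev_ne hij, ev_same]; ring

theorem rot_snd {i j : Fin d} (hij : i ≠ j) (φ : ℝ) (x : V d) :
    rot i j φ x j = Real.sin φ * x i + Real.cos φ * x j := by
  simp [rot_apply, planeProj_apply, planeTurn_apply, ev_ne hij.symm, ev_same]; ring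

theorem rot_other {i j k : Fin d} (hi : k ≠ i) (hj : k ≠ j) (φ : ℝ) (x : V d) :
    rot i j φ x k = x k := by
  simp [rot_apply, planeProj_apply, planeTurn_apply, ev_ne hi, ev_ne hj]

theorem rot_rot {i j : Fin d} (hij : i ≠ j) (φ ψ : ℝ) (x : V d) :
    rot i j φ (rot i j ψ x) = rot i j (φ + ψ) x := by
  ext k
  by_cases hi : k = i
  · subst hi
    rw [rot_fst hij, rot_fst hij, rot_fst hij, rot_snd hij, Real.cos_add, Real.sin_add]; ring
  by_cases hj : k = j
  · subst hj
    rw [rot_snd hij, rot_snd hij, rot_fst hij, rot_snd hij, Real.cos_add, Real.sin_add]; ring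
  · simp only [rot_other hi hj]

theorem rot_zero (i j : Fin d) (x : V d) : rot i j 0 x = x := by
  simp [rot_apply]

theorem inner_ev (x : V d) (i : Fin d) : inner ℝ x (ev i) = x i := by
  simp [ev, EuclideanSpace.inner_single_right]

theorem inner_planeTurn (i j : Fin d) (x : V d) : inner ℝ x (planeTurn i j x) = 0 := by
  rw [planeTurn_apply, inner_sub_right, inner_smul_right, inner_smul_right, inner_ev, inner_ev]
  ring

theorem norm_rot {i j : Fin d} (hij : i ≠ j) (φ : ℝ) (x : V d) : ‖rot i j φ x‖ = ‖x‖ := by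
  have key : ∀ k, k ∉ ({i, j} : Finset (Fin d)) → rot i j φ x k = x k := fun k hk => by
    simp only [Finset.mem_insert, Finset.mem_singleton, not_or] at hk
    exact rot_other hk.1 hk.2 φ x
  rw [EuclideanSpace.norm_eq, EuclideanSpace.norm_eq]
  congr 1
  rw [← Finset.sum_add_sum_compl {i, j}, ← Finset.sum_add_sum_compl {i, j} (fun k => ‖x k‖ ^ 2),
    Finset.sum_pair hij, Finset.sum_pair hij]
  congr 1
  · simp only [Real.norm_eq_abs, sq_abs, rot_fst hij, rot_snd hij]
    linear_combination (x i ^ 2 + x j ^ 2) * Real.sin_sq_add_cos_sq φ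
  · exact Finset.sum_congr rfl fun k hk => by rw [key k (Finset.mem_compl.1 hk)]

theorem det_rot {i j : Fin d} (hij : i ≠ j) (φ : ℝ) : (rot i j φ).det = 1 := by
  have mul : ∀ a b, (rot i j (a + b)).det = (rot i j a).det * (rot i j b).det := fun a b => by
    rw [ContinuousLinearMap.det, ContinuousLinearMap.det, ContinuousLinearMap.det,
      ← LinearMap.det_comp]
    congr 1
    ext x : 1
    exact (rot_rot hij a b x).symm
  have one : (rot i j 0).det = 1 := by
    have : rot i j 0 = ContinuousLinearMap.id ℝ (V d) := by ext x : 1; exact rot_zero i j x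
    rw [this]; exact LinearMap.det_id
  let S : V d →L[ℝ] V d := ContinuousLinearMap.id ℝ (V d) -
    (2 : ℝ) • (EuclideanSpace.proj j : V d →L[ℝ] ℝ).smulRight (ev j)
  have S1 : ∀ x, S x j = - x j := fun x => by simp [S, ev_same]; ring
  have S2 : ∀ x k, k ≠ j → S x k = x k := fun x k hk => by simp [S, ev_ne hk]
  have SS : (S : V d →ₗ[ℝ] V d) ∘ₗ S = LinearMap.id := by
    ext x k
    by_cases hk : k = j
    · subst hk; simp [S1]
    · simp [S2 _ k hk]
  have SRS : ∀ φ, ((rot i j (-φ) : V d →L[ℝ] V d) : V d →ₗ[ℝ] V d) =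
      (S : V d →ₗ[ℝ] V d) ∘ₗ ((rot i j φ : V d →L[ℝ] V d) : V d →ₗ[ℝ] V d) ∘ₗ S := by
    intro φ
    ext1 x
    ext k
    simp only [LinearMap.comp_apply, ContinuousLinearMap.coe_coe]
    by_cases hj : k = j
    · subst hj
      rw [S1, rot_snd hij, rot_snd hij, S1, S2 _ _ hij, Real.sin_neg, Real.cos_neg]; ring
    rw [S2 _ _ hj]
    by_cases hi : k = i
    · subst hi
      rw [rot_fst hij, rot_fst hij, S1, S2 _ _ hij, Real.sin_neg, Real.cos_neg]; ring
    · rw [rot_other hi hj, rot_other hi hj, S2 _ _ hj]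
  have neg : ∀ φ, (rot i j (-φ)).det = (rot i j φ).det := by
    intro φ
    rw [ContinuousLinearMap.det, SRS, LinearMap.det_comp, LinearMap.det_comp,
      ContinuousLinearMap.det]
    have := congrArg LinearMap.det SS
    rw [LinearMap.det_comp, LinearMap.det_id] at this
    linear_combination LinearMap.det ((rot i j φ : V d →L[ℝ] V d) : V d →ₗ[ℝ] V d) * this
  have h1 := mul (φ / 2) (φ / 2)
  have h2 := mul (φ / 2) (-(φ / 2))
  rw [add_halves] at h1
  rw [add_neg_cancel, one, neg] at h2
  rw [h1, ← h2]

/-- Rotation of spheres about the origin by an angle `θ` depending on the point. -/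
noncomputable def twist (i j : Fin d) (θ : V d → ℝ) (x : V d) : V d := rot i j (θ x) x

theorem twist_smooth {θ : V d → ℝ} (hθ : ContDiff ℝ (⊤ : ℕ∞) θ) (i j : Fin d) :
    ContDiff ℝ (⊤ : ℕ∞) (twist i j θ) := by
  have : twist i j θ = fun x => x + (Real.cos (θ x) - 1) • planeProj i j x +
      Real.sin (θ x) • planeTurn i j x := funext fun x => rot_apply _ _ _ _
  rw [this]
  exact (contDiff_id.add (((Real.contDiff_cos.comp hθ).sub contDiff_const).smul
    (planeProj i j).contDiff)).add ((Real.contDiff_sin.comp hθ).smul (planeTurn i j).contDiff)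

theorem twist_twist {i j : Fin d} (hij : i ≠ j) {θ : V d → ℝ}
    (hθ : ∀ x y, ‖x‖ = ‖y‖ → θ x = θ y) (x : V d) :
    twist i j (fun x => - θ x) (twist i j θ x) = x := by
  simp only [twist]
  rw [hθ (rot i j (θ x) x) x (norm_rot hij _ _), rot_rot hij, neg_add_cancel, rot_zero]

theorem det_twist {i j : Fin d} (hij : i ≠ j) {θ : V d → ℝ} {x : V d}
    (hθ : DifferentiableAt ℝ θ x) (h : fderiv ℝ θ x (planeTurn i j x) = 0) :
    (fderiv ℝ (twist i j θ) x).det = 1 := by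
  have e1 : twist i j θ = fun x => x + (Real.cos (θ x) - 1) • planeProj i j x +
      Real.sin (θ x) • planeTurn i j x := funext fun x => rot_apply _ _ _ _
  have h1 := hθ.hasFDerivAt
  have h2 := ((hasFDerivAt_id (𝕜 := ℝ) x).add ((h1.cos.sub_const 1).smul
    (planeProj i j).hasFDerivAt)).add (h1.sin.smul (planeTurn i j).hasFDerivAt)
  replace h2 := h2.congr_of_eventuallyEq (Filter.Eventually.of_forall fun y => congrFun e1 y)
  have e2 : ∀ v : V d, fderiv ℝ (twist i j θ) x v = rot i j (θ x)
      (v + fderiv ℝ θ x v • planeTurn i j x) := by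
    intro v
    rw [h2.fderiv, map_add, map_smul, rot_apply, rot_apply]
    have e3 : planeProj i j (planeTurn i j x) = planeTurn i j x := by
      simp [planeProj_apply, planeTurn_apply, ev_same, ev_ne hij, ev_ne hij.symm]
      module
    have e4 : planeTurn i j (planeTurn i j x) = - planeProj i j x := by
      simp [planeProj_apply, planeTurn_apply, ev_same, ev_ne hij, ev_ne hij.symm]
      module
    rw [e3, e4]
    simp
    module
  have e3 : ((fderiv ℝ (twist i j θ) x : V d →L[ℝ] V d) : V d →ₗ[ℝ] V d) =
      ((rot i j (θ x) : V d →L[ℝ] V d) : V d →ₗ[ℝ] V d) ∘ₗ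
        LinearMap.transvection (fderiv ℝ θ x : V d →ₗ[ℝ] ℝ) (planeTurn i j x) := by
    ext1 v
    simp [LinearMap.transvection.apply, e2]
  rw [ContinuousLinearMap.det, e3, LinearMap.det_comp, LinearMap.transvection.det,
    ← ContinuousLinearMap.det, det_rot hij]
  simp [h]

/-- A compactly supported volume-preserving diffeomorphism that rotates the ball of radius `r`
about `m` and is the identity outside the ball of radius `R`. -/
theorem exists_rotation {i j : Fin d} (hij : i ≠ j) (φ : ℝ) (m : V d) {r R : ℝ} (hr : 0 ≤ r)
    (hrR : r < R) : ∃ Φ, IsCompSuppVolDiffeo d Φ ∧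
      (∀ x, ‖x - m‖ ≤ r → Φ x = m + rot i j φ (x - m)) ∧ ∀ x, R ≤ ‖x - m‖ → Φ x = x := by
  have hpos : 0 < R ^ 2 - r ^ 2 := by nlinarith
  let ψ : ℝ → ℝ := fun t => φ * Real.smoothTransition ((R ^ 2 - t) / (R ^ 2 - r ^ 2))
  have hψ : ContDiff ℝ (⊤ : ℕ∞) ψ := contDiff_const.mul
    (smoothTransition_smooth.comp ((contDiff_const.sub contDiff_id).div_const _))
  let θ : V d → ℝ := fun x => ψ (‖x‖ ^ 2)
  have hθ : ContDiff ℝ (⊤ : ℕ∞) θ := hψ.comp (contDiff_norm_sq ℝ)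
  have θn : ∀ x y : V d, ‖x‖ = ‖y‖ → θ x = θ y := fun x y h => by simp only [θ, h]
  have θd : ∀ x, fderiv ℝ θ x (planeTurn i j x) = 0 := fun x => by
    have h1 : HasFDerivAt (fun x : V d => ‖x‖ ^ 2) (2 • innerSL ℝ x) x :=
      (hasStrictFDerivAt_norm_sq x).hasFDerivAt
    have h2 : HasFDerivAt θ (deriv ψ (‖x‖ ^ 2) • (2 • innerSL ℝ x)) x :=
      (diff_of_smooth hψ _).hasDerivAt.comp_hasFDerivAt x h1
    rw [h2.fderiv]
    simp [inner_planeTurn]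
  have θ1 : ∀ x, ‖x‖ ≤ r → θ x = φ := fun x hx => by
    have : 1 ≤ (R ^ 2 - ‖x‖ ^ 2) / (R ^ 2 - r ^ 2) := by
      rw [le_div_iff₀ hpos]; nlinarith [norm_nonneg x]
    simp [θ, ψ, Real.smoothTransition.one_of_one_le this]
  have θ0 : ∀ x, R ≤ ‖x‖ → θ x = 0 := fun x hx => by
    have : (R ^ 2 - ‖x‖ ^ 2) / (R ^ 2 - r ^ 2) ≤ 0 :=
      div_nonpos_of_nonpos_of_nonneg (by nlinarith) hpos.le
    simp [θ, ψ, Real.smoothTransition.zero_of_nonpos this]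
  have bij : Function.Bijective (twist i j θ) := by
    refine Function.bijective_iff_has_inverse.2 ⟨twist i j fun x => - θ x, twist_twist hij θn, ?_⟩
    have := twist_twist hij (θ := fun x => - θ x) fun x y h => by rw [θn x y h]
    simp only [neg_neg] at this
    exact this
  have fix : ∀ x, R ≤ ‖x‖ → twist i j θ x = x := fun x hx => by
    rw [twist, θ0 x hx, rot_zero]
  obtain ⟨Φ, hΦ, h1⟩ := exists_diffeo_of_pair (P := id) contDiff_id (twist_smooth hθ i j)
    Function.bijective_id bij (fun x => by simp [ContinuousLinearMap.det]) (fun x => by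
      rw [det_twist hij (diff_of_smooth hθ x) (θd x)]
      simp [ContinuousLinearMap.det])
    (isCompact_closedBall 0 R) fun x hx => ⟨rfl, fix x (by simpa using le_of_lt (by simpa using hx))⟩
  refine ⟨_, diffeo_conj hΦ (-m) (ContinuousLinearEquiv.refl ℝ _), fun x hx => ?_, fun x hx => ?_⟩
  · have e := h1 (x - m)
    rw [id, twist, θ1 _ hx] at e
    simp only [conj, ContinuousLinearEquiv.refl_symm, ContinuousLinearEquiv.coe_refl', id]
    rw [show -m + x = x - m by abel, e]; abel
  · have e := h1 (x - m)
    rw [id, fix _ hx] at e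
    simp only [conj, ContinuousLinearEquiv.refl_symm, ContinuousLinearEquiv.coe_refl', id]
    rw [show -m + x = x - m by abel, e]; abel

theorem pd_congr {f g : V d → ℝ} {i : Fin d} {R : ℝ} (h : ∀ y, ‖y‖ < R → f y = g y) {y : V d}
    (hy : ‖y‖ < R) : pd i f y = pd i g y := by
  have e : f =ᶠ[nhds y] g := by
    filter_upwards [Metric.isOpen_ball.mem_nhds (show y ∈ Metric.ball (0 : V d) R by simpa using hy)]
      with z hz
    exact h z (by simpa using hz)
  rw [pd, pd, e.fderiv_eq]

theorem pd_comp_smul {f : V d → ℝ} (hf : Differentiable ℝ f) (i : Fin d) (s : ℝ) (y : V d) :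
    pd i (fun y => f (s • y)) y = s * pd i f (s • y) := by
  have h := (hf (s • y)).hasFDerivAt.comp y ((hasFDerivAt_id (𝕜 := ℝ) y).const_smul s)
  rw [pd, show (fun y => f (s • y)) = f ∘ fun y => s • id y from rfl]
  erw [h.fderiv]
  simp [pd]

/-- Cutoff functions of large balls with small derivatives. -/
theorem exists_wide_cutoff (i j : Fin d) {R δ : ℝ} (hR : 0 < R) (hδ : 0 < δ) :
    ∃ χ : V d → ℝ, ContDiff ℝ (⊤ : ℕ∞) χ ∧ HasCompactSupport χ ∧ (∀ y, ‖y‖ < R → χ y = 1) ∧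
      (∀ y, |pd i χ y| ≤ δ) ∧ ∀ y, |pd j (pd i χ) y| ≤ δ := by
  let χ : ContDiffBump (0 : V d) := ⟨1, 2, by norm_num, by norm_num⟩
  have hχ : ContDiff ℝ (⊤ : ℕ∞) χ := χ.contDiff
  have hs := χ.hasCompactSupport
  obtain ⟨C, hC1, hC⟩ := exists_bound (contDiff_pd hχ i).continuous (hasCompactSupport_pd hs i)
  obtain ⟨C', hC1', hC'⟩ := exists_bound (contDiff_pd (contDiff_pd hχ i) j).continuous
    (hasCompactSupport_pd (hasCompactSupport_pd hs i) j)
  obtain ⟨s, hs0, hsR, hs1, hsC, hsC'⟩ : ∃ s : ℝ, 0 < s ∧ s * R ≤ 1 ∧ s ≤ 1 ∧ s * C ≤ δ ∧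
      s * C' ≤ δ := by
    have c0 : 0 < C := by linarith
    have c0' : 0 < C' := by linarith
    refine ⟨min (1 / R) (min 1 (min (δ / C) (δ / C'))), by positivity, ?_, ?_, ?_, ?_⟩
    · rw [← le_div_iff₀ hR]; exact min_le_left _ _
    · exact (min_le_right _ _).trans (min_le_left _ _)
    · rw [← le_div_iff₀ c0]; simp
    · rw [← le_div_iff₀ c0']; simp
  have h1 : ∀ y, pd i (fun y => χ (s • y)) y = s * pd i χ (s • y) :=
    pd_comp_smul (diff_of_smooth hχ) i s
  have hg : ContDiff ℝ (⊤ : ℕ∞) (pd i χ) := contDiff_pd hχ i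
  refine ⟨fun y => χ (s • y), hχ.comp (contDiff_const_smul s),
    hs.comp_homeomorph (Homeomorph.smulOfNeZero s hs0.ne'), fun y hy => ?_, fun y => ?_, fun y => ?_⟩
  · refine χ.one_of_mem_closedBall ?_
    simp only [Metric.mem_closedBall, dist_zero_right, norm_smul, Real.norm_eq_abs, abs_of_pos hs0]
    exact le_trans (by gcongr) hsR
  · rw [h1, abs_mul, abs_of_pos hs0]
    exact le_trans (by gcongr; exact hC _) hsC
  · rw [show pd i (fun y => χ (s • y)) = fun y => s * pd i χ (s • y) from funext h1,
      pd_const_mul (f := fun y => pd i χ (s • y))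
        (diff_of_smooth (hg.comp (contDiff_const_smul s))), pd_comp_smul (diff_of_smooth hg),
      abs_mul, abs_mul, abs_of_pos hs0]
    have h2 : s * |pd j (pd i χ) (s • y)| ≤ s * C' := by gcongr; exact hC' _
    have h3 : 0 ≤ s * |pd j (pd i χ) (s • y)| := by positivity
    nlinarith

/-- A coordinate function, composed with a suitable diffeomorphism, behaves like a
steep function of another coordinate in a family of slabs. -/
theorem exists_zigzag {i j : Fin d} (hij : i ≠ j) : ∃ R : ℝ, 0 < R ∧ ∀ u : V d → ℝ,
    (∀ x, ‖x‖ ≤ R → u x = x i) → ∃ a₀ : ℝ, 0 < a₀ ∧ ∀ a, 0 < a → a ≤ a₀ → ∀ τ, ∃ Φ,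
      IsCompSuppVolDiffeo d Φ ∧ ZoneAffine j a τ (fun x => 1 / 1000 * u (Φ x) + 0) := by
  obtain ⟨W, hW, hW1, hW2⟩ := exists_zig_bound
  obtain ⟨χ, hχ, hs, χ1, χ2, χ3⟩ := exists_wide_cutoff (d := d) i j (R := 22)
    (δ := 1 / (4000 * W)) (by norm_num) (by positivity)
  refine ⟨21 + 1000 * W, by positivity, fun u hu => ?_⟩
  have hq : ContDiff ℝ (⊤ : ℕ∞) (fun y : V d => y i * y i / 2 * χ y) := by
    have := contDiff_coord i
    exact ((this.mul this).div_const 2).mul hχ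
  obtain ⟨C, hC1, hC⟩ := exists_bound (contDiff_pd (contDiff_pd hq i) j).continuous
    (hasCompactSupport_pd (hasCompactSupport_pd hs.mul_left i) j)
  refine ⟨1 / C, by positivity, fun a ha haC τ => ?_⟩
  have aC : a * C ≤ 1 := by rwa [le_div_iff₀ (by positivity)] at haC
  have a1 : a ≤ 1 := le_trans (by nlinarith) aC
  have hχ' : ContDiff ℝ (⊤ : ℕ∞) (fun y => 1000 * a * χ y) := contDiff_const.mul hχ
  have e1 : pd i (fun x : V d => zig (x j / a - τ) * (1000 * a * χ x)) =
      fun x => zig (x j / a - τ) * (1000 * a * pd i χ x) := by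
    ext x
    rw [pd_part_mul_ne zig_smooth hχ' hij, pd_const_mul (diff_of_smooth hχ)]
  have hχi := contDiff_pd hχ i
  obtain ⟨Φ₁, hΦ₁, h1⟩ := exists_diffeo_of_generating (i := i) (j := j)
    (part_mul_smooth zig_smooth hχ' j a τ) (hs.mul_left.mul_left) fun x => by
      rw [e1, pd_part_mul zig_smooth (contDiff_const.mul hχi), pd_const_mul (diff_of_smooth hχi)]
      have b1 := hW1 (x j / a - τ)
      have b2 := hW2 (x j / a - τ)
      have b3 := mul_le_mul b1 (χ3 x) (abs_nonneg _) (by linarith)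
      have b4 := mul_le_mul b2 (χ2 x) (abs_nonneg _) (by linarith)
      rw [← abs_mul, show W * (1 / (4000 * W)) = 1 / 4000 by field_simp] at b3 b4
      have e : zig (x j / a - τ) * (1000 * a * pd j (pd i χ) x) +
          deriv zig (x j / a - τ) / a * (1000 * a * pd i χ x) =
          1000 * a * (zig (x j / a - τ) * pd j (pd i χ) x) +
          1000 * (deriv zig (x j / a - τ) * pd i χ x) := by field_simp
      rw [e]
      rw [abs_le] at b3 b4 ⊢
      constructor <;> nlinarith
  have hs' : HasCompactSupport fun y : V d => y i * y i / 2 * χ y := hs.mul_left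
  have e2 : pd i (fun y : V d => a / 1000 * (y i * y i / 2 * χ y)) =
      fun y => a / 1000 * pd i (fun y : V d => y i * y i / 2 * χ y) y :=
    funext fun y => pd_const_mul (diff_of_smooth hq) _ _ _
  obtain ⟨Φ₂, hΦ₂, h2⟩ := exists_diffeo_of_generating (i := i) (j := j)
    (K := fun y : V d => a / 1000 * (y i * y i / 2 * χ y)) (contDiff_const.mul hq) hs'.mul_left
    fun x => by
      rw [e2, pd_const_mul (diff_of_smooth (contDiff_pd hq i)), abs_mul, abs_of_pos (by positivity)]
      have := hC x
      nlinarith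
  have key1 : ∀ y, ‖y‖ < 22 → Φ₁ y = shear i (fun y => 1000 * deriv zig (y j / a - τ)) y := by
    intro y hy
    have f1 : pd i (fun x : V d => zig (x j / a - τ) * (1000 * a * χ x)) y = 0 := by
      rw [e1]
      have : pd i χ y = 0 := (pd_congr χ1 hy).trans (by simp [pd])
      simp only [this, mul_zero]
    have f2 := h1 y
    rw [shear_of_zero f1] at f2
    rw [f2, shear, shear, pd_part_mul zig_smooth hχ', χ1 y hy, pd_const_mul (diff_of_smooth hχ)]
    have : pd j χ y = 0 := (pd_congr χ1 hy).trans (by simp [pd])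
    simp only [this]
    congr 2
    field_simp
    ring
  have key2 : ∀ x, ‖x‖ ≤ 20 → ∃ y, ‖y‖ ≤ 21 ∧ Φ₂ x = y ∧ y i = x i ∧
      y j = x j - a / 1000 * x i := by
    intro x hx
    have hxi := abs_coord_le hx i
    obtain ⟨y, hy⟩ : ∃ y, y = shear j (fun _ => - (a / 1000 * x i)) x := ⟨_, rfl⟩
    have hyi : y i = x i := by rw [hy, shear_ne hij]
    have hn : ‖y‖ ≤ 21 := by
      rw [hy, shear]
      refine (norm_add_le _ _).trans ?_
      rw [norm_smul, norm_ev, Real.norm_eq_abs, abs_neg, abs_mul, abs_of_pos (by positivity)]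
      nlinarith
    have hK : ∀ y : V d, ‖y‖ < 22 → a / 1000 * (y i * y i / 2 * χ y) = a / 1000 * (y i * y i / 2) :=
      fun y hy => by rw [χ1 y hy, mul_one]
    have hsm : Differentiable ℝ fun t : ℝ => a / 1000 * (t * t / 2) := by fun_prop
    have f1 := pd_congr (i := i) hK (y := y) (by linarith)
    have f2 := pd_congr (i := j) hK (y := y) (by linarith)
    rw [pd_coord_same (φ := fun t => a / 1000 * (t * t / 2)) hsm] at f1
    rw [pd_coord_ne (φ := fun t => a / 1000 * (t * t / 2)) hsm hij] at f2
    have f3 : deriv (fun t => a / 1000 * (t * t / 2)) (y i) = a / 1000 * y i := by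
      have h := (((hasDerivAt_id (y i)).mul (hasDerivAt_id (y i))).div_const 2).const_mul (a / 1000)
      refine h.deriv.trans ?_
      simp
    have f4 := h2 y
    rw [shear_of_zero f2, shear, f1, f3, hyi] at f4
    refine ⟨y, hn, ?_, hyi, ?_⟩
    · rw [← f4]
      congr 1
      rw [hy, shear]
      module
    · rw [hy, shear_same]; ring
  have key : ∀ x, ‖x‖ ≤ 20 → 1 / 1000 * u (Φ₁ (Φ₂ x)) + 0 =
      x i / 1000 + deriv zig (x j / a - τ - x i / 1000) := by
    intro x hx
    obtain ⟨y, hy, h3, h4, h5⟩ := key2 x hx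
    rw [h3, key1 y (by linarith), hu, shear_same, h4, h5]
    · have : (x j - a / 1000 * x i) / a - τ = x j / a - τ - x i / 1000 := by field_simp; ring
      rw [this]; ring
    · rw [shear]
      refine (norm_add_le _ _).trans ?_
      rw [norm_smul, norm_ev, Real.norm_eq_abs, abs_mul, abs_of_pos (by norm_num), mul_one]
      have := hW2 (y j / a - τ)
      linarith
  refine ⟨_, diffeo_comp hΦ₁ hΦ₂, fun x y hx hy cx cy hxy => ?_⟩
  simp only [Function.comp_apply]
  rw [key x hx, key y hy]
  have bx := abs_le.1 (abs_coord_le hx i)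
  have byy := abs_le.1 (abs_coord_le hy i)
  have cos' : ∀ s t : ℝ, 0.3 ≤ Real.cos s → |t| ≤ 0.02 → 0.25 ≤ Real.cos (s - t) := by
    intro s t h1 h2
    have h3 := Real.abs_cos_sub_cos_le s (s - t)
    rw [sub_sub_cancel] at h3
    have := (abs_le.1 (h3.trans h2)).2
    linarith
  have hdiv : |(x j - y j) / a| ≤ 1 := by
    rw [abs_div, abs_of_pos ha, div_le_one ha]; exact hxy
  have hdiv' := abs_le.1 hdiv
  have := deriv_zig_sub (cos' _ (x i / 1000) cx (by rw [abs_le]; constructor <;> linarith))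
    (cos' _ (y i / 1000) cy (by rw [abs_le]; constructor <;> linarith)) (by
      rw [show x j / a - τ - x i / 1000 - (y j / a - τ - y i / 1000) =
        (x j - y j) / a - x i / 1000 + y i / 1000 by ring, abs_le]
      constructor <;> linarith)
  linear_combination this

theorem norm_le_of_coord {x : V d} {r : ℝ} (hr : 0 ≤ r) (h : ∀ k, |x k| ≤ r) : ‖x‖ ≤ d * r := by
  have h1 : ‖x‖ ^ 2 ≤ d * r ^ 2 := by
    rw [EuclideanSpace.norm_sq_eq]
    refine (Finset.sum_le_card_nsmul _ _ (r ^ 2) fun k _ => ?_).trans (by simp)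
    rw [Real.norm_eq_abs]
    exact pow_le_pow_left₀ (abs_nonneg _) (h k) 2
  have h2 : (d : ℝ) * r ^ 2 ≤ (d * r) ^ 2 := by
    have h3 : (d : ℝ) ≤ d * d := by exact_mod_cast Nat.le_mul_self d
    have : 0 ≤ (d * d - d) * r ^ 2 := mul_nonneg (by linarith) (sq_nonneg r)
    linarith
  exact (abs_le_of_sq_le_sq' (h1.trans h2) (by positivity)).2

theorem integral_pd {g : V d → ℝ} (hg : ContDiff ℝ (⊤ : ℕ∞) g) (hc : HasCompactSupport g)
    (i : Fin d) : ∫ x, pd i g x = 0 := by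
  have h1 := (contDiff_pd hg i).continuous.integrable_of_hasCompactSupport (μ := volume)
    (hasCompactSupport_pd hc i)
  have h2 := hg.continuous.integrable_of_hasCompactSupport (μ := volume) hc
  have := integral_mul_fderiv_eq_neg_fderiv_mul_of_integrable (μ := (volume : Measure (V d)))
    (f := fun _ => (1 : ℝ)) (g := g) (v := ev i) (by simp) (by simp only [one_mul]; exact h1)
    (by simpa using h2) (fun x _ => differentiableAt_const _) (fun x _ => diff_of_smooth hg x)
  simpa [pd] using this

theorem integral_eq_zero_of_lineInt {g : V d → ℝ} (hg : ContDiff ℝ (⊤ : ℕ∞) g)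
    (h1 : ∀ x, g x ≠ 0 → ∀ k, |x k| ≤ 1) {i : Fin d} (h2 : ∀ x, lineInt i (-1) 1 g x = 0) :
    ∫ x, g x = 0 := by
  have hs : HasCompactSupport (prim i (-1) g) := by
    refine hasCompactSupport_of_norm (R := d * 1) fun y hy => norm_le_of_coord zero_le_one ?_
    intro k
    by_cases hk : k = i
    · subst hk
      rw [abs_le]
      constructor
      · by_contra h
        exact hy (prim_of_le (fun x hx => h1 x hx k) (not_le.1 h).le)
      · by_contra h
        exact hy ((prim_of_ge hg.continuous (fun x hx => h1 x hx k) (not_le.1 h).le).trans (h2 y))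
    · have : ∃ t : ℝ, g (y + t • ev i) ≠ 0 := by
        by_contra h
        push Not at h
        exact hy (prim_eq_zero h)
      obtain ⟨t, ht⟩ := this
      simpa [ev_ne hk] using h1 _ ht k
  have := integral_pd (prim_smooth hg i (-1)) hs i
  simpa only [pd_prim_same hg] using this

/-- Functions with vanishing integrals along a coordinate direction. -/
theorem exists_rep_of_lineInt {i j : Fin d} (hij : i ≠ j) : ∃ R C : ℝ, 0 < R ∧ 0 < C ∧
    ∀ u : V d → ℝ, (∀ x, ‖x‖ ≤ R → u x = x i) → ∀ f : V d → ℝ, ContDiff ℝ (⊤ : ℕ∞) f →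
      (∀ x, f x ≠ 0 → ‖x‖ ≤ 1) → (∀ x, lineInt i (-1) 1 f x = 0) →
      ∀ A, (∀ x, |f x| ≤ A) → Rep u (C * A) f := by
  obtain ⟨R, hR, h1⟩ := exists_zigzag hij
  obtain ⟨ε, hε, h2⟩ := exists_rep_slab hij
  refine ⟨R, 8 / 1000 / ε, hR, by positivity, fun u hu f hf f1 f2 A hA => ?_⟩
  have A0 : 0 ≤ A := (abs_nonneg _).trans (hA 0)
  rcases A0.eq_or_lt with rfl | A0
  · refine (Rep.zero u).mono (by simp) |>.congr fun x => ?_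
    exact abs_eq_zero.1 (le_antisymm (hA x) (abs_nonneg _))
  obtain ⟨a₀, ha₀, h3⟩ := h1 u hu
  have main : ∀ τ : ℝ, ∃ a₁ : ℝ, 0 < a₁ ∧ ∀ a, 0 < a → a ≤ a₁ →
      Rep u (2 / 1000 / ε * A) (fun x => part (x j / a - τ) * f x) := by
    intro τ
    obtain ⟨a₁, ha₁, h4⟩ := h2 τ (fun x => ε / A * f x) (contDiff_const.mul hf)
      (fun x hx => f1 x fun h => hx (by simp [h]))
      (fun x => by
        have := f2 x
        rw [lineInt] at this ⊢
        rw [intervalIntegral.integral_const_mul, this, mul_zero])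
      (fun x => by
        rw [abs_mul, abs_of_pos (by positivity), div_mul_eq_mul_div, div_le_iff₀ A0]
        exact mul_le_mul_of_nonneg_left (hA x) hε.le)
    refine ⟨min a₀ a₁, by positivity, fun a ha haa => ?_⟩
    obtain ⟨Φ, hΦ, hz⟩ := h3 a ha (haa.trans (min_le_left _ _)) τ
    have h5 := (h4 a ha (haa.trans (min_le_right _ _)) _ hz).affine.of_comp hΦ
    refine ((h5.smul (A / ε)).mono (le_of_eq ?_)).congr fun x => ?_
    · rw [abs_of_pos (by positivity), abs_of_pos (by positivity)]; field_simp
    · field_simp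
  obtain ⟨a₁, p1, q1⟩ := main 0
  obtain ⟨a₂, p2, q2⟩ := main (Real.pi / 2)
  obtain ⟨a₃, p3, q3⟩ := main Real.pi
  obtain ⟨a₄, p4, q4⟩ := main (-(Real.pi / 2))
  obtain ⟨a, ha, l1, l2, l3, l4⟩ : ∃ a : ℝ, 0 < a ∧ a ≤ a₁ ∧ a ≤ a₂ ∧ a ≤ a₃ ∧ a ≤ a₄ :=
    ⟨min (min a₁ a₂) (min a₃ a₄), by positivity, by simp, by simp, by simp, by simp⟩
  refine ((((q1 a ha l1).add (q2 a ha l2)).add (q3 a ha l3)).add (q4 a ha l4)).mono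
    (le_of_eq (by ring)) |>.congr fun x => ?_
  have := part_sum (x j / a)
  rw [← add_mul, ← add_mul, ← add_mul, sub_neg_eq_add, sub_zero, this, one_mul]

theorem exists_rep_of_lineInt_rotate (i₀ : Fin d) {i j : Fin d} (hij : i ≠ j) :
    ∃ R C : ℝ, 0 < R ∧ 0 < C ∧ ∀ u : V d → ℝ, (∀ x, ‖x‖ ≤ R → u x = x i₀) →
      ∀ f : V d → ℝ, ContDiff ℝ (⊤ : ℕ∞) f →
      (∀ x, f x ≠ 0 → ‖x‖ ≤ 1) → (∀ x, lineInt i (-1) 1 f x = 0) →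
      ∀ A, (∀ x, |f x| ≤ A) → Rep u (C * A) f := by
  by_cases h : i₀ = i
  · subst h
    exact exists_rep_of_lineInt hij
  obtain ⟨R, C, hR, hC, h1⟩ := exists_rep_of_lineInt hij
  refine ⟨R, C, hR, hC, fun u hu f hf f1 f2 A hA => ?_⟩
  obtain ⟨Φ, hΦ, h2, -⟩ := exists_rotation h (-(Real.pi / 2)) 0 hR.le (lt_add_one R)
  refine (h1 (fun x => u (Φ x)) (fun x hx => ?_) f hf f1 f2 A hA).of_comp hΦ
  have h3 := h2 x (by simpa using hx)
  simp only [sub_zero, zero_add] at h3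
  rw [h3, hu _ (by rwa [norm_rot h]), rot_fst h]
  simp

theorem exists_bump {r : ℝ} (hr : 0 < r) (hr1 : r < 1) : ∃ b : ℝ → ℝ, ContDiff ℝ (⊤ : ℕ∞) b ∧
    (∀ t, 0 ≤ b t) ∧ (∀ t, b t ≠ 0 → |t| ≤ r) ∧ (∫ t in (-1)..1, b t) = 1 := by
  let χ : ContDiffBump (0 : ℝ) := ⟨r / 2, r, by linarith, by linarith⟩
  have hs : Function.support (χ.normed volume) = Metric.ball 0 r := χ.support_normed_eq
  refine ⟨χ.normed volume, χ.contDiff_normed, χ.nonneg_normed, fun t ht => ?_, ?_⟩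
  · have : t ∈ Metric.ball (0 : ℝ) r := hs ▸ ht
    simpa using le_of_lt (by simpa using this)
  · rw [intervalIntegral.integral_eq_integral_of_support_subset, χ.integral_normed]
    rw [hs]
    intro t ht
    have := abs_lt.1 (by simpa using ht : |t| < r)
    exact ⟨by linarith, by linarith⟩

/-- Redistribution of `f` along the lines in direction `i`. -/
noncomputable def avg (i : Fin d) (b : ℝ → ℝ) (f : V d → ℝ) (x : V d) : ℝ :=
  b (x i) * lineInt i (-1) 1 f x

theorem avg_smooth {b : ℝ → ℝ} (hb : ContDiff ℝ (⊤ : ℕ∞) b) {f : V d → ℝ}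
    (hf : ContDiff ℝ (⊤ : ℕ∞) f) (i : Fin d) : ContDiff ℝ (⊤ : ℕ∞) (avg i b f) :=
  (hb.comp (contDiff_coord i)).mul (lineInt_smooth hf i _ _)

theorem avg_support {r : ℝ} {b : ℝ → ℝ} (hb : ∀ t, b t ≠ 0 → |t| ≤ r) {f : V d → ℝ}
    (hf : ∀ x, f x ≠ 0 → ∀ k, |x k| ≤ r) {i : Fin d} {x : V d} (hx : avg i b f x ≠ 0) (k : Fin d) :
    |x k| ≤ r := by
  by_cases hk : k = i
  · subst hk
    exact hb _ (left_ne_zero_of_mul hx)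
  · have : ∃ t : ℝ, f (x + t • ev i) ≠ 0 := by
      by_contra h
      push Not at h
      exact right_ne_zero_of_mul hx (lineInt_eq_zero h)
    obtain ⟨t, ht⟩ := this
    simpa [ev_ne hk] using hf _ ht k

theorem lineInt_avg {b : ℝ → ℝ} (hb : (∫ t in (-1)..1, b t) = 1) (i : Fin d) (f : V d → ℝ)
    (x : V d) : lineInt i (-1) 1 (avg i b f) x = lineInt i (-1) 1 f x := by
  rw [lineInt]
  have : ∀ t : ℝ, avg i b f (x + (t - x i) • ev i) = b t * lineInt i (-1) 1 f x := fun t => by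
    rw [avg, lineInt_add_same]; simp
  simp only [this]
  rw [intervalIntegral.integral_mul_const, hb, one_mul]

theorem lineInt_sub {f g : V d → ℝ} (hf : Continuous f) (hg : Continuous g) (i : Fin d) (a b : ℝ)
    (x : V d) : lineInt i a b (fun y => f y - g y) x = lineInt i a b f x - lineInt i a b g x := by
  refine intervalIntegral.integral_sub ?_ ?_ <;>
  · refine Continuous.intervalIntegrable ?_ _ _
    fun_prop

/-- Successive averaging over a set of coordinates: the result depends on these coordinates through
a fixed bump function. -/
theorem exists_averaged (i₀ : Fin d) (hd : 2 ≤ d) {r : ℝ} (hr : 0 < r) (hdr : d * r ≤ 1)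
    {b : ℝ → ℝ} (hb : ContDiff ℝ (⊤ : ℕ∞) b) (hbr : ∀ t, b t ≠ 0 → |t| ≤ r)
    (hb1 : (∫ t in (-1)..1, b t) = 1) {B : ℝ} (hB : 0 ≤ B) (hbB : ∀ t, |b t| ≤ B)
    (s : Finset (Fin d)) :
    ∃ R C D : ℝ, 0 < R ∧ 0 < C ∧ 0 < D ∧ ∀ u : V d → ℝ, (∀ x, ‖x‖ ≤ R → u x = x i₀) →
      ∀ f : V d → ℝ, ContDiff ℝ (⊤ : ℕ∞) f → (∀ x, f x ≠ 0 → ∀ k, |x k| ≤ r) →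
      ∀ A, (∀ x, |f x| ≤ A) → ∃ g : V d → ℝ, ContDiff ℝ (⊤ : ℕ∞) g ∧
        (∀ x, g x ≠ 0 → ∀ k, |x k| ≤ r) ∧ (∀ x, |g x| ≤ D * A) ∧ (∫ x, g x) = ∫ x, f x ∧
        (∀ x y : V d, (∀ k ∉ s, x k = y k) → g x * ∏ k ∈ s, b (y k) = g y * ∏ k ∈ s, b (x k)) ∧
        Rep u (C * A) (fun x => f x - g x) := by
  induction s using Finset.induction_on with
  | empty =>
    refine ⟨1, 1, 1, one_pos, one_pos, one_pos, fun u hu f hf f1 A hA => ⟨f, hf, f1, by simpa, rfl,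
      fun x y h => ?_, ?_⟩⟩
    · rw [show x = y from PiLp.ext fun k => h k (by simp)]
    · refine ((Rep.zero u).mono ?_).congr fun x => by simp
      simpa using (abs_nonneg _).trans (hA 0)
  | insert i s hi ih =>
    obtain ⟨R, C, D, hR, hC, hD, h1⟩ := ih
    obtain ⟨j, hij⟩ : ∃ j : Fin d, i ≠ j := by
      have : Nontrivial (Fin d) := Fin.nontrivial_iff_two_le.2 hd
      obtain ⟨j, hj⟩ := exists_ne i
      exact ⟨j, hj.symm⟩
    obtain ⟨R', C', hR', hC', h2⟩ := exists_rep_of_lineInt_rotate i₀ hij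
    refine ⟨max R R', C + C' * (D + B * D * 2), D + B * D * 2, by positivity, by positivity,
      by positivity, fun u hu f hf f1 A hA => ?_⟩
    have A0 : 0 ≤ A := (abs_nonneg _).trans (hA 0)
    obtain ⟨g, hg, g1, g2, g3, g4, g5⟩ := h1 u (fun x hx => hu x (hx.trans (le_max_left _ _)))
      f hf f1 A hA
    have hr1 : r ≤ 1 := by
      have : (1 : ℝ) ≤ d := by exact_mod_cast (by omega : 1 ≤ d)
      nlinarith
    have ha := avg_smooth hb hg i
    have ha1 : ∀ x, |avg i b g x| ≤ B * D * 2 * A := fun x => by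
      have := abs_lineInt_le g2 i (a := -1) (b := 1) (by norm_num) x
      rw [avg, abs_mul]
      calc _ ≤ B * (D * A * (1 - -1)) := by gcongr; exact hbB _
        _ = _ := by ring
    have hsub : ∀ x, g x - avg i b g x ≠ 0 → ∀ k, |x k| ≤ r := fun x hx k => by
      by_cases h : g x = 0
      · refine avg_support hbr g1 (i := i) (fun h' => hx ?_) k
        rw [h, h', sub_zero]
      · exact g1 x h k
    have hline : ∀ x, lineInt i (-1) 1 (fun x => g x - avg i b g x) x = 0 := fun x => by
      rw [lineInt_sub hg.continuous ha.continuous, lineInt_avg hb1, sub_self]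
    have supp : ∀ {h : V d → ℝ}, (∀ x, h x ≠ 0 → ∀ k, |x k| ≤ r) → ∀ x, h x ≠ 0 → ‖x‖ ≤ 1 :=
      fun h x hx => (norm_le_of_coord hr.le (h x hx)).trans hdr
    refine ⟨avg i b g, ha, fun x hx => avg_support hbr g1 hx, fun x => (ha1 x).trans ?_, ?_,
      fun x y hxy => ?_, ?_⟩
    · gcongr; linarith
    · rw [← g3]
      have h3 := integral_eq_zero_of_lineInt (hg.sub ha) (fun x hx k => (hsub x hx k).trans hr1) hline
      rw [integral_sub] at h3
      · linarith
      · exact hg.continuous.integrable_of_hasCompactSupport (hasCompactSupport_of_norm (supp g1))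
      · exact ha.continuous.integrable_of_hasCompactSupport
          (hasCompactSupport_of_norm (supp fun x hx => avg_support hbr g1 hx))
    · rw [Finset.prod_insert hi, Finset.prod_insert hi, avg, avg, lineInt, lineInt]
      have h3 : ∀ t : ℝ, g (x + (t - x i) • ev i) * ∏ k ∈ s, b (y k) =
          g (y + (t - y i) • ev i) * ∏ k ∈ s, b (x k) := by
        intro t
        have h4 := g4 (x + (t - x i) • ev i) (y + (t - y i) • ev i) fun k hk => by
          by_cases hki : k = i
          · subst hki; simp
          · simpa [ev_ne hki] using hxy k (by simp [hk, hki])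
        have h5 : ∀ (z : V d) (c : ℝ), ∏ k ∈ s, b ((z + c • ev i) k) = ∏ k ∈ s, b (z k) :=
          fun z c => Finset.prod_congr rfl fun k hk => by
            have : k ≠ i := fun h => hi (h ▸ hk)
            simp [ev_ne this]
        rwa [h5, h5] at h4
      have h6 : (∫ t in (-1)..1, g (x + (t - x i) • ev i)) * ∏ k ∈ s, b (y k) =
          (∫ t in (-1)..1, g (y + (t - y i) • ev i)) * ∏ k ∈ s, b (x k) := by
        rw [← intervalIntegral.integral_mul_const, ← intervalIntegral.integral_mul_const]
        simp only [h3]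
      linear_combination b (x i) * b (y i) * h6
    · have h3 := h2 u (fun x hx => hu x (hx.trans (le_max_right _ _))) _ (hg.sub ha) (supp hsub) hline
        ((D + B * D * 2) * A) fun x => by
          have := abs_sub (g x) (avg i b g x)
          linarith [g2 x, ha1 x]
      refine ((g5.add h3).mono (le_of_eq (by ring))).congr fun x => by ring

/-- Flexibility at a fixed scale: mean-zero functions supported in a small box. -/
theorem exists_rep_box (i₀ : Fin d) (hd : 2 ≤ d) {r : ℝ} (hr : 0 < r) (hdr : d * r ≤ 1) :
    ∃ R C : ℝ, 0 < R ∧ 0 < C ∧ ∀ u : V d → ℝ, (∀ x, ‖x‖ ≤ R → u x = x i₀) →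
      ∀ f : V d → ℝ, ContDiff ℝ (⊤ : ℕ∞) f → (∀ x, f x ≠ 0 → ∀ k, |x k| ≤ r) →
      (∫ x, f x) = 0 → ∀ A, (∀ x, |f x| ≤ A) → Rep u (C * A) f := by
  have hr1 : r < 1 := by
    have : (2 : ℝ) ≤ d := by exact_mod_cast hd
    nlinarith
  obtain ⟨b, hb, b0, hbr, hb1⟩ := exists_bump hr hr1
  obtain ⟨B, hB⟩ := (hasCompactSupport_of_norm (f := fun x : V 1 => b (x 0)) (R := 1 * r)
    fun x hx => by
      have := norm_le_of_coord (x := x) hr.le fun k => by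
        rw [Subsingleton.elim k 0]; exact hbr _ hx
      simpa using this).exists_bound_of_continuous (hb.comp (contDiff_coord 0)).continuous
  have hbB : ∀ t, |b t| ≤ B := fun t => by
    simpa using hB (t • ev 0)
  have B0 : 0 ≤ B := (abs_nonneg _).trans (hbB 0)
  obtain ⟨R, C, D, hR, hC, hD, h1⟩ := exists_averaged i₀ hd hr hdr hb hbr hb1 B0 hbB Finset.univ
  refine ⟨R, C, hR, hC, fun u hu f hf f1 f2 A hA => ?_⟩
  obtain ⟨g, hg, g1, g2, g3, g4, g5⟩ := h1 u hu f hf f1 A hA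
  refine g5.congr fun x => ?_
  have hc : Continuous fun y : V d => ∏ k, b (y k) := by
    have := hb.continuous
    fun_prop
  have hs : HasCompactSupport fun y : V d => ∏ k, b (y k) :=
    hasCompactSupport_of_norm (R := 1) fun y hy => (norm_le_of_coord hr.le fun k =>
      hbr _ (Finset.prod_ne_zero_iff.1 hy k (Finset.mem_univ k))).trans hdr
  have hpos : 0 < ∫ y : V d, ∏ k, b (y k) := by
    obtain ⟨t, ht⟩ : ∃ t, b t ≠ 0 := by
      by_contra h
      push Not at h
      simp [h] at hb1
    refine hc.integral_pos_of_hasCompactSupport_nonneg_nonzero hs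
      (fun y => Finset.prod_nonneg fun k _ => b0 _) (x := WithLp.toLp 2 fun _ => t) ?_
    exact Finset.prod_ne_zero_iff.2 fun _ _ => ht
  have key : g x * ∫ y : V d, ∏ k, b (y k) = 0 := by
    rw [← integral_const_mul]
    simp only [fun y => g4 x y (by simp)]
    rw [integral_mul_const, g3, f2, zero_mul]
  rw [(mul_eq_zero.1 key).resolve_right hpos.ne', sub_zero]

/-- The points of the lattice of mesh `ε` based at `s`. -/
noncomputable def ctr (ε : ℝ) (s : V d) (j : Fin d → ℤ) : V d :=
  s + ε • WithLp.toLp 2 fun k => (j k : ℝ)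

theorem ctr_apply (ε : ℝ) (s : V d) (j : Fin d → ℤ) (k : Fin d) : ctr ε s j k = s k + ε * j k := by
  simp [ctr]

theorem ctr_update (ε : ℝ) (s : V d) (j : Fin d → ℤ) (k : Fin d) :
    ctr ε s (Function.update j k (j k + 1)) = ctr ε s j + ε • ev k := by
  ext l
  by_cases h : l = k
  · subst h; simp [ctr_apply]; ring
  · simp [ctr_apply, h, ev_ne h]

theorem le_norm_ctr_sub {ε : ℝ} (hε : 0 < ε) (s : V d) {i j : Fin d → ℤ} (hij : i ≠ j) :
    ε ≤ ‖ctr ε s i - ctr ε s j‖ := by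
  obtain ⟨k, hk⟩ := Function.ne_iff.1 hij
  refine le_trans ?_ (abs_coord_le le_rfl k)
  have h1 : (1 : ℝ) ≤ |(i k : ℝ) - j k| := by
    exact_mod_cast Int.one_le_abs (sub_ne_zero.2 hk)
  rw [PiLp.sub_apply, ctr_apply, ctr_apply, add_sub_add_left_eq_sub, ← mul_sub, abs_mul,
    abs_of_pos hε]
  nlinarith

theorem eq_of_norm_ctr_sub {ε r r' : ℝ} {s x : V d} {i j : Fin d → ℤ} (hε : 0 < ε)
    (hi : ‖x - ctr ε s i‖ ≤ r) (hj : ‖x - ctr ε s j‖ ≤ r') (h : r + r' < ε) : i = j := by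
  by_contra hij
  have h1 := le_norm_ctr_sub hε s hij
  have h2 := norm_sub_le (x - ctr ε s j) (x - ctr ε s i)
  rw [sub_sub_sub_cancel_left] at h2
  linarith

/-- A permutation of the lattice induced by a diffeomorphism. -/
def Realizable (ε : ℝ) (s : V d) (π : Equiv.Perm (Fin d → ℤ)) : Prop :=
  ∃ T, IsCompSuppVolDiffeo d T ∧
    ∀ i x, ‖x - ctr ε s i‖ ≤ ε / 4 → ‖T x - ctr ε s (π i)‖ ≤ ε / 4

theorem Realizable.mul {ε : ℝ} {s : V d} {π σ : Equiv.Perm (Fin d → ℤ)}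
    (h : Realizable ε s π) (h' : Realizable ε s σ) : Realizable ε s (π * σ) := by
  obtain ⟨T, hT, h1⟩ := h
  obtain ⟨T', hT', h2⟩ := h'
  exact ⟨_, diffeo_comp hT hT', fun i x hx => h1 _ _ (h2 _ _ hx)⟩

theorem Realizable.one (ε : ℝ) (s : V d) : Realizable ε s 1 := ⟨id, diffeo_id, fun _ _ h => h⟩

theorem realizable_swap_adjacent (hd : 2 ≤ d) {ε : ℝ} (hε : 0 < ε) (s : V d) (j : Fin d → ℤ)
    (k : Fin d) : Realizable ε s (Equiv.swap j (Function.update j k (j k + 1))) := by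
  have : Nontrivial (Fin d) := Fin.nontrivial_iff_two_le.2 hd
  obtain ⟨l, hl⟩ := exists_ne k
  set j' := Function.update j k (j k + 1) with hj'
  obtain ⟨m, hm⟩ : ∃ m, m = ctr ε s j + (ε / 2) • ev k := ⟨_, rfl⟩
  have e1 : ctr ε s j - m = -((ε / 2) • ev k) := by rw [hm]; abel
  have e2 : ctr ε s j' - m = (ε / 2) • ev k := by rw [hm, hj', ctr_update]; module
  have hrot : rot k l Real.pi (ev k : V d) = - ev k := by
    ext i
    by_cases hi : i = k
    · subst hi; rw [rot_fst hl.symm]; simp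
    · by_cases hi' : i = l
      · subst hi'; rw [rot_snd hl.symm]; simp [ev_ne hl]
      · rw [rot_other hi hi']; simp [ev_ne hi]
  obtain ⟨T, hT, h1, h2⟩ := exists_rotation hl.symm Real.pi m (r := 0.75 * ε) (R := 0.8 * ε)
    (by positivity) (by linarith)
  have en : ‖(ε / 2) • (ev k : V d)‖ = ε / 2 := by
    rw [norm_smul, norm_ev, Real.norm_eq_abs, abs_of_pos (by positivity), mul_one]
  have near : ∀ p q x : V d, ‖p - m‖ = ε / 2 → rot k l Real.pi (p - m) = q - m →
      ‖x - p‖ ≤ ε / 4 → ‖T x - q‖ ≤ ε / 4 := by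
    intro p q x hp hpq hx
    have h3 : ‖x - m‖ ≤ 0.75 * ε := by
      have := norm_add_le (x - p) (p - m)
      rw [sub_add_sub_cancel] at this
      linarith
    rw [h1 x h3, show m + rot k l Real.pi (x - m) - q = rot k l Real.pi (x - p) by
      rw [← sub_add_sub_cancel x p m, map_add, hpq]; abel, norm_rot hl.symm]
    exact hx
  refine ⟨T, hT, fun i x hx => ?_⟩
  by_cases hij : i = j
  · subst hij
    rw [Equiv.swap_apply_left]
    refine near _ _ x (by rw [e1, norm_neg, en]) ?_ hx
    rw [e1, e2, map_neg, map_smul, hrot]; module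
  by_cases hij' : i = j'
  · subst hij'
    rw [Equiv.swap_apply_right]
    refine near _ _ x (by rw [e2, en]) ?_ hx
    rw [e1, e2, map_smul, hrot]; module
  rw [Equiv.swap_apply_of_ne_of_ne hij hij']
  have far : 1.1 * ε ≤ ‖ctr ε s i - m‖ := by
    have c : ∀ n, (ctr ε s i - m) n = ε * (i n - j n) - ε / 2 * (ev k : V d) n := fun n => by
      simp [hm, ctr_apply]; ring
    by_cases h3 : ∃ n, n ≠ k ∧ i n ≠ j n
    · obtain ⟨n, hn, hin⟩ := h3
      have a1 : (1 : ℝ) ≤ ((i n : ℝ) - j n) ^ 2 := by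
        have := Int.one_le_abs (sub_ne_zero.2 hin)
        rw [← sq_abs]
        exact_mod_cast one_le_pow₀ this
      have a2 : (1 : ℝ) / 4 ≤ ((i k : ℝ) - j k - 1 / 2) ^ 2 := by
        have : (0 : ℤ) ≤ (i k - j k) * (i k - j k - 1) := by
          rcases le_or_gt (i k - j k) 0 with h | h <;> nlinarith
        have : (0 : ℝ) ≤ (i k - j k) * (i k - j k - 1) := by exact_mod_cast this
        nlinarith
      have a3 : (ctr ε s i - m) n ^ 2 + (ctr ε s i - m) k ^ 2 ≤ ‖ctr ε s i - m‖ ^ 2 := by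
        rw [EuclideanSpace.norm_sq_eq, ← Finset.sum_pair (f := fun l => (ctr ε s i - m) l ^ 2) hn]
        simp only [Real.norm_eq_abs, sq_abs]
        exact Finset.sum_le_sum_of_subset_of_nonneg (Finset.subset_univ _)
          fun _ _ _ => sq_nonneg _
      rw [c, c, ev_same, ev_ne hn] at a3
      refine le_of_sq_le_sq ?_ (norm_nonneg _)
      nlinarith [sq_pos_of_pos hε]
    · push Not at h3
      refine le_trans ?_ (abs_coord_le le_rfl k)
      have h4 : i k ≠ j k := fun h => hij (funext fun n => by
        by_cases hn : n = k
        · rw [hn, h]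
        · exact h3 n hn)
      have h5 : i k ≠ j k + 1 := fun h => hij' (funext fun n => by
        by_cases hn : n = k
        · rw [hn, hj', Function.update_self, h]
        · rw [hj', Function.update_of_ne hn, h3 n hn])
      rw [c, ev_same]
      rcases lt_or_gt_of_ne h4 with h | h
      · have : (i k : ℝ) + 1 ≤ j k := by exact_mod_cast h
        refine le_trans ?_ (neg_le_abs _)
        nlinarith
      · have : (j k : ℝ) + 2 ≤ i k := by exact_mod_cast (by omega : j k + 2 ≤ i k)
        refine le_trans ?_ (le_abs_self _)
        nlinarith
  rw [h2]
  · exact hx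
  · have := norm_sub_norm_le (ctr ε s i - m) (ctr ε s i - x)
    rw [sub_sub_sub_cancel_left, norm_sub_rev _ x] at this
    linarith

theorem realizable_swap (hd : 2 ≤ d) {ε : ℝ} (hε : 0 < ε) (s : V d) (i j : Fin d → ℤ) :
    Realizable ε s (Equiv.swap i j) := by
  have trans : ∀ {a b c : Fin d → ℤ}, Realizable ε s (Equiv.swap a b) →
      Realizable ε s (Equiv.swap b c) → Realizable ε s (Equiv.swap a c) := by
    intro a b c h1 h2
    by_cases hab : a = b
    · rwa [hab]
    by_cases hac : a = c
    · rw [hac, Equiv.swap_self]; exact Realizable.one ε s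
    rw [Equiv.swap_comm a c, ← Equiv.swap_mul_swap_mul_swap hab hac]
    exact (h2.mul h1).mul h2
  have line : ∀ (a : Fin d → ℤ) (k : Fin d) (n : ℤ),
      Realizable ε s (Equiv.swap a (Function.update a k n)) := by
    intro a k n
    induction n using Int.inductionOn' (b := a k) with
    | zero => rw [Function.update_eq_self, Equiv.swap_self]; exact Realizable.one ε s
    | succ n _ ih =>
      have := realizable_swap_adjacent hd hε s (Function.update a k n) k
      rw [Function.update_self, Function.update_idem] at this
      exact trans ih this
    | pred n _ ih =>
      have := realizable_swap_adjacent hd hε s (Function.update a k (n - 1)) k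
      rw [Function.update_self, Function.update_idem, sub_add_cancel, Equiv.swap_comm] at this
      exact trans ih this
  have all : ∀ t : Finset (Fin d), Realizable ε s (Equiv.swap i (t.piecewise j i)) := by
    intro t
    induction t using Finset.induction_on with
    | empty => rw [Finset.piecewise_empty, Equiv.swap_self]; exact Realizable.one ε s
    | insert k t hk ih =>
      rw [Finset.piecewise_insert]
      exact trans ih (line _ _ _)
  simpa using all Finset.univ

/-- Finitely many cells of the lattice can be moved to arbitrary distinct cells. -/
theorem exists_realizable (hd : 2 ≤ d) {ε : ℝ} (hε : 0 < ε) (s : V d) (S : Finset (Fin d → ℤ))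
    {e : (Fin d → ℤ) → Fin d → ℤ} (he : InjOn e S) :
    ∃ π, Realizable ε s π ∧ ∀ i ∈ S, π i = e i := by
  classical
  induction S using Finset.induction_on with
  | empty => exact ⟨1, Realizable.one ε s, by simp⟩
  | insert a S ha ih =>
    obtain ⟨π, hπ, h1⟩ := ih (he.mono (by simp))
    refine ⟨Equiv.swap (π a) (e a) * π, (realizable_swap hd hε s _ _).mul hπ, fun i hi => ?_⟩
    rw [Equiv.Perm.mul_apply]
    rcases Finset.mem_insert.1 hi with rfl | hiS
    · simp
    · have hne : i ≠ a := fun h => ha (h ▸ hiS)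
      rw [Equiv.swap_apply_of_ne_of_ne (π.injective.ne hne), h1 i hiS]
      rw [h1 i hiS]
      exact he.ne (by simp [hiS]) (by simp) hne

theorem exists_top_subset {ι : Type*} (a : ι → ℝ) (J : Finset ι) (m : ℕ) (hm : m ≤ J.card) :
    ∃ G ⊆ J, G.card = m ∧ ∀ i ∈ G, ∀ j ∈ J, j ∉ G → a j ≤ a i := by
  classical
  induction m with
  | zero => exact ⟨∅, by simp, by simp, by simp⟩
  | succ m ih =>
    obtain ⟨G, hG, hc, h⟩ := ih (by omega)
    obtain ⟨k, hk, hmax⟩ := (J \ G).exists_max_image a (by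
      rw [← Finset.card_pos, Finset.card_sdiff_of_subset hG]; omega)
    obtain ⟨hkJ, hkG⟩ := Finset.mem_sdiff.1 hk
    refine ⟨insert k G, Finset.insert_subset hkJ hG, by rw [Finset.card_insert_of_notMem hkG, hc],
      fun i hi j hj hjG => ?_⟩
    simp only [Finset.mem_insert, not_or] at hi hjG
    rcases hi with rfl | hi
    · exact hmax j (Finset.mem_sdiff.2 ⟨hj, hjG.2⟩)
    · exact h i hi j hj hjG.2

/-- Representing a sum in groups of at most `M` terms costs the maximal size of a term plus the
total size divided by `M`. -/
theorem rep_sum_of_groups {ι : Type*} {u : V d → ℝ} {F : ι → V d → ℝ} {a b : ι → ℝ} {C : ℝ}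
    {M : ℕ} (hM : 0 < M) (ha : ∀ j, 0 ≤ a j) (hC : 0 ≤ C)
    (h : ∀ G : Finset ι, G.card ≤ M → ∀ A, 0 ≤ A → (∀ j ∈ G, a j ≤ A) →
      Rep u (C * A + ∑ j ∈ G, b j) (fun x => ∑ j ∈ G, F j x))
    (J : Finset ι) {A : ℝ} (hA : 0 ≤ A) (hJ : ∀ j ∈ J, a j ≤ A) :
    Rep u (C * (A + (∑ j ∈ J, a j) / M) + ∑ j ∈ J, b j) (fun x => ∑ j ∈ J, F j x) := by
  classical
  have hM' : (0 : ℝ) < M := by exact_mod_cast hM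
  induction hn : J.card using Nat.strong_induction_on generalizing J A with
  | _ n ih =>
    rcases le_or_gt J.card M with hle | hlt
    · refine (h J hle A hA hJ).mono ?_
      have : 0 ≤ C * ((∑ j ∈ J, a j) / M) :=
        mul_nonneg hC (div_nonneg (Finset.sum_nonneg fun _ _ => ha _) hM'.le)
      linarith
    obtain ⟨G, hG, hc, htop⟩ := exists_top_subset a J M hlt.le
    have hA' : 0 ≤ (∑ j ∈ G, a j) / M := div_nonneg (Finset.sum_nonneg fun _ _ => ha _) hM'.le
    have h1 := ih (J \ G).card (by rw [Finset.card_sdiff_of_subset hG]; omega) (J \ G) hA'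
      (fun j hj => by
        rw [le_div_iff₀ hM', mul_comm, ← hc, ← nsmul_eq_mul]
        exact Finset.card_nsmul_le_sum _ _ _ fun i hi =>
          htop i hi j (Finset.mem_sdiff.1 hj).1 (Finset.mem_sdiff.1 hj).2) rfl
    have h2 := h G hc.le A hA fun j hj => hJ j (hG hj)
    refine ((h1.add h2).mono (le_of_eq ?_)).congr fun x => ?_
    · rw [← Finset.sum_sdiff hG, ← Finset.sum_sdiff (f := b) hG]
      ring
    · exact (Finset.sum_sdiff hG).symm

theorem abs_sum_le_of_disjoint {ε A : ℝ} {s x : V d} {F : (Fin d → ℤ) → V d → ℝ} (hε : 0 < ε)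
    (G : Finset (Fin d → ℤ)) (hF : ∀ j ∈ G, ∀ x, F j x ≠ 0 → ‖x - ctr ε s j‖ ≤ ε / 4)
    (hA : 0 ≤ A) (hb : ∀ j ∈ G, |F j x| ≤ A) : |∑ j ∈ G, F j x| ≤ A := by
  by_cases h : ∃ j ∈ G, F j x ≠ 0
  · obtain ⟨j, hj, hjx⟩ := h
    rw [Finset.sum_eq_single_of_mem j hj fun i hi hij => by
      by_contra hne
      exact hij (eq_of_norm_ctr_sub hε (hF i hi x hne) (hF j hj x hjx) (by linarith))]
    exact hb j hj
  · push Not at h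
    rw [Finset.sum_eq_zero h, abs_zero]
    exact hA

theorem sum_integral_cells_le {ε : ℝ} {s : V d} {g : V d → ℝ} (hε : 0 < ε)
    (J : Finset (Fin d → ℤ)) (hg : Integrable g) (h0 : ∀ x, 0 ≤ g x) :
    ∑ j ∈ J, ∫ x in Metric.ball (ctr ε s j) (ε / 4), g x ≤ ∫ x, g x := by
  rw [← integral_biUnion_finset J (fun _ _ => Metric.isOpen_ball.measurableSet) ?_
    fun _ _ => hg.integrableOn]
  · exact setIntegral_le_integral hg (Filter.Eventually.of_forall h0)
  · intro i _ j _ hij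
    refine Set.disjoint_left.2 fun x hi hj => hij ?_
    rw [Metric.mem_ball, dist_eq_norm] at hi hj
    exact eq_of_norm_ctr_sub hε hi.le hj.le (by linarith)

theorem volume_real_ball (x : V d) {r : ℝ} (hr : 0 < r) :
    volume.real (Metric.ball x r) = r ^ d * volume.real (Metric.ball (0 : V d) 1) := by
  rw [measureReal_def, Measure.addHaar_ball_of_pos _ _ hr, ENNReal.toReal_mul,
    ENNReal.toReal_ofReal (by positivity), finrank_euclideanSpace_fin, measureReal_def]

theorem volume_real_ball_pos (x : V d) {r : ℝ} (hr : 0 < r) :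
    0 < volume.real (Metric.ball x r) :=
  ENNReal.toReal_pos (Metric.measure_ball_pos _ _ hr).ne' measure_ball_lt_top.ne

theorem exists_class (hd : 0 < d) {ε : ℝ} (hε : 0 < ε) (x : V d) :
    ∃ (c : Fin d → Fin (5 * d)) (j : Fin d → ℤ),
      ‖x - ctr ε (WithLp.toLp 2 fun k => ε / (5 * d) * (c k : ℕ)) j‖ < ε / 4 := by
  have hd' : (0 : ℝ) < d := by exact_mod_cast hd
  have hm : (0 : ℤ) < (5 * d : ℕ) := by exact_mod_cast (by omega : 0 < 5 * d)
  let q : Fin d → ℤ := fun k => ⌊x k * (5 * d) / ε⌋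
  refine ⟨fun k => ⟨(q k % (5 * d : ℕ)).toNat, ?_⟩, fun k => q k / (5 * d : ℕ), ?_⟩
  · have := Int.emod_lt_of_pos (q k) hm
    have := Int.emod_nonneg (q k) hm.ne'
    omega
  refine lt_of_le_of_lt (norm_le_of_coord (r := ε / (5 * d)) (by positivity) fun k => ?_) ?_
  · have e1 : (((q k % (5 * d : ℕ)).toNat : ℕ) : ℝ) = ((q k % (5 * d : ℕ) : ℤ) : ℝ) := by
      exact_mod_cast Int.toNat_of_nonneg (Int.emod_nonneg (q k) hm.ne')
    have e2 : ((q k % (5 * d : ℕ) : ℤ) : ℝ) + 5 * d * ((q k / (5 * d : ℕ) : ℤ) : ℝ) = q k := by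
      exact_mod_cast Int.emod_add_mul_ediv (q k) (5 * d : ℕ)
    have h1 := Int.floor_le (x k * (5 * d) / ε)
    have h2 := Int.lt_floor_add_one (x k * (5 * d) / ε)
    have e3 : (x - ctr ε (WithLp.toLp 2 fun k => ε / (5 * d) * ((q k % (5 * d : ℕ)).toNat : ℕ))
        fun k => q k / (5 * d : ℕ)) k = ε / (5 * d) * (x k * (5 * d) / ε - q k) := by
      rw [← e2, PiLp.sub_apply, ctr_apply]
      dsimp only
      rw [e1]
      field_simp
    rw [e3, abs_mul, abs_of_pos (by positivity : 0 < ε / (5 * d))]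
    refine mul_le_of_le_one_right (by positivity) ?_
    rw [abs_le]
    constructor <;> linarith
  · rw [div_eq_mul_inv, mul_inv]
    field_simp
    norm_num

theorem exists_partition {ι : Type} [Fintype ι] (U : ι → Set (V d)) (ho : ∀ i, IsOpen (U i))
    (hU : ∀ x, ∃ i, x ∈ U i) : ∃ ψ : ι → V d → ℝ, (∀ i, ContDiff ℝ (⊤ : ℕ∞) (ψ i)) ∧
      (∀ i x, 0 ≤ ψ i x) ∧ (∀ i x, ψ i x ≤ 1) ∧ (∀ x, ∑ i, ψ i x = 1) ∧
      ∀ i x, ψ i x ≠ 0 → x ∈ U i := by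
  obtain ⟨f, hf⟩ := SmoothPartitionOfUnity.exists_isSubordinate (modelWithCornersSelf ℝ (V d))
    isClosed_univ U ho fun x _ => mem_iUnion.2 (hU x)
  refine ⟨fun i => f i, fun i => (f i).contMDiff.contDiff, fun i x => f.nonneg i x,
    fun i x => f.le_one i x, fun x => ?_, fun i x hx => hf i (subset_tsupport _ hx)⟩
  rw [← finsum_eq_sum_of_fintype]
  exact f.sum_eq_one (mem_univ x)

/-- Functions of mean zero supported in the cube of half-side `r` are representable at a cost
proportional to their maximum. -/
def BoxRep (u : V d → ℝ) (r C : ℝ) : Prop :=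
  ∀ f : V d → ℝ, ContDiff ℝ (⊤ : ℕ∞) f → (∀ x, f x ≠ 0 → ∀ k, |x k| ≤ r) →
    (∫ x, f x) = 0 → ∀ A, (∀ x, |f x| ≤ A) → Rep u (C * A) f

theorem hasCompactSupport_of_cell {f : V d → ℝ} {p : V d} {r : ℝ}
    (h : ∀ x, f x ≠ 0 → ‖x - p‖ ≤ r) : HasCompactSupport f :=
  hasCompactSupport_of_norm (R := r + ‖p‖) fun x hx => by
    have := norm_le_norm_sub_add x p
    linarith [h x hx]

/-- A density of mass one spread over `N ^ d` cells. -/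
theorem exists_density {ε : ℝ} (hε : 0 < ε) {N : ℕ} (hN : 0 < N) (s : V d) :
    ∃ η : V d → ℝ, ContDiff ℝ (⊤ : ℕ∞) η ∧ HasCompactSupport η ∧
      (∀ x, η x ≠ 0 → ∃ j : Fin d → ℤ, (∀ k, 0 ≤ j k ∧ j k < N) ∧ ‖x - ctr ε s j‖ ≤ ε / 4) ∧
      (∫ x, η x) = 1 ∧
      ∀ x, |η x| ≤ ((N * ε / 8) ^ d * volume.real (Metric.ball (0 : V d) 1))⁻¹ := by
  let χ : ContDiffBump (0 : V d) := ⟨ε / 8, ε / 4, by linarith, by linarith⟩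
  have hN' : (0 : ℝ) < N := by exact_mod_cast hN
  set w := volume.real (Metric.ball (0 : V d) 1) with hw
  have hw0 : 0 < w := volume_real_ball_pos _ one_pos
  set H : Finset (Fin d → ℤ) := Fintype.piFinset fun _ => Finset.Ico 0 (N : ℤ) with hH
  have hcard : H.card = N ^ d := by simp [hH]
  let F : (Fin d → ℤ) → V d → ℝ := fun j x => χ.normed volume (x - ctr ε s j)
  have hFs : ∀ j, ContDiff ℝ (⊤ : ℕ∞) (F j) := fun j =>
    χ.contDiff_normed.comp (contDiff_id.sub contDiff_const)
  have hF : ∀ j x, F j x ≠ 0 → ‖x - ctr ε s j‖ ≤ ε / 4 := by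
    intro j x hx
    have : x - ctr ε s j ∈ Function.support (χ.normed volume) := hx
    rw [χ.support_normed_eq] at this
    simpa using (mem_ball_zero_iff.1 this).le
  have hFi : ∀ j, Integrable (F j) := fun j =>
    (hFs j).continuous.integrable_of_hasCompactSupport (hasCompactSupport_of_cell (hF j))
  have hb : ∀ j x, |F j x| ≤ ((ε / 8) ^ d * w)⁻¹ := by
    intro j x
    rw [abs_of_nonneg (χ.nonneg_normed _)]
    refine (χ.normed_le_div_measure_closedBall_rIn volume _).trans ?_
    rw [one_div, hw, ← volume_real_ball (0 : V d) (by positivity)]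
    gcongr
    · exact volume_real_ball_pos _ (by positivity)
    · exact measure_closedBall_lt_top.ne
    · exact Metric.ball_subset_closedBall
  have hsupp : ∀ x, ((N : ℝ) ^ d)⁻¹ * ∑ j ∈ H, F j x ≠ 0 →
      ∃ j : Fin d → ℤ, (∀ k, 0 ≤ j k ∧ j k < N) ∧ ‖x - ctr ε s j‖ ≤ ε / 4 := by
    intro x hx
    obtain ⟨j, hj, hjx⟩ := Finset.exists_ne_zero_of_sum_ne_zero (right_ne_zero_of_mul hx)
    exact ⟨j, by simpa [hH] using hj, hF j x hjx⟩
  refine ⟨fun x => ((N : ℝ) ^ d)⁻¹ * ∑ j ∈ H, F j x,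
    contDiff_const.mul (ContDiff.sum fun j _ => hFs j), ?_, hsupp, ?_, fun x => ?_⟩
  · have : (fun x => ∑ j ∈ H, F j x) = ∑ j ∈ H, F j := by ext; simp
    refine HasCompactSupport.mul_left ?_
    rw [this]
    refine Finset.sum_induction F HasCompactSupport (fun _ _ h h' => h.add h') HasCompactSupport.zero
      fun j _ => hasCompactSupport_of_cell (hF j)
  · rw [integral_const_mul, integral_finsetSum _ fun j _ => hFi j]
    have : ∀ j, ∫ x, F j x = 1 := fun j => by
      rw [integral_sub_right_eq_self (χ.normed volume), χ.integral_normed]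
    simp only [this, Finset.sum_const, hcard]
    simp [hN'.ne']
  · rw [abs_mul, abs_of_pos (by positivity), mul_div_assoc, mul_pow, mul_assoc, mul_inv]
    exact mul_le_mul_of_nonneg_left (abs_sum_le_of_disjoint hε H (fun j _ => hF j)
      (by positivity) fun j _ => hb j x) (by positivity)

theorem rep_group (hd : 2 ≤ d) {u : V d → ℝ} {r C : ℝ} (hbox : BoxRep u r C) {ε : ℝ} (hε : 0 < ε)
    {N : ℕ} (hN : 0 < N) (hr : r = 3 * (N * ε)) {s : V d} (hs : ∀ k, 0 ≤ s k ∧ s k ≤ ε)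
    {η : V d → ℝ} {c : ℝ} (hη : ContDiff ℝ (⊤ : ℕ∞) η) (hηc : HasCompactSupport η)
    (hηs : ∀ x, η x ≠ 0 →
      ∃ j : Fin d → ℤ, (∀ k, 0 ≤ j k ∧ j k < N) ∧ ‖x - ctr ε s j‖ ≤ ε / 4)
    (hη1 : ∫ x, η x = 1) (hηb : ∀ x, |η x| ≤ c) {F : (Fin d → ℤ) → V d → ℝ}
    (hF : ∀ j, ContDiff ℝ (⊤ : ℕ∞) (F j)) (hFs : ∀ j x, F j x ≠ 0 → ‖x - ctr ε s j‖ ≤ ε / 4)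
    {G : Finset (Fin d → ℤ)} (hG : G.card ≤ N ^ d) {A : ℝ} (hA : 0 ≤ A)
    (hb : ∀ j ∈ G, ∀ x, |F j x| ≤ A) :
    Rep u (C * (A + ∑ j ∈ G, |∫ x, F j x| * c))
      (fun x => ∑ j ∈ G, (F j x - (∫ y, F j y) * η x)) := by
  classical
  set H₀ : Finset (Fin d → ℤ) := Fintype.piFinset fun _ => Finset.Ico 0 (N : ℤ) with hH₀
  set H : Finset (Fin d → ℤ) := Fintype.piFinset fun _ => Finset.Ico 0 (2 * N : ℤ) with hH
  have hc0 : H₀.card = N ^ d := by simp [hH₀]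
  have hc1 : H.card = (2 * N) ^ d := by
    have : (2 * (N : ℤ)).toNat = 2 * N := by omega
    simp [hH, this]
  have hcard : (G ∪ H₀).card ≤ H.card := by
    refine (Finset.card_union_le _ _).trans ?_
    rw [hc0, hc1, mul_pow]
    have : 2 ^ 2 ≤ 2 ^ d := Nat.pow_le_pow_right (by norm_num) hd
    nlinarith [Nat.zero_le (N ^ d)]
  obtain ⟨e, he, hinj⟩ := (G ∪ H₀).finite_toSet.exists_injOn_of_encard_le
    (t := (H : Set (Fin d → ℤ))) (by
      rw [encard_coe_eq_coe_finsetCard, encard_coe_eq_coe_finsetCard]; exact_mod_cast hcard)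
  obtain ⟨π, ⟨T, hT, hTc⟩, hπ⟩ := exists_realizable hd hε s (G ∪ H₀) hinj
  obtain ⟨Ψ, hΨ, hl, hrr⟩ := diffeo_inv hT
  have hFi : ∀ j, Integrable (F j) := fun j =>
    (hF j).continuous.integrable_of_hasCompactSupport (hasCompactSupport_of_cell (hFs j))
  have hηi : Integrable η := hη.continuous.integrable_of_hasCompactSupport hηc
  set g : V d → ℝ := fun x => ∑ j ∈ G, (F j x - (∫ y, F j y) * η x) with hg
  have hgs : ContDiff ℝ (⊤ : ℕ∞) g :=
    ContDiff.sum fun j _ => (hF j).sub (contDiff_const.mul hη)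
  have hcell : ∀ x, g x ≠ 0 → ∃ j ∈ G ∪ H₀, ‖x - ctr ε s j‖ ≤ ε / 4 := by
    intro x hx
    by_cases hηx : η x = 0
    · simp only [hg, hηx, mul_zero, sub_zero] at hx
      obtain ⟨j, hj, hjx⟩ := Finset.exists_ne_zero_of_sum_ne_zero hx
      exact ⟨j, Finset.mem_union_left _ hj, hFs j x hjx⟩
    · obtain ⟨j, hj, hjx⟩ := hηs x hηx
      exact ⟨j, Finset.mem_union_right _ (by simpa [hH₀] using hj), hjx⟩
  have hrep := hbox (fun y => g (Ψ y)) (hgs.comp hΨ.1) ?_ ?_ (A + ∑ j ∈ G, |∫ x, F j x| * c) ?_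
  · refine (hrep.comp hT).congr fun x => ?_
    rw [hl x]
  · intro y hy k
    obtain ⟨j, hj, hjx⟩ := hcell _ hy
    have h1 := hTc j _ hjx
    rw [hrr y, hπ j hj] at h1
    have h2 : e j ∈ H := he hj
    simp only [hH, Fintype.mem_piFinset, Finset.mem_Ico] at h2
    have h3 : (0 : ℝ) ≤ e j k := by exact_mod_cast (h2 k).1
    have h4 : (e j k : ℝ) + 1 ≤ 2 * N := by exact_mod_cast (h2 k).2
    have h5 := abs_le.1 (abs_coord_le h1 k)
    rw [PiLp.sub_apply, ctr_apply] at h5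
    have h6 : (1 : ℝ) ≤ N := by exact_mod_cast hN
    have h7 := hs k
    rw [abs_le, hr]
    constructor <;> nlinarith
  · rw [hΨ.2.2.1.integral_comp (hΨ.1.continuous.measurableEmbedding hrr.leftInverse.injective)]
    simp only [hg]
    rw [integral_finsetSum _ fun j _ => by exact (hFi j).sub (hηi.const_mul _)]
    refine Finset.sum_eq_zero fun j _ => ?_
    rw [integral_sub (hFi j) (hηi.const_mul _), integral_const_mul, hη1]
    ring
  · intro y
    simp only [hg, Finset.sum_sub_distrib]
    refine (abs_sub _ _).trans (add_le_add (abs_sum_le_of_disjoint hε G (fun j _ => hFs j) hA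
      fun j hj => hb j hj _) ((Finset.abs_sum_le_sum_abs _ _).trans
      (Finset.sum_le_sum fun j _ => ?_)))
    rw [abs_mul]
    exact mul_le_mul_of_nonneg_left (hηb _) (abs_nonneg _)

/-- Cutting a function supported in the cells of a lattice into its restrictions to the cells. -/
theorem exists_pieces {ε : ℝ} (hε : 0 < ε) (s : V d) {f : V d → ℝ} (hf : ContDiff ℝ (⊤ : ℕ∞) f)
    (hs : ∀ x, f x ≠ 0 → ∃ j, ‖x - ctr ε s j‖ < ε / 4) :
    ∃ F : (Fin d → ℤ) → V d → ℝ, (∀ j, ContDiff ℝ (⊤ : ℕ∞) (F j)) ∧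
      (∀ j x, F j x ≠ 0 → ‖x - ctr ε s j‖ < ε / 4) ∧
      ∀ j x, ‖x - ctr ε s j‖ < ε / 4 → F j x = f x := by
  let χ : ∀ j, ContDiffBump (ctr ε s j) := fun j => ⟨ε / 4, ε / 3, by linarith, by linarith⟩
  refine ⟨fun j x => χ j x * f x, fun j => (χ j).contDiff.mul hf, fun j x hx => ?_, fun j x hx => ?_⟩
  · obtain ⟨i, hi⟩ := hs x (right_ne_zero_of_mul hx)
    have h1 : ‖x - ctr ε s j‖ < ε / 3 := by
      rw [← dist_eq_norm]
      by_contra h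
      exact left_ne_zero_of_mul hx ((χ j).zero_of_le_dist (not_lt.1 h))
    rwa [eq_of_norm_ctr_sub hε h1.le hi.le (by linarith)]
  · dsimp only
    rw [(χ j).one_of_mem_closedBall (by rw [Metric.mem_closedBall, dist_eq_norm]; exact hx.le),
      one_mul]

theorem exists_finset_cells {ε : ℝ} (hε : 0 < ε) (s : V d) (R : ℝ) :
    ∃ J : Finset (Fin d → ℤ), ∀ j x, ‖x‖ ≤ R → ‖x - ctr ε s j‖ < ε / 4 → j ∈ J := by
  obtain ⟨L, hL⟩ := exists_nat_gt ((R + ε / 4 + ‖s‖) / ε)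
  rw [div_lt_iff₀ hε] at hL
  refine ⟨Finset.Icc (fun _ => -(L : ℤ)) fun _ => L, fun j x hx hj => ?_⟩
  have key : ∀ k, |(j k : ℝ)| ≤ L := fun k => by
    have h1 : ‖ctr ε s j - s‖ ≤ R + ε / 4 + ‖s‖ := by
      have h2 := norm_sub_le (x - s) (x - ctr ε s j)
      have h3 := norm_sub_le x s
      rw [sub_sub_sub_cancel_left] at h2
      linarith
    have h2 := abs_coord_le h1 k
    rw [PiLp.sub_apply, ctr_apply, add_sub_cancel_left, abs_mul, abs_of_pos hε] at h2
    by_contra h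
    push Not at h
    nlinarith
  rw [Finset.mem_Icc]
  exact ⟨fun k => by exact_mod_cast (abs_le.1 (key k)).1, fun k => by
    exact_mod_cast (abs_le.1 (key k)).2⟩

theorem rep_class (hd : 2 ≤ d) {u : V d → ℝ} {r C : ℝ} (hbox : BoxRep u r C) (hC : 0 ≤ C) {ε : ℝ}
    (hε : 0 < ε) {N : ℕ} (hN : 0 < N) (hr : r = 3 * (N * ε)) {s : V d}
    (hs : ∀ k, 0 ≤ s k ∧ s k ≤ ε) {η : V d → ℝ} {c : ℝ}
    (hc : c = ((N * ε / 8) ^ d * volume.real (Metric.ball (0 : V d) 1))⁻¹)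
    (hη : ContDiff ℝ (⊤ : ℕ∞) η) (hηc : HasCompactSupport η)
    (hηs : ∀ x, η x ≠ 0 →
      ∃ j : Fin d → ℤ, (∀ k, 0 ≤ j k ∧ j k < N) ∧ ‖x - ctr ε s j‖ ≤ ε / 4)
    (hη1 : ∫ x, η x = 1) (hηb : ∀ x, |η x| ≤ c) {f g : V d → ℝ}
    (hf : ContDiff ℝ (⊤ : ℕ∞) f) {R A : ℝ} (hfR : ∀ x, f x ≠ 0 → ‖x‖ ≤ R) (hA : ∀ x, |f x| ≤ A)
    (hfs : ∀ x, f x ≠ 0 → ∃ j, ‖x - ctr ε s j‖ < ε / 4)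
    (hg : Integrable g) (hg0 : ∀ x, 0 ≤ g x)
    (hfg : ∀ j x y, ‖x - ctr ε s j‖ < ε / 4 → ‖y - ctr ε s j‖ < ε / 4 → |f y| ≤ g x) :
    Rep u (C * (A + 2 * c * ∫ x, g x)) (fun x => f x - (∫ y, f y) * η x) := by
  have hA0 : 0 ≤ A := (abs_nonneg _).trans (hA 0)
  have hN' : (0 : ℝ) < N := by exact_mod_cast hN
  set w := volume.real (Metric.ball (0 : V d) 1) with hw
  have hw0 : 0 < w := volume_real_ball_pos _ one_pos
  have hc0 : 0 < c := by rw [hc]; positivity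
  obtain ⟨F, hF, hFs, hFf⟩ := exists_pieces hε s hf hfs
  obtain ⟨J, hJ⟩ := exists_finset_cells hε s R
  have hFg : ∀ j x y, ‖x - ctr ε s j‖ < ε / 4 → |F j y| ≤ g x := by
    intro j x y hx
    by_cases hy : F j y = 0
    · rw [hy, abs_zero]; exact hg0 x
    · rw [hFf j y (hFs j y hy)]; exact hfg j x y hx (hFs j y hy)
  have hFA : ∀ j y, |F j y| ≤ A := by
    intro j y
    by_cases hy : F j y = 0
    · rw [hy, abs_zero]; exact hA0
    · rw [hFf j y (hFs j y hy)]; exact hA y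
  have hFi : ∀ j, Integrable (F j) := fun j => (hF j).continuous.integrable_of_hasCompactSupport
    (hasCompactSupport_of_cell fun x hx => (hFs j x hx).le)
  have hsum : ∀ x, ∑ j ∈ J, F j x = f x := by
    intro x
    by_cases hx : f x = 0
    · rw [hx]
      refine Finset.sum_eq_zero fun j _ => ?_
      by_contra hne
      exact hne ((hFf j x (hFs j x hne)).trans hx)
    · obtain ⟨j, hj⟩ := hfs x hx
      rw [Finset.sum_eq_single_of_mem j (hJ j x (hfR x hx) hj), hFf j x hj]
      intro i _ hij
      by_contra hne
      exact hij (eq_of_norm_ctr_sub hε (hFs i x hne).le hj.le (by linarith))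
  set a : (Fin d → ℤ) → ℝ := fun j => ⨆ y, |F j y| with ha
  have hle : ∀ j y, |F j y| ≤ a j := fun j y =>
    le_ciSup (f := fun y => |F j y|) ⟨A, by rintro _ ⟨y, rfl⟩; exact hFA j y⟩ y
  have ha0 : ∀ j, 0 ≤ a j := fun j => (abs_nonneg _).trans (hle j 0)
  have hcells := sum_integral_cells_le (s := s) hε J hg hg0
  have h1 : (∑ j ∈ J, a j) / (N ^ d : ℕ) ≤ c * ∫ x, g x := by
    have h2 : (∑ j ∈ J, a j) * ((ε / 4) ^ d * w) ≤ ∫ x, g x := by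
      refine le_trans ?_ hcells
      rw [Finset.sum_mul]
      refine Finset.sum_le_sum fun j _ => ?_
      rw [hw, ← volume_real_ball (ctr ε s j) (by positivity), mul_comm, ← smul_eq_mul,
        ← setIntegral_const]
      refine setIntegral_mono_on (integrableOn_const measure_ball_lt_top.ne) hg.integrableOn
        Metric.isOpen_ball.measurableSet fun x hx => ?_
      rw [Metric.mem_ball, dist_eq_norm] at hx
      exact ciSup_le fun y => hFg j x y hx
    have h3 : (ε / 8) ^ d * w ≤ (ε / 4) ^ d * w := by gcongr; norm_num
    have h4 : 0 ≤ ∑ j ∈ J, a j := Finset.sum_nonneg fun j _ => ha0 j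
    rw [hc, mul_div_assoc, mul_pow, ← div_eq_inv_mul, mul_assoc, Nat.cast_pow,
      div_le_div_iff₀ (by positivity) (by positivity)]
    have h5 := mul_le_mul_of_nonneg_left h3 h4
    have h6 : (0 : ℝ) ≤ N ^ d := by positivity
    nlinarith
  have h2 : ∑ j ∈ J, |∫ x, F j x| ≤ ∫ x, g x := by
    refine le_trans (Finset.sum_le_sum fun j _ => ?_) hcells
    rw [← setIntegral_eq_integral_of_forall_compl_eq_zero (s := Metric.ball (ctr ε s j) (ε / 4))
      fun x hx => by
        by_contra hne
        exact hx (by rw [Metric.mem_ball, dist_eq_norm]; exact hFs j x hne)]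
    refine norm_integral_le_of_norm_le (f := F j) hg.integrableOn
      ((ae_restrict_iff' Metric.isOpen_ball.measurableSet).2 (Filter.Eventually.of_forall
        fun x hx => hFg j x x ?_))
    rwa [Metric.mem_ball, dist_eq_norm] at hx
  have h3 := rep_sum_of_groups (u := u) (F := fun j x => F j x - (∫ y, F j y) * η x) (a := a)
    (b := fun j => C * (|∫ x, F j x| * c)) (C := C) (M := N ^ d) (by positivity) ha0 hC
    (fun G hG B hB haB => by
      refine (rep_group hd hbox hε hN hr hs hη hηc hηs hη1 hηb hF
        (fun j x hx => (hFs j x hx).le) hG hB fun j hj x => (hle j x).trans (haB j hj)).mono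
        (le_of_eq ?_)
      rw [mul_add, Finset.mul_sum]) J hA0 fun j _ => ciSup_le (hFA j)
  refine (h3.mono ?_).congr fun x => ?_
  · rw [← Finset.mul_sum, ← Finset.sum_mul, ← mul_add]
    refine mul_le_mul_of_nonneg_left ?_ hC
    have := mul_le_mul_of_nonneg_right h2 hc0.le
    linarith
  · rw [Finset.sum_sub_distrib, hsum, ← Finset.sum_mul, ← integral_finsetSum _ fun j _ => hFi j]
    simp only [hsum]

theorem exists_majorant {f : V d → ℝ} (hf : ContDiff ℝ (⊤ : ℕ∞) f) (hc : HasCompactSupport f)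
    {A : ℝ} (hA : 0 < A) : ∃ δ > 0, ∃ g : V d → ℝ, Integrable g ∧ (∀ x, 0 ≤ g x) ∧
      (∫ x, g x) ≤ (∫ x, |f x|) + A ∧ ∀ x y, ‖x - y‖ < δ → |f y| ≤ g x := by
  obtain ⟨K, hK⟩ := hf.lipschitzWith_of_hasCompactSupport hc (by simp)
  obtain ⟨R, hR⟩ := hc.isCompact.isBounded.exists_norm_le
  have hR' : ∀ x, f x ≠ 0 → ‖x‖ ≤ R := fun x hx => hR x (subset_tsupport _ hx)
  set U := Metric.ball (0 : V d) (|R| + 1) with hU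
  have hv : 0 < volume.real U := volume_real_ball_pos _ (by positivity)
  obtain ⟨δ, hδ, h1⟩ := Metric.uniformContinuous_iff.1 hK.uniformContinuous (A / volume.real U)
    (by positivity)
  have hfi : Integrable fun x => |f x| :=
    (hf.continuous.integrable_of_hasCompactSupport hc).abs
  have hUi : Integrable (U.indicator fun _ => A / volume.real U) :=
    (integrable_indicator_iff Metric.isOpen_ball.measurableSet).2
      (integrableOn_const measure_ball_lt_top.ne)
  have hU0 : ∀ x, 0 ≤ U.indicator (fun _ => A / volume.real U) x :=
    fun x => indicator_nonneg (fun _ _ => by positivity) x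
  refine ⟨min δ 1, lt_min hδ one_pos, fun x => |f x| + U.indicator (fun _ => A / volume.real U) x,
    hfi.add hUi, fun x => add_nonneg (abs_nonneg _) (hU0 x), ?_, fun x y hxy => ?_⟩
  · rw [integral_add hfi hUi, integral_indicator Metric.isOpen_ball.measurableSet,
      setIntegral_const, smul_eq_mul, mul_div_cancel₀ _ hv.ne']
  · by_cases hy : f y = 0
    · rw [hy, abs_zero]
      exact add_nonneg (abs_nonneg _) (hU0 x)
    · have hx : x ∈ U := by
        rw [hU, mem_ball_zero_iff]
        have h2 := norm_sub_norm_le x y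
        linarith [hR' y hy, hxy.trans_le (min_le_right _ _), le_abs_self R]
      dsimp only
      rw [indicator_of_mem hx]
      have h2 := h1 (a := y) (b := x)
        (by rw [dist_comm, dist_eq_norm]; exact hxy.trans_le (min_le_left _ _))
      rw [Real.dist_eq] at h2
      have h3 := abs_sub_abs_le_abs_sub (f y) (f x)
      linarith

/-- A function which is a coordinate on a sufficiently large ball is flexible. -/
theorem exists_flex_of_eq_coord (i₀ : Fin d) (hd : 2 ≤ d) :
    ∃ R : ℝ, 0 < R ∧ ∀ u : V d → ℝ, (∀ x, ‖x‖ ≤ R → u x = x i₀) → Flex u := by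
  have hd' : (0 : ℝ) < d := by exact_mod_cast (by omega : 0 < d)
  set r : ℝ := 1 / d with hrdef
  have hr : 0 < r := by positivity
  obtain ⟨R, C, hR, hC, hrep⟩ := exists_rep_box i₀ hd hr (by rw [hrdef]; field_simp; rfl)
  refine ⟨R, hR, fun u hu => ?_⟩
  have hbox : BoxRep u r C := hrep u hu
  set c := ((r / 3 / 8) ^ d * volume.real (Metric.ball (0 : V d) 1))⁻¹ with hc
  have hw0 : 0 < volume.real (Metric.ball (0 : V d) 1) := volume_real_ball_pos _ one_pos
  have hc0 : 0 < c := by positivity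
  set m : ℝ := (Fintype.card (Fin d → Fin (5 * d)) : ℝ) with hm
  have hm0 : 0 ≤ m := by positivity
  refine ⟨m * C * (1 + 3 * c) + 1, by positivity, fun f hf hfc hf0 A hA => ?_⟩
  have hI0 : 0 ≤ ∫ x, |f x| := integral_nonneg fun _ => abs_nonneg _
  rcases ((abs_nonneg _).trans (hA 0)).eq_or_lt with hA0 | hA0
  · have : f = fun _ => 0 := funext fun x => abs_nonpos_iff.1 (hA0 ▸ hA x)
    rw [this]
    refine (Rep.zero u).mono ?_
    rw [← hA0]
    simp
  obtain ⟨δ, hδ, g, hg, hg0, hgI, hgf⟩ := exists_majorant hf hfc hA0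
  obtain ⟨N, hN⟩ := exists_nat_gt (r / 3 / δ)
  have hN0 : (0 : ℝ) < N := lt_of_le_of_lt (by positivity) hN
  have hN1 : 0 < N := by exact_mod_cast hN0
  set ε : ℝ := r / 3 / N with hε'
  have hε : 0 < ε := by positivity
  have hεδ : ε < δ := by rw [hε', div_lt_iff₀ hN0]; rwa [div_lt_iff₀ hδ, mul_comm] at hN
  have hNε : N * ε = r / 3 := by rw [hε']; field_simp
  let s : (Fin d → Fin (5 * d)) → V d :=
    fun q => WithLp.toLp 2 fun k => ε / (5 * d) * (q k : ℕ)
  have hs : ∀ q k, 0 ≤ s q k ∧ s q k ≤ ε := by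
    intro q k
    have h1 : ((q k : ℕ) : ℝ) ≤ 5 * d := by exact_mod_cast (q k).2.le
    refine ⟨by simp only [s]; positivity, ?_⟩
    calc ε / (5 * d) * (q k : ℕ) ≤ ε / (5 * d) * (5 * d) := by gcongr
      _ = ε := by field_simp
  obtain ⟨ψ, hψ, hψ0, hψ1, hψs, hψU⟩ := exists_partition
    (fun q : Fin d → Fin (5 * d) => ⋃ j, Metric.ball (ctr ε (s q) j) (ε / 4))
    (fun q => isOpen_iUnion fun j => Metric.isOpen_ball) (fun x => by
      obtain ⟨q, j, h⟩ := exists_class (by omega) hε x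
      exact ⟨q, mem_iUnion.2 ⟨j, by rwa [Metric.mem_ball, dist_eq_norm]⟩⟩)
  choose η hη hηc hηs hη1 hηb using fun q => exists_density hε hN1 (s q)
  rw [hNε] at hηb
  obtain ⟨Rf, hRf⟩ := hfc.isCompact.isBounded.exists_norm_le
  have hle : ∀ q x, |ψ q x * f x| ≤ |f x| := fun q x => by
    rw [abs_mul, abs_of_nonneg (hψ0 q x)]
    exact mul_le_of_le_one_left (abs_nonneg _) (hψ1 q x)
  have hpi : ∀ q, Integrable fun x => ψ q x * f x := fun q =>
    ((hψ q).continuous.mul hf.continuous).integrable_of_hasCompactSupport hfc.mul_left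
  have hpI : ∀ q, |∫ x, ψ q x * f x| ≤ ∫ x, |f x| := fun q =>
    norm_integral_le_of_norm_le (f := fun x => ψ q x * f x) (hf.continuous.integrable_of_hasCompactSupport hfc).abs
      (Filter.Eventually.of_forall (hle q))
  have h1 : ∀ q, Rep u (C * (A + 2 * c * ((∫ x, |f x|) + A)))
      (fun x => ψ q x * f x - (∫ y, ψ q y * f y) * η q x) := fun q => by
    refine (rep_class hd hbox hC.le hε hN1 (by rw [hNε]; ring) (hs q) (by rw [hNε]) (hη q) (hηc q)
      (hηs q) (hη1 q) (hηb q) ((hψ q).mul hf) (R := Rf) (A := A)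
      (fun x hx => hRf x (subset_tsupport _ (right_ne_zero_of_mul hx)))
      (fun x => (hle q x).trans (hA x)) (fun x hx => ?_) hg hg0 fun j x y hx hy => ?_).mono ?_
    · obtain ⟨j, hj⟩ := mem_iUnion.1 (hψU q x (left_ne_zero_of_mul hx))
      exact ⟨j, by rwa [Metric.mem_ball, dist_eq_norm] at hj⟩
    · refine (hle q y).trans (hgf x y ?_)
      have := norm_sub_le (x - ctr ε (s q) j) (y - ctr ε (s q) j)
      rw [sub_sub_sub_cancel_right] at this
      linarith
    · gcongr
  have h2 : Rep u (C * (m * ((∫ x, |f x|) * c))) (fun x => ∑ q, (∫ y, ψ q y * f y) * η q x) := by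
    refine hbox _ (ContDiff.sum fun q _ => contDiff_const.mul (hη q)) (fun x hx k => ?_) ?_ _
      fun x => ?_
    · obtain ⟨q, -, hq⟩ := Finset.exists_ne_zero_of_sum_ne_zero hx
      obtain ⟨j, hj, hjx⟩ := hηs q x (right_ne_zero_of_mul hq)
      have h5 := abs_le.1 (abs_coord_le hjx k)
      rw [PiLp.sub_apply, ctr_apply] at h5
      have h3 : (0 : ℝ) ≤ j k := by exact_mod_cast (hj k).1
      have h4 : (j k : ℝ) + 1 ≤ N := by exact_mod_cast (hj k).2
      have h6 : (1 : ℝ) ≤ N := by exact_mod_cast hN1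
      have h7 := hs q k
      rw [abs_le]
      constructor <;> nlinarith
    · rw [integral_finsetSum _ fun q _ =>
        ((hη q).continuous.integrable_of_hasCompactSupport (hηc q)).const_mul _]
      simp only [integral_const_mul, hη1, mul_one]
      rw [← integral_finsetSum _ fun q _ => hpi q]
      simp only [← Finset.sum_mul, hψs, one_mul, hf0]
    · refine (Finset.abs_sum_le_sum_abs _ _).trans ?_
      rw [hm, ← nsmul_eq_mul]
      refine Finset.sum_le_card_nsmul _ _ _ fun q _ => ?_
      rw [abs_mul]
      exact mul_le_mul (hpI q) (hηb q x) (abs_nonneg _) hI0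
  refine (((Rep.sum Finset.univ fun q _ => h1 q).add h2).mono ?_).congr fun x => ?_
  · rw [Finset.sum_const, nsmul_eq_mul, Finset.card_univ, ← hm]
    have h3 : 0 ≤ m * C * (∫ x, |f x|) := by positivity
    have h4 : 0 ≤ m * C * c * A := by positivity
    nlinarith
  · rw [Finset.sum_sub_distrib, sub_add_cancel, ← Finset.sum_mul, hψs, one_mul]

/-- A perturbation of a coordinate which is small in `C¹` is a component of a diffeomorphism. -/
theorem exists_straightening {i j : Fin d} (hij : i ≠ j) : ∃ c : ℝ, 0 < c ∧ ∀ h : V d → ℝ,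
    ContDiff ℝ (⊤ : ℕ∞) h → (∀ x, h x ≠ 0 → ‖x‖ ≤ 1) → (∀ x, |pd j h x| ≤ c) →
    ∃ Φ, IsCompSuppVolDiffeo d Φ ∧ ∀ x, ‖x‖ ≤ 1 → Φ x j = x j + h x := by
  obtain ⟨B, hB1, hB, -⟩ := exists_step_bound
  refine ⟨1 / (4 * (1 + 2 * B)), by positivity, fun h hh hs hj => ?_⟩
  set c := 1 / (4 * (1 + 2 * B)) with hc
  have hcB : 2 * c * (1 + 2 * B) = 1 / 2 := by rw [hc]; field_simp; norm_num
  have hc0 : 0 < c := by positivity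
  obtain ⟨η, -, hη⟩ := exists_bound hh.continuous (hasCompactSupport_of_norm hs)
  obtain ⟨κ, hκ, -, k1, -, k2, -, k3, -⟩ :=
    exists_shear_inverse_bound hh (by nlinarith : c ≤ 1 / 2) hj hη
  have hκs : ∀ x, κ x ≠ 0 → ‖x‖ ≤ 1 := fun x hx => hs x fun h => hx (k2 x h)
  have hK := pot_smooth hκ i
  have hstep : ContDiff ℝ (⊤ : ℕ∞) (fun y : V d => deriv step (y i)) :=
    (contDiff_deriv step_smooth).comp (contDiff_coord i)
  have hint := lineInt_smooth hκ i (-1) 1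
  have hKc : HasCompactSupport (pot i κ) := hasCompactSupport_of_norm fun y hy => by
    obtain ⟨h1, t, ht⟩ := pot_support hκ.continuous (fun x hx => abs_coord_le (hκs x hx) i) hy
    exact norm_le_of_line hκs h1 ht
  obtain ⟨Φ, hΦ, h1⟩ := exists_diffeo_of_generating hK hKc (i := i) (j := j) fun x => by
    rw [show pd i (pot i κ) = fun y => κ y - deriv step (y i) * lineInt i (-1) 1 κ y from
      funext fun y => pd_pot_same hκ i y, pd_sub (diff_of_smooth hκ)
      (diff_of_smooth (hstep.mul hint)), pd_mul (diff_of_smooth hstep) (diff_of_smooth hint),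
      pd_coord_ne (diff_of_smooth (contDiff_deriv step_smooth)) hij, pd_lineInt_ne hκ hij,
      mul_zero, add_zero]
    have h2 := abs_lineInt_le k3 i (by norm_num : (-1 : ℝ) ≤ 1) x
    have h3 : |deriv step (x i) * lineInt i (-1) 1 (pd j κ) x| ≤ B * (2 * c * (1 - -1)) := by
      rw [abs_mul]
      exact mul_le_mul (hB _) h2 (abs_nonneg _) (by linarith)
    have h4 := abs_sub (pd j κ x) (deriv step (x i) * lineInt i (-1) 1 (pd j κ) x)
    linarith [k3 x]
  refine ⟨Φ, hΦ, fun x hx => ?_⟩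
  have h2 : shear j (pd i (pot i κ)) (shear j h x) = x := by
    have h3 := abs_le.1 (abs_coord_le hx i)
    conv_rhs => rw [← k1 x]
    simp only [shear]
    rw [pd_pot_same hκ, show (x + h x • ev j : V d) i = x i from shear_ne hij h x,
      deriv_step_of_le (by linarith), zero_mul, sub_zero]
  have h3 := h1 (shear j h x)
  rw [h2] at h3
  rw [h3, shear_ne hij.symm, shear_same]

theorem Flex.of_smul {u : V d → ℝ} {s : ℝ} (hs : s ≠ 0) (p : V d)
    (h : Flex (fun x => u (p + s • x))) : Flex u :=
  Flex.of_conj (p := p) (L := ContinuousLinearEquiv.smulLeft (Units.mk0 s hs)) h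

/-- A function whose derivative at the origin is a coordinate is flexible. -/
theorem flex_of_fderiv_eq_coord (hd : 2 ≤ d) (j : Fin d) {g : V d → ℝ}
    (hg : ContDiff ℝ (⊤ : ℕ∞) g) (h0 : g 0 = 0)
    (h1 : HasFDerivAt g (EuclideanSpace.proj j : V d →L[ℝ] ℝ) 0) : Flex g := by
  have : Nontrivial (Fin d) := Fin.nontrivial_iff_two_le.2 hd
  obtain ⟨i, hij⟩ := exists_ne j
  obtain ⟨c, hc, hstr⟩ := exists_straightening hij
  obtain ⟨R, hR, hflex⟩ := exists_flex_of_eq_coord j hd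
  let χ : ContDiffBump (0 : V d) := ⟨1 / 2, 1, by norm_num, by norm_num⟩
  have hχ : ContDiff ℝ (⊤ : ℕ∞) χ := χ.contDiff
  obtain ⟨C, hC1, hC⟩ := exists_bound (contDiff_pd hχ j).continuous
    (hasCompactSupport_pd χ.hasCompactSupport j)
  have hpd0 : pd j g 0 = 1 := by rw [pd, h1.fderiv]; simp
  have e1 : ∀ᶠ y in nhds (0 : V d), ‖g y - y j‖ ≤ c / (2 * C) * ‖y‖ := by
    have := h1.isLittleO.def (show 0 < c / (2 * C) by positivity)
    simpa [h0] using this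
  have e2 : ∀ᶠ y in nhds (0 : V d), |pd j g y - 1| < c / 2 := by
    have := (contDiff_pd hg j).continuous.tendsto 0
    rw [hpd0] at this
    exact Metric.tendsto_nhds.1 this _ (by positivity)
  obtain ⟨s, hs, hball⟩ := Metric.eventually_nhds_iff_ball.1 (e1.and e2)
  set t := s / 2 with ht
  have ht0 : 0 < t := by positivity
  have hmem : ∀ x : V d, ‖x‖ ≤ 1 → t • x ∈ Metric.ball (0 : V d) s := by
    intro x hx
    rw [mem_ball_zero_iff, norm_smul, Real.norm_eq_abs, abs_of_pos ht0]
    nlinarith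
  have hgt : ContDiff ℝ (⊤ : ℕ∞) (fun x : V d => g (t • x)) := hg.comp (contDiff_id.const_smul t)
  have hw : ContDiff ℝ (⊤ : ℕ∞) (fun x : V d => t⁻¹ * g (t • x) - x j) :=
    (contDiff_const.mul hgt).sub (contDiff_coord j)
  have hχ0 : ∀ x, 1 < ‖x‖ → χ x = 0 := fun x hx => χ.zero_of_le_dist (by simpa using hx.le)
  have hχ1 : ∀ x, |χ x| ≤ 1 := fun x => by rw [abs_of_nonneg χ.nonneg]; exact χ.le_one
  have hs1 : ∀ x, χ x * (t⁻¹ * g (t • x) - x j) ≠ 0 → ‖x‖ ≤ 1 := fun x hx => by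
    by_contra h
    exact hx (by rw [hχ0 x (not_le.1 h), zero_mul])
  obtain ⟨Φ, hΦ, hΦj⟩ := hstr (fun x => χ x * (t⁻¹ * g (t • x) - x j)) (hχ.mul hw) hs1 fun x => by
    by_cases hx : ‖x‖ ≤ 1
    · obtain ⟨h2, h3⟩ := hball _ (hmem x hx)
      rw [pd_mul (diff_of_smooth hχ) (diff_of_smooth hw),
        pd_sub (diff_of_smooth (contDiff_const.mul hgt)) (diff_of_smooth (contDiff_coord j)),
        pd_const_mul (diff_of_smooth hgt), pd_comp_smul (diff_of_smooth hg),
        pd_coord_same (φ := fun t => t) differentiable_id, deriv_id'',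
        inv_mul_cancel_left₀ ht0.ne']
      have h4 : |t⁻¹ * g (t • x) - x j| ≤ c / (2 * C) := by
        have e : t⁻¹ * g (t • x) - x j = t⁻¹ * (g (t • x) - (t • x) j) := by
          rw [PiLp.smul_apply, smul_eq_mul]; field_simp
        rw [e, abs_mul, abs_of_pos (inv_pos.2 ht0), inv_mul_le_iff₀ ht0]
        refine h2.trans ?_
        rw [norm_smul, Real.norm_eq_abs, abs_of_pos ht0]
        have : 0 < c / (2 * C) := by positivity
        have : t * ‖x‖ ≤ t := by nlinarith
        nlinarith
      have h5 : |χ x * (pd j g (t • x) - 1)| ≤ 1 * (c / 2) := by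
        rw [abs_mul]
        exact mul_le_mul (hχ1 x) h3.le (abs_nonneg _) zero_le_one
      have h6 : |(t⁻¹ * g (t • x) - x j) * pd j χ x| ≤ c / (2 * C) * C := by
        rw [abs_mul]
        exact mul_le_mul h4 (hC x) (abs_nonneg _) (by positivity)
      have h7 : c / (2 * C) * C = c / 2 := by field_simp
      refine (abs_add_le _ _).trans ?_
      linarith
    · rw [pd_eq_zero, abs_zero]
      · exact hc.le
      · intro h
        have h8 : tsupport (fun x => χ x * (t⁻¹ * g (t • x) - x j)) ⊆ Metric.closedBall 0 1 :=
          closure_minimal (fun y hy => by simpa using hs1 y hy) Metric.isClosed_closedBall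
        exact hx (by simpa using h8 h)
  obtain ⟨Ψ, hΨ, hl, hr⟩ := diffeo_inv hΦ
  have hev : ∀ᶠ z in nhds (Φ 0), ‖Ψ z‖ < 1 / 2 := by
    have := (hΨ.1.continuous.norm).tendsto (Φ 0)
    rw [hl 0, norm_zero] at this
    exact this.eventually (gt_mem_nhds (by norm_num))
  obtain ⟨ρ, hρ, hρb⟩ := Metric.eventually_nhds_iff_ball.1 hev
  have hstraight : ∀ z ∈ Metric.ball (Φ 0) ρ, t⁻¹ * g (t • Ψ z) = z j := by
    intro z hz
    have h2 := hρb z hz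
    have h3 := hΦj (Ψ z) (by linarith)
    rw [hr z, χ.one_of_mem_closedBall (by rw [mem_closedBall_zero_iff]; exact h2.le), one_mul] at h3
    linarith
  set σ := ρ / (2 * R) with hσ
  have hσ0 : 0 < σ := by positivity
  have hσR : σ * R = ρ / 2 := by rw [hσ]; field_simp
  have key : Flex (fun x => σ⁻¹ * (t⁻¹ * g (t • Ψ (Φ 0 + σ • x)) + 0) + -(σ⁻¹ * Φ 0 j)) := by
    refine hflex _ fun x hx => ?_
    rw [hstraight]
    · rw [PiLp.add_apply, PiLp.smul_apply, smul_eq_mul]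
      field_simp
      ring
    · rw [Metric.mem_ball, dist_eq_norm, add_sub_cancel_left, norm_smul, Real.norm_eq_abs,
        abs_of_pos hσ0]
      nlinarith
  have k1 : Flex (fun x => g (t • Ψ (Φ 0 + σ • x))) := (key.affine (by positivity)).affine
    (by positivity)
  have k2 : Flex (fun x => g (t • Ψ x)) := Flex.of_smul hσ0.ne' (Φ 0) k1
  have k3 : Flex (fun x => g (t • x)) := Flex.of_comp hΨ k2
  exact Flex.of_smul ht0.ne' 0 (by simpa using k3)

theorem flex_of_fderiv_ne_zero (hd : 2 ≤ d) {u : V d → ℝ} (hu : ContDiff ℝ (⊤ : ℕ∞) u) {p : V d}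
    (hp : fderiv ℝ u p ≠ 0) : Flex u := by
  set φ := fderiv ℝ u p with hφ
  obtain ⟨j, hj⟩ : ∃ j, φ (ev j) ≠ 0 := by
    by_contra! h
    refine hp (ContinuousLinearMap.coe_injective
      ((EuclideanSpace.basisFun (Fin d) ℝ).toBasis.ext fun k => ?_))
    simpa [ev] using h k
  set α := φ (ev j) with hα
  let θ : V d →L[ℝ] ℝ := EuclideanSpace.proj j - α⁻¹ • φ
  have hθ : θ (ev j) = 0 := by simp [θ, ← hα, hj]
  have hθ' : ∀ x, α * θ x = α * x j - φ x := fun x => by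
    simp only [θ, sub_apply, smul_apply, smul_eq_mul,
      PiLp.proj_apply]
    field_simp
  let L : V d ≃L[ℝ] V d := ContinuousLinearEquiv.equivOfInverse
    (ContinuousLinearMap.id ℝ (V d) + θ.smulRight (ev j))
    (ContinuousLinearMap.id ℝ (V d) - θ.smulRight (ev j))
    (fun x => by simp [hθ]) (fun x => by simp [hθ])
  have hL : ∀ x, φ (L x) = α * x j := fun x => by
    have : L x = x + θ x • ev j := rfl
    rw [this, map_add, map_smul, smul_eq_mul, ← hα, mul_comm, hθ']
    ring
  have hLs : ContDiff ℝ (⊤ : ℕ∞) (fun x => u (p + L x)) := hu.comp (contDiff_const.add L.contDiff)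
  have key : Flex (fun x => α⁻¹ * u (p + L x) + -(α⁻¹ * u p)) := by
    refine flex_of_fderiv_eq_coord hd j ((contDiff_const.mul hLs).add contDiff_const)
      (by simp) ?_
    have h1 : HasFDerivAt (fun x => p + L x) (L : V d →L[ℝ] V d) 0 :=
      (L : V d →L[ℝ] V d).hasFDerivAt.const_add p
    have h2 : HasFDerivAt u φ (p + L 0) := by
      rw [map_zero, add_zero]
      exact (hu.differentiable (by simp) p).hasFDerivAt
    refine (((h2.comp (0 : V d) h1).const_mul α⁻¹).add_const _).congr_fderiv ?_
    ext x
    simp [hL, hj]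
  exact (key.affine (inv_ne_zero hj)).of_conj

theorem flex_of_ne (hd : 2 ≤ d) {u : V d → ℝ} (hu : ContDiff ℝ (⊤ : ℕ∞) u)
    (h : ∃ x y, u x ≠ u y) : Flex u := by
  by_contra hne
  obtain ⟨x, y, hxy⟩ := h
  refine hxy (is_const_of_fderiv_eq_zero (𝕜 := ℝ) (hu.differentiable (by simp)) (fun p => ?_) x y)
  by_contra hp
  exact hne (flex_of_fderiv_ne_zero hd hu hp)

end Flexibility

/-- **Main flexibility theorem for `(ℝ^{2n}, ω_std)`.** For a smooth non-constant
`u`, there is `C = C(u) > 0` such that every smooth compactly supported zero-mean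
`f` with `‖f‖_∞ + ‖f‖_{L¹} ≤ 1` can be written as
`∑_{i=1}^ℓ c_i · (u ∘ Φ_{i,+} − u ∘ Φ_{i,-})` with `∑ |c_i| ≤ C` and the `Φ_{i,±}`
compactly supported volume-preserving diffeomorphisms. -/
theorem main_flexibility (n : ℕ) (hn : 1 ≤ n)
    (u : EuclideanSpace ℝ (Fin (2 * n)) → ℝ)
    (hu_smooth : ContDiff ℝ (⊤ : ℕ∞) u)
    (hu_nonconst : ∃ x y, u x ≠ u y) :
    ∃ C : ℝ, 0 < C ∧
      ∀ f : EuclideanSpace ℝ (Fin (2 * n)) → ℝ,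
        ContDiff ℝ (⊤ : ℕ∞) f → HasCompactSupport f → (∫ x, f x) = 0 →
        (⨆ x, |f x|) + (∫ x, |f x|) ≤ 1 →
        ∃ (ℓ : ℕ) (c : Fin ℓ → ℝ)
          (Φp Φm : Fin ℓ → (EuclideanSpace ℝ (Fin (2 * n)) → EuclideanSpace ℝ (Fin (2 * n)))),
          (∑ i, |c i|) ≤ C ∧
          (∀ i, IsCompSuppVolDiffeo (2 * n) (Φp i)) ∧
          (∀ i, IsCompSuppVolDiffeo (2 * n) (Φm i)) ∧
          f = fun x => ∑ i, c i * (u (Φp i x) - u (Φm i x)) := by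
  obtain ⟨C, hC, h⟩ := Flexibility.flex_of_ne (by omega) hu_smooth hu_nonconst
  refine ⟨C, hC, fun f hf hfc hf0 hf1 => ?_⟩
  obtain ⟨B, -, hB⟩ := Flexibility.exists_bound hf.continuous hfc
  obtain ⟨ι, _, c, P, M, hc, hP, hM, hfeq⟩ := h f hf hfc hf0 (⨆ x, |f x|) fun x =>
    le_ciSup (f := fun x => |f x|) ⟨B, by rintro _ ⟨y, rfl⟩; exact hB y⟩ x
  let e := (Fintype.equivFin ι).symm
  refine ⟨Fintype.card ι, fun i => c (e i), fun i => P (e i), fun i => M (e i), ?_,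
    fun i => hP _, fun i => hM _, funext fun x => ?_⟩
  · rw [e.sum_comp fun i => |c i|]
    exact hc.trans (mul_le_of_le_one_right hC.le hf1)
  · rw [hfeq x]
    exact (e.sum_comp fun i => c i * (u (P i x) - u (M i x))).symm
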